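/- For every finite set S of N points in the plane in general position, the number of crossing-free straight-edge perfect matchings of S satisfies pm(S) ≤ 8 · (3/2)^{N/4} · tr(S), where tr(S) is the number of triangulations of S; in particular pm(S) = O(1.1067^N) · tr(S). -/

import Mathlib

open scoped Classical

noncomputable section

/-- Points of the plane. -/
abbrev Pt : Type := ℝ × ℝ

/-- A finite point set is in general position if no three of its points are collinear. -/
def GenPos (S : Finset Pt) : Prop :=
  ∀ p ∈ S, ∀ q ∈ S, ∀ r ∈ S, p ≠ q → p ≠ r → q ≠ r →
    ¬ Collinear ℝ ({p, q, r} : Set Pt)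

/-- The closed straight segment spanned by an unordered pair of points. -/
def seg2 (e : Sym2 Pt) : Set Pt :=
  Sym2.lift ⟨fun p q => segment ℝ p q, fun p q => segment_symm ℝ p q⟩ e

/-- A crossing-free straight-edge graph (plane graph) on the point set `S`:
its edges are straight segments between points of `S`, any two of which
meet only at shared endpoints. -/
structure PlaneGraph (S : Finset Pt) where
  edges : Finset (Sym2 Pt)
  endpoint_mem : ∀ e ∈ edges, ∀ p, p ∈ e → p ∈ S
  not_isDiag : ∀ e ∈ edges, ¬ e.IsDiag
  noncrossing : ∀ e₁ ∈ edges, ∀ e₂ ∈ edges, e₁ ≠ e₂ →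
    ∀ x ∈ seg2 e₁ ∩ seg2 e₂, x ∈ e₁ ∧ x ∈ e₂

/-- A triangulation of `S` is a maximal plane graph on `S`. -/
def IsTriangulation {S : Finset Pt} (T : PlaneGraph S) : Prop :=
  ∀ G : PlaneGraph S, T.edges ⊆ G.edges → G.edges = T.edges

/-- `tr S`: the number of triangulations of `S`. -/
def triCount (S : Finset Pt) : ℕ :=
  Nat.card {T : PlaneGraph S // IsTriangulation T}

/-- A plane graph is a spanning cycle of `S` if its edges form a Hamiltonian
cycle on `S`. -/
def IsSpanningCycle {S : Finset Pt} (G : PlaneGraph S) : Prop :=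
  3 ≤ S.card ∧ ∃ f : Fin S.card ≃ {p : Pt // p ∈ S},
    G.edges =
      Finset.image (fun i : Fin S.card => s(((f i : Pt)), ((f (finRotate S.card i) : Pt)))) Finset.univ

/-- `sc S`: the number of crossing-free straight-edge spanning cycles of `S`. -/
def scCount (S : Finset Pt) : ℕ :=
  Nat.card {G : PlaneGraph S // IsSpanningCycle G}

/-- A plane graph is a perfect matching of `S` if every point of `S` is incident
to exactly one edge. -/
def IsPerfectMatching {S : Finset Pt} (G : PlaneGraph S) : Prop :=
  ∀ p ∈ S, ∃! e, e ∈ G.edges ∧ p ∈ e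

/-- `pm S`: the number of crossing-free straight-edge perfect matchings of `S`. -/
def pmCount (S : Finset Pt) : ℕ :=
  Nat.card {G : PlaneGraph S // IsPerfectMatching G}

/-- The support of a plane graph `G` on `S`: the number of triangulations of `S`
containing all edges of `G`. -/
def supp {S : Finset Pt} (G : PlaneGraph S) : ℕ :=
  Nat.card {T : PlaneGraph S // IsTriangulation T ∧ G.edges ⊆ T.edges}

/-- A finite set of points is in (strictly) convex position. -/
def InConvexPosition (Q : Finset Pt) : Prop :=
  ∀ p ∈ Q, p ∉ convexHull ℝ (↑(Q.erase p) : Set Pt)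

/-- `p q` is an edge of the convex hull boundary of `Q`. -/
def IsHullEdgeOf (Q : Finset Pt) (p q : Pt) : Prop :=
  p ∈ Q ∧ q ∈ Q ∧ p ≠ q ∧
    segment ℝ p q ⊆ frontier (convexHull ℝ (Q : Set Pt))

/-- `e` is a diagonal of the convex polygon with vertex set `Q`. -/
def IsDiagonalOf (Q : Finset Pt) (e : Sym2 Pt) : Prop :=
  ∃ p ∈ Q, ∃ q ∈ Q, e = s(p, q) ∧
    openSegment ℝ p q ⊆ interior (convexHull ℝ (Q : Set Pt))

/-- `F` is a set of ps-flippable (pseudo-simultaneously flippable) edges of the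
triangulation `T`: the edges of `F` are diagonals of pairwise interior-disjoint
(empty) convex polygons whose boundary edges all belong to `T`. -/
def IsPsFlippable {S : Finset Pt} (T : PlaneGraph S) (F : Finset (Sym2 Pt)) : Prop :=
  F ⊆ T.edges ∧
  ∃ 𝒬 : Finset (Finset Pt),
    (∀ Q ∈ 𝒬, ↑Q ⊆ (S : Set Pt) ∧ 3 ≤ Q.card ∧ InConvexPosition Q ∧
      (∀ p q, IsHullEdgeOf Q p q → s(p, q) ∈ T.edges) ∧
      (∀ p ∈ S, p ∉ interior (convexHull ℝ (Q : Set Pt)))) ∧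
    (∀ Q ∈ 𝒬, ∀ Q' ∈ 𝒬, Q ≠ Q' →
      interior (convexHull ℝ (Q : Set Pt)) ∩ interior (convexHull ℝ (Q' : Set Pt)) = ∅) ∧
    (∀ e ∈ F, ∃ Q ∈ 𝒬, IsDiagonalOf Q e)

/-- The drawing of a plane graph: the union of its (closed) edge segments and
its vertex set. -/
def drawing {S : Finset Pt} (G : PlaneGraph S) : Set Pt :=
  (⋃ e ∈ G.edges, seg2 e) ∪ (S : Set Pt)

/-- A convex decomposition of `S`: a plane graph containing all convex hull
boundary edges, whose bounded faces are all convex, and with no isolated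
vertices. -/
def IsConvexDecomposition {S : Finset Pt} (D : PlaneGraph S) : Prop :=
  (∀ p q, IsHullEdgeOf S p q → s(p, q) ∈ D.edges) ∧
  (∀ x ∉ drawing D, Bornology.IsBounded (connectedComponentIn (drawing D)ᶜ x) →
    Convex ℝ (connectedComponentIn (drawing D)ᶜ x)) ∧
  (∀ p ∈ S, ∃ e ∈ D.edges, p ∈ e)

/-- `p` is an interior vertex of `S` (not on the convex hull boundary). -/
def InteriorVtx (S : Finset Pt) (p : Pt) : Prop :=
  p ∈ S ∧ p ∉ frontier (convexHull ℝ (S : Set Pt))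

/-- `p` has a valid triple of edges in `G`. -/
def IsValidAt {S : Finset Pt} (G : PlaneGraph S) (p : Pt) : Prop :=
  ∃ a ∈ S, ∃ b ∈ S, ∃ c ∈ S,
    p ∈ convexHull ℝ ({a, b, c} : Set Pt) ∧
    s(p, a) ∈ G.edges ∧ s(p, b) ∈ G.edges ∧ s(p, c) ∈ G.edges

/-- The degree of a point in a plane graph. -/
def degree {S : Finset Pt} (G : PlaneGraph S) (p : Pt) : ℕ :=
  (G.edges.filter (fun e => p ∈ e)).card

/-- `a b c` span a triangular face of the triangulation `T`. -/
def IsTriFace {S : Finset Pt} (T : PlaneGraph S) (a b c : Pt) : Prop :=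
  a ∈ S ∧ b ∈ S ∧ c ∈ S ∧
  s(a, b) ∈ T.edges ∧ s(b, c) ∈ T.edges ∧ s(a, c) ∈ T.edges ∧
  ∀ p ∈ S, p ∉ interior (convexHull ℝ ({a, b, c} : Set Pt))

/-- An edge of a triangulation is flippable if its two incident triangles form
a convex quadrilateral. -/
def IsFlippable {S : Finset Pt} (T : PlaneGraph S) (e : Sym2 Pt) : Prop :=
  e ∈ T.edges ∧ ∃ a b c d : Pt, e = s(a, b) ∧ c ≠ d ∧
    IsTriFace T a b c ∧ IsTriFace T a b d ∧
    (openSegment ℝ a b ∩ openSegment ℝ c d).Nonempty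

/-- `flip T`: the number of flippable edges of `T`. -/
def flipCount {S : Finset Pt} (T : PlaneGraph S) : ℕ :=
  (T.edges.filter (fun e => IsFlippable T e)).card

/-- `v3 T`: the number of interior vertices of degree 3 in `T`. -/
def v3 {S : Finset Pt} (T : PlaneGraph S) : ℕ :=
  (S.filter (fun p => p ∉ frontier (convexHull ℝ (S : Set Pt)) ∧ degree T p = 3)).card

/-- The number of vertices of `S` on its convex hull boundary. -/
def hullVtxCount (S : Finset Pt) : ℕ :=
  (S.filter (fun p => p ∈ frontier (convexHull ℝ (S : Set Pt)))).card

section PartA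

/-- Unnormalised Pfaffian. -/
def pfF {n : ℕ} (A : Matrix (Fin n ⊕ Fin n) (Fin n ⊕ Fin n) ℝ) : ℝ :=
  ∑ σ : Equiv.Perm (Fin n ⊕ Fin n), ((Equiv.Perm.sign σ : ℤ) : ℝ) *
    ∏ i : Fin n, A (σ (Sum.inl i)) (σ (Sum.inr i))

lemma pfF_congr {n : ℕ} (A B : Matrix (Fin n ⊕ Fin n) (Fin n ⊕ Fin n) ℝ) :
    pfF (B * A * B.transpose) = B.det * pfF A := by
  have h1 : ∀ x y, (B * A * B.transpose) x y =
      ∑ k : (Fin n ⊕ Fin n) × (Fin n ⊕ Fin n), B x k.1 * A k.1 k.2 * B y k.2 := by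
    intro x y
    rw [Fintype.sum_prod_type, Finset.sum_comm]
    simp only [Matrix.mul_apply, Matrix.transpose_apply, Finset.sum_mul]
  have h2 : ∀ f : (Fin n ⊕ Fin n) → (Fin n ⊕ Fin n),
      (∑ σ : Equiv.Perm (Fin n ⊕ Fin n), ((Equiv.Perm.sign σ : ℤ) : ℝ) * ∏ x, B (σ x) (f x))
        = (B.submatrix id f).det := by
    intro f
    rw [Matrix.det_apply']
    rfl
  let eqv : (Fin n → (Fin n ⊕ Fin n) × (Fin n ⊕ Fin n)) ≃ ((Fin n ⊕ Fin n) → (Fin n ⊕ Fin n)) :=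
    { toFun := fun g x => Sum.elim (fun i => (g i).1) (fun i => (g i).2) x
      invFun := fun f i => (f (Sum.inl i), f (Sum.inr i))
      left_inv := fun g => by ext i <;> simp
      right_inv := fun f => by ext x; cases x <;> simp }
  have h3 : pfF (B * A * B.transpose) = ∑ f : (Fin n ⊕ Fin n) → (Fin n ⊕ Fin n),
      (∏ i : Fin n, A (f (Sum.inl i)) (f (Sum.inr i))) * (B.submatrix id f).det := by
    unfold pfF
    simp_rw [h1]
    simp_rw [Finset.prod_univ_sum, Fintype.piFinset_univ]
    rw [← Equiv.sum_comp eqv]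
    simp_rw [← h2, Finset.mul_sum]
    rw [Finset.sum_comm]
    refine Finset.sum_congr rfl fun g _ => Finset.sum_congr rfl fun σ _ => ?_
    rw [Fintype.prod_sum_type]
    simp only [eqv, Equiv.coe_fn_mk, Sum.elim_inl, Sum.elim_inr, Finset.prod_mul_distrib]
    ring
  rw [h3]
  have h4 : ∑ f : (Fin n ⊕ Fin n) → (Fin n ⊕ Fin n),
      (∏ i : Fin n, A (f (Sum.inl i)) (f (Sum.inr i))) * (B.submatrix id f).det
      = ∑ τ : Equiv.Perm (Fin n ⊕ Fin n),
      (∏ i : Fin n, A (τ (Sum.inl i)) (τ (Sum.inr i))) * (B.submatrix id τ).det := by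
    symm
    refine Finset.sum_of_injOn (fun τ => (τ : (Fin n ⊕ Fin n) → (Fin n ⊕ Fin n))) ?_ ?_ ?_ ?_
    · intro a _ b _ h
      exact Equiv.coe_fn_injective h
    · intro a _
      simp
    · intro f _ hf
      have : ¬ Function.Injective f := by
        intro hi
        apply hf
        exact ⟨Equiv.ofBijective f ((Fintype.bijective_iff_injective_and_card f).2 ⟨hi, rfl⟩), by simp, rfl⟩
      simp only [Function.Injective, not_forall] at this
      obtain ⟨a, b, hab, hne⟩ := this
      rw [Matrix.det_zero_of_column_eq hne, mul_zero]
      intro k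
      simp [hab]
    · intro τ _
      rfl
  rw [h4, pfF, Finset.mul_sum]
  refine Finset.sum_congr rfl fun τ _ => ?_
  rw [Matrix.det_permute']
  ring

/-- A symplectic family for the skew matrix `A`. -/
def SympFam {m k : ℕ} (A : Matrix (Fin m ⊕ Fin m) (Fin m ⊕ Fin m) ℝ)
    (e f : Fin k → (Fin m ⊕ Fin m → ℝ)) : Prop :=
  (∀ i j, e i ⬝ᵥ A.mulVec (e j) = 0) ∧ (∀ i j, f i ⬝ᵥ A.mulVec (f j) = 0) ∧
    (∀ i j, e i ⬝ᵥ A.mulVec (f j) = if i = j then 1 else 0)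

lemma skew_form {ι : Type*} [Fintype ι] (A : Matrix ι ι ℝ) (hA : A.transpose = -A)
    (x y : ι → ℝ) : x ⬝ᵥ A.mulVec y = - (y ⬝ᵥ A.mulVec x) := by
  rw [Matrix.dotProduct_mulVec, ← Matrix.mulVec_transpose, hA, Matrix.neg_mulVec, neg_dotProduct,
    dotProduct_comm]

lemma sympFam_indep {m k : ℕ} (A : Matrix (Fin m ⊕ Fin m) (Fin m ⊕ Fin m) ℝ)
    (hA : A.transpose = -A)
    (e f : Fin k → (Fin m ⊕ Fin m → ℝ)) (h : SympFam A e f) :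
    LinearIndependent ℝ (Sum.elim e f) := by
  rw [Fintype.linearIndependent_iff]
  intro g hg
  obtain ⟨h1, h2, h3⟩ := h
  have key : ∀ y, ∑ x, g x * (y ⬝ᵥ A.mulVec (Sum.elim e f x)) = 0 := by
    intro y
    have : y ⬝ᵥ A.mulVec (∑ x, g x • Sum.elim e f x) = 0 := by rw [hg]; simp
    rw [Matrix.mulVec_sum, dotProduct_sum] at this
    simpa [Matrix.mulVec_smul, dotProduct_smul] using this
  rintro (i | i)
  · have := key (f i)
    rw [Fintype.sum_sum_type] at this
    simp only [Sum.elim_inl, Sum.elim_inr, h2, mul_zero, Finset.sum_const_zero, add_zero] at this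
    simp_rw [skew_form A hA (f i), h3] at this
    simpa using this
  · have := key (e i)
    rw [Fintype.sum_sum_type] at this
    simp only [Sum.elim_inl, Sum.elim_inr, h1, mul_zero, Finset.sum_const_zero, zero_add, h3] at this
    simpa using this

lemma exists_symp {m : ℕ} (A : Matrix (Fin m ⊕ Fin m) (Fin m ⊕ Fin m) ℝ)
    (hA : A.transpose = -A) (hdet : A.det ≠ 0) (k : ℕ) (hk : k ≤ m) :
    ∃ e f : Fin k → (Fin m ⊕ Fin m → ℝ), SympFam A e f := by
  induction k with
  | zero => exact ⟨fun i => i.elim0, fun i => i.elim0, fun i => i.elim0, fun i => i.elim0, fun i => i.elim0⟩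
  | succ k ih =>
    obtain ⟨e, f, h⟩ := ih (by omega)
    have hself : ∀ x, x ⬝ᵥ A.mulVec x = 0 := fun x => by linarith [skew_form A hA x x]
    have hfin : Module.finrank ℝ (Submodule.span ℝ (Set.range (Sum.elim e f))) = 2 * k := by
      rw [finrank_span_eq_card (sympFam_indep A hA e f h)]; simp; ring
    have hne : Submodule.span ℝ (Set.range (Sum.elim e f)) ≠ ⊤ := by
      intro ht
      rw [ht, finrank_top] at hfin
      simp at hfin
      omega
    obtain ⟨v, hv⟩ : ∃ v, v ∉ Submodule.span ℝ (Set.range (Sum.elim e f)) := by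
      by_contra hcon
      push Not at hcon
      exact hne (by rw [eq_top_iff]; intro x _; exact hcon x)
    obtain ⟨h1, h2, h3⟩ := h
    have h4 : ∀ i j, f i ⬝ᵥ A.mulVec (e j) = if i = j then -1 else 0 := by
      intro i j
      rw [skew_form A hA, h3]
      by_cases hij : i = j
      · simp [hij]
      · simp [hij, Ne.symm hij]
    let proj : (Fin m ⊕ Fin m → ℝ) → (Fin m ⊕ Fin m → ℝ) := fun v =>
      v + ∑ j, ((f j ⬝ᵥ A.mulVec v) • e j) - ∑ j, ((e j ⬝ᵥ A.mulVec v) • f j)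
    have pe : ∀ v i, e i ⬝ᵥ A.mulVec (proj v) = 0 := by
      intro v i
      simp only [proj, Matrix.mulVec_add, Matrix.mulVec_sub, dotProduct_add, dotProduct_sub,
        Matrix.mulVec_sum, dotProduct_sum, Matrix.mulVec_smul, dotProduct_smul, h1, h3]
      simp
    have pf : ∀ v i, f i ⬝ᵥ A.mulVec (proj v) = 0 := by
      intro v i
      simp only [proj, Matrix.mulVec_add, Matrix.mulVec_sub, dotProduct_add, dotProduct_sub,
        Matrix.mulVec_sum, dotProduct_sum, Matrix.mulVec_smul, dotProduct_smul, h2, h4]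
      simp
    have hv' : proj v ≠ 0 := by
      intro h0
      apply hv
      have : v = (∑ j, ((e j ⬝ᵥ A.mulVec v) • f j)) - ∑ j, ((f j ⬝ᵥ A.mulVec v) • e j) := by
        have h0' : v + ∑ j, ((f j ⬝ᵥ A.mulVec v) • e j) - ∑ j, ((e j ⬝ᵥ A.mulVec v) • f j) = 0 := h0
        rw [sub_eq_zero] at h0'
        rw [← h0']; abel
      rw [this]
      refine Submodule.sub_mem _ ?_ ?_
      · exact Submodule.sum_mem _ fun j _ => Submodule.smul_mem _ _ (Submodule.subset_span ⟨Sum.inr j, rfl⟩)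
      · exact Submodule.sum_mem _ fun j _ => Submodule.smul_mem _ _ (Submodule.subset_span ⟨Sum.inl j, rfl⟩)
    -- find u
    obtain ⟨u, hu⟩ : ∃ u, proj v ⬝ᵥ A.mulVec u ≠ 0 := by
      by_contra hcon
      push Not at hcon
      apply hv'
      have : Matrix.vecMul (proj v) A = 0 := by
        apply dotProduct_eq
        intro w
        rw [← Matrix.dotProduct_mulVec, hcon]; simp
      exact Matrix.eq_zero_of_vecMul_eq_zero hdet this
    set c := proj v ⬝ᵥ A.mulVec u with hc
    have hpu : proj v ⬝ᵥ A.mulVec (proj u) = c := by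
      have z1 : ∀ i, proj v ⬝ᵥ A.mulVec (e i) = 0 := fun i => by rw [skew_form A hA, pe]; simp
      have z2 : ∀ i, proj v ⬝ᵥ A.mulVec (f i) = 0 := fun i => by rw [skew_form A hA, pf]; simp
      have hu' : proj u = u + ∑ j, ((f j ⬝ᵥ A.mulVec u) • e j) - ∑ j, ((e j ⬝ᵥ A.mulVec u) • f j) := rfl
      rw [hu']
      simp only [Matrix.mulVec_add, Matrix.mulVec_sub, dotProduct_add, dotProduct_sub,
        Matrix.mulVec_sum, dotProduct_sum, Matrix.mulVec_smul, dotProduct_smul, z1, z2]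
      simp [hc]
    refine ⟨Fin.snoc e (proj v), Fin.snoc f (c⁻¹ • proj u), ?_, ?_, ?_⟩
    · intro i j
      refine Fin.lastCases ?_ (fun i => ?_) i <;> refine Fin.lastCases ?_ (fun j => ?_) j
      · simp [hself]
      · simp; rw [skew_form A hA, pe]; simp
      · simp [pe]
      · simp [h1]
    · intro i j
      refine Fin.lastCases ?_ (fun i => ?_) i <;> refine Fin.lastCases ?_ (fun j => ?_) j
      · simp [hself, Matrix.mulVec_smul]
      · simp; right; rw [skew_form A hA, pf]; simp
      · simp [pf, Matrix.mulVec_smul]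
      · simp [h2]
    · intro i j
      refine Fin.lastCases ?_ (fun i => ?_) i <;> refine Fin.lastCases ?_ (fun j => ?_) j
      · simp [Matrix.mulVec_smul, hpu, hu]
      · have : Fin.last k ≠ j.castSucc := (Fin.castSucc_lt_last j).ne'
        simp [this]; rw [skew_form A hA, pf]; simp
      · have : i.castSucc ≠ Fin.last k := (Fin.castSucc_lt_last i).ne
        simp [pe, Matrix.mulVec_smul, this]
      · simp [h3]

/-- The standard symplectic matrix. -/
def Jstd (n : ℕ) : Matrix (Fin n ⊕ Fin n) (Fin n ⊕ Fin n) ℝ :=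
  Matrix.fromBlocks 0 1 (-1) 0

lemma Jstd_det_sq (n : ℕ) : (Jstd n).det = 1 := by
  have : Jstd n = Matrix.fromBlocks 1 1 0 1 * Matrix.fromBlocks 1 0 (-1) 1 *
      Matrix.fromBlocks 1 1 0 1 := by
    rw [Matrix.fromBlocks_multiply, Matrix.fromBlocks_multiply]
    simp [Jstd]
  rw [this, Matrix.det_mul, Matrix.det_mul, Matrix.det_fromBlocks_zero₂₁,
    Matrix.det_fromBlocks_zero₁₂]
  simp

lemma pfF_sq {n : ℕ} (A : Matrix (Fin n ⊕ Fin n) (Fin n ⊕ Fin n) ℝ) (hA : A.transpose = -A) :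
    pfF A ^ 2 = A.det * pfF (Jstd n) ^ 2 := by
  by_cases hdet : A.det = 0
  · rw [hdet, zero_mul]
    obtain ⟨u, hu0, hu⟩ := Matrix.exists_vecMul_eq_zero_iff.2 hdet
    obtain ⟨i0, hi0⟩ : ∃ i, u i ≠ 0 := by
      by_contra hcon; push Not at hcon; exact hu0 (funext hcon)
    set B : Matrix (Fin n ⊕ Fin n) (Fin n ⊕ Fin n) ℝ := Matrix.updateRow 1 i0 u with hB
    have hBd : B.det = u i0 := by
      rw [hB, ← Matrix.cramer_transpose_apply]; simp
    have hrow : ∀ y, (B * A * B.transpose) i0 y = 0 := by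
      intro y
      rw [Matrix.mul_apply]
      apply Finset.sum_eq_zero
      intro z _
      have : (B * A) i0 z = Matrix.vecMul u A z := by
        rw [Matrix.mul_apply]; simp [hB, Matrix.vecMul, dotProduct]
      rw [this, hu]; simp
    have hsk : (B * A * B.transpose).transpose = -(B * A * B.transpose) := by
      simp [Matrix.transpose_mul, hA, Matrix.mul_assoc]
    have hcol : ∀ x, (B * A * B.transpose) x i0 = 0 := by
      intro x
      have := congrFun (congrFun hsk i0) x
      rw [Matrix.transpose_apply, Matrix.neg_apply, hrow] at this
      simpa using this
    have hz : pfF (B * A * B.transpose) = 0 := by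
      unfold pfF
      apply Finset.sum_eq_zero
      intro σ _
      rw [mul_eq_zero]; right
      rcases hs : σ.symm i0 with i | i
      · apply Finset.prod_eq_zero (Finset.mem_univ i)
        rw [← hs, Equiv.apply_symm_apply]; exact hrow _
      · apply Finset.prod_eq_zero (Finset.mem_univ i)
        rw [← hs, Equiv.apply_symm_apply]; exact hcol _
    rw [pfF_congr, hBd] at hz
    have := (mul_eq_zero.1 hz).resolve_left hi0
    rw [this]; simp
  · obtain ⟨e, f, h1, h2, h3⟩ := exists_symp A hA hdet n le_rfl
    have h4 : ∀ i j, f i ⬝ᵥ A.mulVec (e j) = if i = j then -1 else 0 := by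
      intro i j
      rw [skew_form A hA, h3]
      by_cases hij : i = j
      · simp [hij]
      · simp [hij, Ne.symm hij]
    set B : Matrix (Fin n ⊕ Fin n) (Fin n ⊕ Fin n) ℝ := Matrix.of (Sum.elim e f) with hB
    have hBAB : B * A * B.transpose = Jstd n := by
      ext x y
      have : (B * A * B.transpose) x y = (Sum.elim e f x) ⬝ᵥ A.mulVec (Sum.elim e f y) := by
        rw [Matrix.mul_assoc, Matrix.mul_apply]
        rfl
      rw [this]
      rcases x with i | i <;> rcases y with j | j <;>
        simp [Jstd, h1, h2, h3, h4, Matrix.one_apply]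
      split_ifs <;> simp
    have hd : B.det ^ 2 * A.det = 1 := by
      rw [← Jstd_det_sq n, ← hBAB]; simp; ring
    rw [← hBAB, pfF_congr]
    linear_combination (-(pfF A)^2) * hd

end PartA

section PartB

lemma prod_prod_split {n : ℕ} (h : Fin n → Fin n → ℝ) :
    ∏ i, ∏ j, h i j = (∏ i, h i i) * ∏ i, ∏ j, if i < j then h i j * h j i else 1 := by
  have h1 : ∀ i j, h i j = (if i < j then h i j else 1) * (if j < i then h i j else 1) *
      (if i = j then h i j else 1) := by
    intro i j
    rcases lt_trichotomy i j with hh | hh | hh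
    · simp [hh, hh.not_gt, hh.ne]
    · simp [hh]
    · simp [hh, hh.not_gt, hh.ne']
  have h2 : ∀ i j, (if i < j then h i j * h j i else 1) =
      (if i < j then h i j else 1) * (if i < j then h j i else 1) := by
    intro i j; split_ifs <;> simp
  have e1 : ∏ i, ∏ j, h i j = ∏ i, ∏ j, ((if i < j then h i j else 1) *
      (if j < i then h i j else 1) * (if i = j then h i j else 1)) :=
    Finset.prod_congr rfl fun i _ => Finset.prod_congr rfl fun j _ => h1 i j
  rw [e1]
  simp_rw [h2, Finset.prod_mul_distrib]
  have e2 : ∏ i, ∏ j, (if i = j then h i j else 1) = ∏ i, h i i := by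
    refine Finset.prod_congr rfl fun i _ => ?_
    simp
  have e3 : ∏ i, ∏ j, (if j < i then h i j else 1) = ∏ i, ∏ j, (if i < j then h j i else 1) := by
    rw [Finset.prod_comm]
  rw [e2, e3]; ring

/-- The block product. -/
def blockQ {n : ℕ} (f : (Fin n ⊕ Fin n) → (Fin n ⊕ Fin n) → ℝ)
    (σ : Equiv.Perm (Fin n ⊕ Fin n)) : ℝ :=
  (∏ i, f (σ (Sum.inl i)) (σ (Sum.inr i))) * ∏ i, ∏ j, if i < j then
    f (σ (Sum.inl i)) (σ (Sum.inl j)) * f (σ (Sum.inr i)) (σ (Sum.inr j)) *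
    f (σ (Sum.inl i)) (σ (Sum.inr j)) * f (σ (Sum.inl j)) (σ (Sum.inr i)) else 1

lemma blockQ_sum {n : ℕ} (f : (Fin n ⊕ Fin n) → (Fin n ⊕ Fin n) → ℝ)
    (σ : Equiv.Perm (Fin n ⊕ Fin n)) :
    blockQ f σ = ∏ x : Fin (n + n), ∏ y ∈ Finset.Ioi x,
      f (σ (finSumFinEquiv.symm x)) (σ (finSumFinEquiv.symm y)) := by
  have e1 : ∀ x : Fin (n+n), ∏ y ∈ Finset.Ioi x,
      f (σ (finSumFinEquiv.symm x)) (σ (finSumFinEquiv.symm y)) =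
      ∏ y, if x < y then f (σ (finSumFinEquiv.symm x)) (σ (finSumFinEquiv.symm y)) else 1 := by
    intro x
    rw [← Finset.prod_filter]
    congr 1
    ext y; simp
  simp_rw [e1]
  rw [← Equiv.prod_comp finSumFinEquiv]
  simp_rw [← Equiv.prod_comp finSumFinEquiv (fun y => if (_ : Fin (n+n)) < y then f _ (σ (finSumFinEquiv.symm y)) else 1)]
  simp only [Fintype.prod_sum_type, Equiv.symm_apply_apply]
  have c1 : ∀ i j : Fin n, (finSumFinEquiv (Sum.inl i : Fin n ⊕ Fin n) < finSumFinEquiv (Sum.inl j : Fin n ⊕ Fin n)) ↔ i < j := by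
    intro i j; rw [Fin.lt_def, Fin.lt_def]; simp
  have c2 : ∀ i j : Fin n, (finSumFinEquiv (Sum.inr i : Fin n ⊕ Fin n) < finSumFinEquiv (Sum.inr j : Fin n ⊕ Fin n)) ↔ i < j := by
    intro i j; rw [Fin.lt_def, Fin.lt_def]; simp
  have c3 : ∀ i j : Fin n, (finSumFinEquiv (Sum.inl i : Fin n ⊕ Fin n) < finSumFinEquiv (Sum.inr j : Fin n ⊕ Fin n)) ↔ True := by
    intro i j; simp [Fin.lt_def]; omega
  have c4 : ∀ i j : Fin n, (finSumFinEquiv (Sum.inr i : Fin n ⊕ Fin n) < finSumFinEquiv (Sum.inl j : Fin n ⊕ Fin n)) ↔ False := by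
    intro i j; simp [Fin.lt_def]; omega
  simp_rw [c1, c2, c3, c4]
  simp only [if_true, if_false, Finset.prod_const_one, one_mul, Finset.prod_mul_distrib]
  rw [prod_prod_split (fun i j => f (σ (Sum.inl i)) (σ (Sum.inr j)))]
  unfold blockQ
  have : ∀ i j : Fin n, (if i < j then
    f (σ (Sum.inl i)) (σ (Sum.inl j)) * f (σ (Sum.inr i)) (σ (Sum.inr j)) *
    f (σ (Sum.inl i)) (σ (Sum.inr j)) * f (σ (Sum.inl j)) (σ (Sum.inr i)) else 1) =
    (if i < j then f (σ (Sum.inl i)) (σ (Sum.inl j)) else 1) *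
    (if i < j then f (σ (Sum.inr i)) (σ (Sum.inr j)) else 1) *
    (if i < j then f (σ (Sum.inl i)) (σ (Sum.inr j)) * f (σ (Sum.inl j)) (σ (Sum.inr i)) else 1) := by
    intro i j; split_ifs <;> ring
  simp_rw [this, Finset.prod_mul_distrib]
  ring

lemma blockQ_sign {n : ℕ} (f : (Fin n ⊕ Fin n) → (Fin n ⊕ Fin n) → ℝ)
    (hf : ∀ x y, f x y = - f y x)
    (σ : Equiv.Perm (Fin n ⊕ Fin n)) :
    blockQ f σ = ((Equiv.Perm.sign σ : ℤ) : ℝ) * blockQ f 1 := by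
  rw [blockQ_sum, blockQ_sum]
  have := Equiv.Perm.prod_Ioi_comp_eq_sign_mul_prod (finSumFinEquiv.permCongr σ)
    (f := fun x y => f (finSumFinEquiv.symm x) (finSumFinEquiv.symm y)) (fun i j => hf _ _)
  simpa using this

/-- All nonzero terms of the Pfaffian have the same sign. -/
def SignConst {n : ℕ} (A : Matrix (Fin n ⊕ Fin n) (Fin n ⊕ Fin n) ℝ) : Prop :=
  ∃ η : ℝ, η ^ 2 = 1 ∧ ∀ σ : Equiv.Perm (Fin n ⊕ Fin n),
    (∀ i, A (σ (Sum.inl i)) (σ (Sum.inr i)) ≠ 0) →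
    ((Equiv.Perm.sign σ : ℤ) : ℝ) * ∏ i, A (σ (Sum.inl i)) (σ (Sum.inr i)) = η

lemma signConst_of_local {n : ℕ} (A : Matrix (Fin n ⊕ Fin n) (Fin n ⊕ Fin n) ℝ)
    (f : (Fin n ⊕ Fin n) → (Fin n ⊕ Fin n) → ℝ)
    (bel : (Fin n ⊕ Fin n) → (Fin n ⊕ Fin n) → (Fin n ⊕ Fin n) → ℝ)
    (hf : ∀ x y, f x y = - f y x) (hf1 : ∀ x y, x ≠ y → f x y ^ 2 = 1)
    (hb1 : ∀ x y, bel x y x = 1) (hb2 : ∀ x y, bel x y y = 1)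
    (hA : ∀ x y, A x y ≠ 0 → A x y = f x y * ∏ u, bel x y u)
    (hloc : ∀ p₁ q₁ p₂ q₂, p₁ ≠ q₁ → p₁ ≠ p₂ → p₁ ≠ q₂ → q₁ ≠ p₂ → q₁ ≠ q₂ → p₂ ≠ q₂ →
      A p₁ q₁ ≠ 0 → A p₂ q₂ ≠ 0 →
      f p₁ p₂ * f q₁ q₂ * f p₁ q₂ * f p₂ q₁ *
        (bel p₁ q₁ p₂ * bel p₁ q₁ q₂ * bel p₂ q₂ p₁ * bel p₂ q₂ q₁) = -1) : SignConst A := by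
  have hQ1 : blockQ f 1 ^ 2 = 1 := by
    unfold blockQ
    rw [mul_pow, ← Finset.prod_pow, ← Finset.prod_pow]
    simp_rw [← Finset.prod_pow]
    rw [Finset.prod_eq_one, Finset.prod_eq_one, one_mul]
    · intro i _
      apply Finset.prod_eq_one
      intro j _
      split_ifs with hij
      · have a1 := hf1 (Sum.inl i) (Sum.inl j) (by simp [hij.ne])
        have a2 := hf1 (Sum.inr i) (Sum.inr j) (by simp [hij.ne])
        have a3 := hf1 (Sum.inl i) (Sum.inr j) (by simp)
        have a4 := hf1 (Sum.inl j) (Sum.inr i) (by simp)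
        simp only [Equiv.Perm.coe_one, id, mul_pow, a1, a2, a3, a4, mul_one]
      · simp
    · intro i _
      exact hf1 _ _ (by simp)
  refine ⟨blockQ f 1 * ∏ i : Fin n, ∏ j : Fin n, (if i < j then (-1 : ℝ) else 1), ?_, ?_⟩
  · rw [mul_pow, hQ1, one_mul, ← Finset.prod_pow]
    apply Finset.prod_eq_one
    intro i _
    rw [← Finset.prod_pow]
    apply Finset.prod_eq_one
    intro j _
    split_ifs <;> simp
  · intro σ hσ
    have hs : ((Equiv.Perm.sign σ : ℤ) : ℝ) = blockQ f σ * blockQ f 1 := by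
      rw [blockQ_sign f hf σ, mul_assoc, ← sq, hQ1, mul_one]
    have hprod : ∏ i, A (σ (Sum.inl i)) (σ (Sum.inr i)) =
        (∏ i, f (σ (Sum.inl i)) (σ (Sum.inr i))) * ∏ i, ∏ j, if i < j then
          (bel (σ (Sum.inl i)) (σ (Sum.inr i)) (σ (Sum.inl j)) *
           bel (σ (Sum.inl i)) (σ (Sum.inr i)) (σ (Sum.inr j))) *
          (bel (σ (Sum.inl j)) (σ (Sum.inr j)) (σ (Sum.inl i)) *
           bel (σ (Sum.inl j)) (σ (Sum.inr j)) (σ (Sum.inr i))) else 1 := by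
      have : ∀ i, A (σ (Sum.inl i)) (σ (Sum.inr i)) = f (σ (Sum.inl i)) (σ (Sum.inr i)) *
          ∏ j, (bel (σ (Sum.inl i)) (σ (Sum.inr i)) (σ (Sum.inl j)) *
           bel (σ (Sum.inl i)) (σ (Sum.inr i)) (σ (Sum.inr j))) := by
        intro i
        rw [hA _ _ (hσ i)]
        congr 1
        rw [← Equiv.prod_comp σ, Fintype.prod_sum_type, Finset.prod_mul_distrib]
      rw [Finset.prod_congr rfl fun i _ => this i, Finset.prod_mul_distrib, prod_prod_split]
      congr 1
      rw [Finset.prod_eq_one, one_mul]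
      intro i _
      rw [hb1, hb2, one_mul]
    rw [hs, hprod]
    have hff : (∏ i, f (σ (Sum.inl i)) (σ (Sum.inr i))) ^ 2 = 1 := by
      rw [← Finset.prod_pow]
      apply Finset.prod_eq_one
      intro i _
      exact hf1 _ _ (by simp)
    have hmain : (∏ i, ∏ j, if i < j then
        f (σ (Sum.inl i)) (σ (Sum.inl j)) * f (σ (Sum.inr i)) (σ (Sum.inr j)) *
        f (σ (Sum.inl i)) (σ (Sum.inr j)) * f (σ (Sum.inl j)) (σ (Sum.inr i)) else 1) *
        (∏ i, ∏ j, if i < j then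
          (bel (σ (Sum.inl i)) (σ (Sum.inr i)) (σ (Sum.inl j)) *
           bel (σ (Sum.inl i)) (σ (Sum.inr i)) (σ (Sum.inr j))) *
          (bel (σ (Sum.inl j)) (σ (Sum.inr j)) (σ (Sum.inl i)) *
           bel (σ (Sum.inl j)) (σ (Sum.inr j)) (σ (Sum.inr i))) else 1) =
        ∏ i : Fin n, ∏ j : Fin n, (if i < j then (-1 : ℝ) else 1) := by
      rw [← Finset.prod_mul_distrib]
      refine Finset.prod_congr rfl fun i _ => ?_
      rw [← Finset.prod_mul_distrib]
      refine Finset.prod_congr rfl fun j _ => ?_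
      split_ifs with hij
      · rw [← hloc (σ (Sum.inl i)) (σ (Sum.inr i)) (σ (Sum.inl j)) (σ (Sum.inr j))
          (by simp) (by simp [hij.ne]) (by simp) (by simp) (by simp [hij.ne]) (by simp) (hσ i) (hσ j)]
        ring
      · simp
    rw [← hmain]
    generalize blockQ f 1 = Q1
    unfold blockQ
    linear_combination (Q1 * ((∏ i, ∏ j, if i < j then
        f (σ (Sum.inl i)) (σ (Sum.inl j)) * f (σ (Sum.inr i)) (σ (Sum.inr j)) *
        f (σ (Sum.inl i)) (σ (Sum.inr j)) * f (σ (Sum.inl j)) (σ (Sum.inr i)) else 1) *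
        (∏ i, ∏ j, if i < j then
          (bel (σ (Sum.inl i)) (σ (Sum.inr i)) (σ (Sum.inl j)) *
           bel (σ (Sum.inl i)) (σ (Sum.inr i)) (σ (Sum.inr j))) *
          (bel (σ (Sum.inl j)) (σ (Sum.inr j)) (σ (Sum.inl i)) *
           bel (σ (Sum.inl j)) (σ (Sum.inr j)) (σ (Sum.inr i))) else 1))) * hff

/-- Fixed-point-free involutions supported on the relation `A x y ≠ 0`. -/
def matchPerms {ι : Type} [Fintype ι] (A : Matrix ι ι ℝ) : Finset (Equiv.Perm ι) :=
  Finset.univ.filter fun μ => μ * μ = 1 ∧ ∀ x, μ x ≠ x ∧ A x (μ x) ≠ 0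

lemma pfF_eq_card {n : ℕ} (A : Matrix (Fin n ⊕ Fin n) (Fin n ⊕ Fin n) ℝ) (h : SignConst A) :
    pfF A ^ 2 = ((Finset.univ.filter fun σ : Equiv.Perm (Fin n ⊕ Fin n) =>
      ∀ i, A (σ (Sum.inl i)) (σ (Sum.inr i)) ≠ 0).card : ℝ) ^ 2 := by
  obtain ⟨η, h1, h2⟩ := h
  have : pfF A = ((Finset.univ.filter fun σ : Equiv.Perm (Fin n ⊕ Fin n) =>
      ∀ i, A (σ (Sum.inl i)) (σ (Sum.inr i)) ≠ 0).card : ℝ) * η := by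
    unfold pfF
    rw [← nsmul_eq_mul, ← Finset.sum_const, Finset.sum_filter]
    refine Finset.sum_congr rfl fun σ _ => ?_
    split_ifs with hh
    · exact h2 σ hh
    · push Not at hh
      obtain ⟨i, hi⟩ := hh
      rw [Finset.prod_eq_zero (Finset.mem_univ i) hi, mul_zero]
  rw [this, mul_pow, h1, mul_one]

lemma Jstd_signConst (n : ℕ) : SignConst (Jstd n) := by
  let κ : (Fin n ⊕ Fin n) → ℕ := Sum.elim (fun i => 2 * i.1) (fun i => 2 * i.1 + 1)
  have hκ : ∀ x y, κ x = κ y → x = y := by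
    rintro (⟨i, _⟩ | ⟨i, _⟩) (⟨j, _⟩ | ⟨j, _⟩) h <;> simp [κ] at h ⊢ <;> omega
  let f : (Fin n ⊕ Fin n) → (Fin n ⊕ Fin n) → ℝ := fun x y =>
    if κ x < κ y then 1 else if κ y < κ x then -1 else 0
  have hJ : ∀ x y, Jstd n x y ≠ 0 → ∃ i, (x = Sum.inl i ∧ y = Sum.inr i ∧ Jstd n x y = 1) ∨
      (x = Sum.inr i ∧ y = Sum.inl i ∧ Jstd n x y = -1) := by
    rintro (i | i) (j | j) h
    · simp [Jstd] at h
    · simp [Jstd, Matrix.one_apply] at h; subst h; exact ⟨i, Or.inl (by simp [Jstd])⟩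
    · simp [Jstd, Matrix.one_apply] at h; subst h; exact ⟨i, Or.inr (by simp [Jstd])⟩
    · simp [Jstd] at h
  refine signConst_of_local (Jstd n) f (fun _ _ _ => 1) ?_ ?_ (by simp) (by simp) ?_ ?_
  · intro x y
    simp only [f]
    split_ifs <;> first | omega | simp
  · intro x y hxy
    have : κ x ≠ κ y := fun h => hxy (hκ _ _ h)
    simp only [f]
    split_ifs <;> first | omega | simp
  · intro x y h
    obtain ⟨i, ⟨rfl, rfl, h⟩ | ⟨rfl, rfl, h⟩⟩ := hJ x y h
    · rw [h]; simp [f, κ]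
    · rw [h]; simp [f, κ]
  · intro p₁ q₁ p₂ q₂ h1 h2 h3 h4 h5 h6 a1 a2
    obtain ⟨i, hi⟩ := hJ _ _ a1
    obtain ⟨j, hj⟩ := hJ _ _ a2
    have hij : i ≠ j := by
      rintro rfl
      rcases hi with ⟨rfl, rfl, _⟩ | ⟨rfl, rfl, _⟩ <;> rcases hj with ⟨rfl, rfl, _⟩ | ⟨rfl, rfl, _⟩ <;> simp at *
    have hij' : i.1 < j.1 ∨ j.1 < i.1 := by
      have : i.1 ≠ j.1 := fun h => hij (Fin.ext h)
      omega
    have hlt : ∀ x y, κ x < κ y → f x y = 1 := fun x y h => by simp only [f]; rw [if_pos h]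
    have hgt : ∀ x y, κ y < κ x → f x y = -1 := fun x y h => by
      simp only [f]; rw [if_neg (by omega), if_pos h]
    have kl : ∀ i : Fin n, κ (Sum.inl i) = 2 * i.1 := fun i => rfl
    have kr : ∀ i : Fin n, κ (Sum.inr i) = 2 * i.1 + 1 := fun i => rfl
    rcases hij' with h | h <;>
    rcases hi with ⟨rfl, rfl, _⟩ | ⟨rfl, rfl, _⟩ <;> rcases hj with ⟨rfl, rfl, _⟩ | ⟨rfl, rfl, _⟩ <;>
    first
    | (rw [hlt _ _ (by simp only [kl, kr]; omega), hlt _ _ (by simp only [kl, kr]; omega),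
        hlt _ _ (by simp only [kl, kr]; omega), hgt _ _ (by simp only [kl, kr]; omega)]; norm_num)
    | (rw [hgt _ _ (by simp only [kl, kr]; omega), hgt _ _ (by simp only [kl, kr]; omega),
        hgt _ _ (by simp only [kl, kr]; omega), hlt _ _ (by simp only [kl, kr]; omega)]; norm_num)

lemma isConj_sumComm {n : ℕ} (μ : Equiv.Perm (Fin n ⊕ Fin n)) (h1 : μ * μ = 1)
    (h2 : ∀ x, μ x ≠ x) : ∃ τ : Equiv.Perm (Fin n ⊕ Fin n), μ = τ * Equiv.sumComm _ _ * τ⁻¹ := by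
  have hcyc : ∀ ν : Equiv.Perm (Fin n ⊕ Fin n), ν * ν = 1 → (∀ x, ν x ≠ x) →
      ν.cycleType = Multiset.replicate n 2 := by
    intro ν h1 h2
    have : Fact (Nat.Prime 2) := ⟨Nat.prime_two⟩
    have hc := Equiv.Perm.cycleType_of_pow_prime_eq_one (σ := ν) (p := 2) (by rw [sq, h1])
    have hs := Equiv.Perm.sum_cycleType ν
    have hsup : ν.support = Finset.univ := by ext x; simp [h2]
    rw [hsup] at hs
    rw [hc] at hs ⊢
    simp at hs
    congr 1
    omega
  have : IsConj (Equiv.sumComm (Fin n) (Fin n) : Equiv.Perm (Fin n ⊕ Fin n)) μ := by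
    rw [Equiv.Perm.isConj_iff_cycleType_eq, hcyc μ h1 h2, hcyc]
    · ext x; cases x <;> simp
    · intro x; cases x <;> simp
  obtain ⟨τ, h⟩ := isConj_iff.1 this
  exact ⟨τ, h.symm⟩

lemma card_good_eq {n : ℕ} (A : Matrix (Fin n ⊕ Fin n) (Fin n ⊕ Fin n) ℝ)
    (hsym : ∀ x y, A x y ≠ 0 → A y x ≠ 0) :
    (Finset.univ.filter fun σ : Equiv.Perm (Fin n ⊕ Fin n) =>
      ∀ i, A (σ (Sum.inl i)) (σ (Sum.inr i)) ≠ 0).card =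
    (matchPerms A).card * (Finset.univ.filter fun σ : Equiv.Perm (Fin n ⊕ Fin n) =>
      σ * Equiv.sumComm _ _ * σ⁻¹ = Equiv.sumComm _ _).card := by
  rw [← smul_eq_mul]
  rw [Finset.card_eq_sum_card_fiberwise (t := matchPerms A)
    (f := fun σ => σ * (Equiv.sumComm _ _ : Equiv.Perm (Fin n ⊕ Fin n)) * σ⁻¹)]
  · rw [← Finset.sum_const]
    refine Finset.sum_congr rfl fun μ hμ => ?_
    simp only [matchPerms, Finset.mem_filter, Finset.mem_univ, true_and] at hμ
    obtain ⟨τ, hτ⟩ := isConj_sumComm μ hμ.1 (fun x => (hμ.2 x).1)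
    refine Finset.card_bij' (fun σ _ => τ⁻¹ * σ) (fun σ _ => τ * σ) ?_ ?_ ?_ ?_
    · intro σ hσ
      simp only [Finset.mem_filter, Finset.mem_univ, true_and] at hσ ⊢
      have := hσ.2
      rw [hτ] at this
      calc τ⁻¹ * σ * Equiv.sumComm _ _ * (τ⁻¹ * σ)⁻¹
          = τ⁻¹ * (σ * Equiv.sumComm _ _ * σ⁻¹) * τ := by group
        _ = _ := by rw [this]; group
    · intro σ hσ
      simp only [Finset.mem_filter, Finset.mem_univ, true_and] at hσ ⊢
      have hc : τ * σ * Equiv.sumComm _ _ * (τ * σ)⁻¹ = μ := by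
        calc τ * σ * Equiv.sumComm _ _ * (τ * σ)⁻¹
          = τ * (σ * Equiv.sumComm _ _ * σ⁻¹) * τ⁻¹ := by group
        _ = _ := by rw [hσ, hτ]
      refine ⟨?_, hc⟩
      intro i
      have := (hμ.2 ((τ * σ) (Sum.inl i))).2
      rw [← hc] at this
      simpa using this
    · intro σ _; simp
    · intro σ _; simp
  · intro σ hσ
    simp only [Finset.coe_filter, Finset.mem_univ, true_and, Set.mem_ofPred_eq] at hσ
    simp only [matchPerms, Finset.coe_filter, Finset.mem_univ, true_and, Set.mem_ofPred_eq]
    have hss : (Equiv.sumComm _ _ : Equiv.Perm (Fin n ⊕ Fin n)) * Equiv.sumComm _ _ = 1 := by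
      ext x; cases x <;> simp
    refine ⟨?_, ?_⟩
    · calc _ = σ * ((Equiv.sumComm _ _ : Equiv.Perm (Fin n ⊕ Fin n)) * Equiv.sumComm _ _) * σ⁻¹ := by group
        _ = 1 := by rw [hss]; group
    · intro x
      obtain ⟨y, rfl⟩ := σ.surjective x
      have hinv : σ⁻¹ (σ y) = y := by simp
      simp only [Equiv.Perm.mul_apply, hinv]
      rcases y with i | i
      · exact ⟨by simp, by simpa using hσ i⟩
      · exact ⟨by simp, by simpa using hsym _ _ (hσ i)⟩

lemma matchPerms_sq {n : ℕ} (A : Matrix (Fin n ⊕ Fin n) (Fin n ⊕ Fin n) ℝ)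
    (hA : A.transpose = -A) (h : SignConst A) : ((matchPerms A).card : ℝ) ^ 2 = A.det := by
  have hsym : ∀ x y, A x y ≠ 0 → A y x ≠ 0 := by
    intro x y hxy h0
    have := congrFun (congrFun hA x) y
    simp [h0] at this
    exact hxy this
  have e1 := pfF_sq A hA
  have hJ : (Jstd n).transpose = - Jstd n := by
    simp [Jstd, Matrix.fromBlocks_transpose, Matrix.fromBlocks_neg]
  have hJsym : ∀ x y, Jstd n x y ≠ 0 → Jstd n y x ≠ 0 := by
    intro x y hxy h0
    have := congrFun (congrFun hJ x) y
    simp [h0] at this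
    exact hxy this
  rw [pfF_eq_card A h, pfF_eq_card _ (Jstd_signConst n), card_good_eq A hsym,
    card_good_eq _ hJsym] at e1
  have hm : (matchPerms (Jstd n)).card = 1 := by
    rw [Finset.card_eq_one]
    refine ⟨(Equiv.sumComm _ _ : Equiv.Perm (Fin n ⊕ Fin n)), ?_⟩
    ext μ
    simp only [matchPerms, Finset.mem_filter, Finset.mem_univ, true_and, Finset.mem_singleton]
    constructor
    · rintro ⟨_, h2⟩
      ext x
      have := (h2 x).2
      rcases x with i | i <;> rcases hx : μ _ with j | j <;> rw [hx] at this <;>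
        simp [Jstd, Matrix.one_apply] at this ⊢
      · exact this.symm
      · exact this.symm
    · rintro rfl
      refine ⟨by ext x; cases x <;> simp, ?_⟩
      intro x
      cases x <;> simp [Jstd]
  have hc : ((Finset.univ.filter fun σ : Equiv.Perm (Fin n ⊕ Fin n) =>
      σ * Equiv.sumComm _ _ * σ⁻¹ = Equiv.sumComm _ _).card : ℝ) ≠ 0 := by
    have : (1 : Equiv.Perm (Fin n ⊕ Fin n)) ∈ (Finset.univ.filter fun σ : Equiv.Perm (Fin n ⊕ Fin n) =>
      σ * Equiv.sumComm _ _ * σ⁻¹ = Equiv.sumComm _ _) := by simp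
    exact_mod_cast (Finset.card_pos.2 ⟨_, this⟩).ne'
  rw [hm] at e1
  push_cast at e1
  have hc2 := pow_ne_zero 2 hc
  apply mul_right_cancel₀ hc2
  linear_combination e1

end PartB

section PartC

lemma hadamard_fin {m : ℕ} (A : Matrix (Fin m) (Fin m) ℝ) :
    A.det ^ 2 ≤ ∏ i, ∑ j, A i j ^ 2 := by
  have : Fact (Module.finrank ℝ (EuclideanSpace ℝ (Fin m)) = m) := ⟨by simp⟩
  let b := EuclideanSpace.basisFun (Fin m) ℝ
  let v : Fin m → EuclideanSpace ℝ (Fin m) := fun i => WithLp.toLp 2 (A i)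
  have h := (b.toBasis.orientation).abs_volumeForm_apply_le v
  rw [Orientation.volumeForm_robust _ b rfl] at h
  have hd : b.toBasis.det v = A.det := by
    rw [Module.Basis.det_apply, ← Matrix.det_transpose]
    congr 1
  rw [hd] at h
  have h2 : A.det ^ 2 ≤ (∏ i, ‖v i‖) ^ 2 := by
    rw [← sq_abs A.det]
    gcongr
  refine h2.trans (le_of_eq ?_)
  rw [← Finset.prod_pow]
  refine Finset.prod_congr rfl fun i _ => ?_
  rw [EuclideanSpace.norm_sq_eq]
  simp [v]

lemma hadamard_gen {ι : Type} [Fintype ι] (A : Matrix ι ι ℝ) :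
    A.det ^ 2 ≤ ∏ i, ∑ j, A i j ^ 2 := by
  let e := Fintype.equivFin ι
  have h := hadamard_fin (A.submatrix e.symm e.symm)
  rw [Matrix.det_submatrix_equiv_self] at h
  refine h.trans (le_of_eq ?_)
  rw [← Equiv.prod_comp e.symm]
  refine Finset.prod_congr rfl fun i _ => ?_
  rw [← Equiv.sum_comp e.symm]
  rfl

lemma prod_le_six_pow {ι : Type} [Fintype ι] (d : ι → ℝ) (h0 : ∀ i, 0 ≤ d i)
    (h : ∑ i, d i ≤ 6 * Fintype.card ι) : ∏ i, d i ≤ 6 ^ Fintype.card ι := by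
  have h1 : ∀ i, d i ≤ 6 * Real.exp (d i / 6 - 1) := by
    intro i
    have := Real.add_one_le_exp (d i / 6 - 1)
    linarith
  calc ∏ i, d i ≤ ∏ i, (6 * Real.exp (d i / 6 - 1)) :=
        Finset.prod_le_prod (fun i _ => h0 i) (fun i _ => h1 i)
    _ = 6 ^ Fintype.card ι * Real.exp (∑ i, (d i / 6 - 1)) := by
        rw [Finset.prod_mul_distrib, Real.exp_sum]; simp
    _ ≤ 6 ^ Fintype.card ι * 1 := by
        gcongr
        rw [Real.exp_le_one_iff]
        rw [Finset.sum_sub_distrib, ← Finset.sum_div]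
        simp
        linarith
    _ = _ := mul_one _

lemma kasteleyn_bound {ι : Type} [Fintype ι] (n : ℕ) (hn : Fintype.card ι = n + n)
    (A : Matrix ι ι ℝ) (f : ι → ι → ℝ) (bel : ι → ι → ι → ℝ)
    (hf : ∀ x y, f x y = - f y x) (hf1 : ∀ x y, x ≠ y → f x y ^ 2 = 1)
    (hb1 : ∀ x y, bel x y x = 1) (hb2 : ∀ x y, bel x y y = 1)
    (hbs : ∀ x y u, bel x y u ^ 2 = 1)
    (hA0 : A.transpose = -A)
    (hA : ∀ x y, A x y ≠ 0 → A x y = f x y * ∏ u, bel x y u)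
    (hloc : ∀ p₁ q₁ p₂ q₂, p₁ ≠ q₁ → p₁ ≠ p₂ → p₁ ≠ q₂ → q₁ ≠ p₂ → q₁ ≠ q₂ → p₂ ≠ q₂ →
      A p₁ q₁ ≠ 0 → A p₂ q₂ ≠ 0 →
      f p₁ p₂ * f q₁ q₂ * f p₁ q₂ * f p₂ q₁ *
        (bel p₁ q₁ p₂ * bel p₁ q₁ q₂ * bel p₂ q₂ p₁ * bel p₂ q₂ q₁) = -1)
    (hE : ∑ x, ((Finset.univ.filter fun y => A x y ≠ 0).card : ℝ) ≤ 6 * Fintype.card ι) :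
    ((matchPerms A).card : ℝ) ^ 4 ≤ 6 ^ Fintype.card ι := by
  have hc : Fintype.card (Fin n ⊕ Fin n) = Fintype.card ι := by simp [hn]
  let e : Fin n ⊕ Fin n ≃ ι := Fintype.equivOfCardEq hc
  let B := A.submatrix e e
  have hB0 : B.transpose = -B := by
    ext x y
    exact congrFun (congrFun hA0 (e x)) (e y)
  have hs : SignConst B := by
    refine signConst_of_local B (fun x y => f (e x) (e y)) (fun x y u => bel (e x) (e y) (e u))
      (fun x y => hf _ _) (fun x y h => hf1 _ _ (by simpa using h)) (fun x y => hb1 _ _)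
      (fun x y => hb2 _ _) ?_ ?_
    · intro x y h
      have := hA (e x) (e y) h
      simp only [B, Matrix.submatrix_apply]
      rw [this, ← Equiv.prod_comp e]
    · intro p₁ q₁ p₂ q₂ h1 h2 h3 h4 h5 h6 a1 a2
      exact hloc _ _ _ _ (by simpa using h1) (by simpa using h2) (by simpa using h3)
        (by simpa using h4) (by simpa using h5) (by simpa using h6) a1 a2
  have hq := matchPerms_sq B hB0 hs
  have hdet : B.det = A.det := Matrix.det_submatrix_equiv_self _ _
  have hcard : (matchPerms A).card ≤ (matchPerms B).card := by
    apply Finset.card_le_card_of_injOn (fun μ => e.symm.permCongr μ)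
    · intro μ hμ
      simp only [matchPerms, Finset.coe_filter, Finset.mem_univ, true_and, Set.mem_ofPred_eq] at hμ ⊢
      refine ⟨?_, ?_⟩
      · ext x
        have h1 : ∀ y, μ (μ y) = y := fun y => by
          have := congrArg (fun ν : Equiv.Perm ι => ν y) hμ.1
          simpa using this
        simp [h1]
      · intro x
        have := hμ.2 (e x)
        refine ⟨?_, by simpa [B] using this.2⟩
        intro h
        apply this.1
        have h2 := congrArg e h
        simpa using h2
    · intro μ _ ν _ h
      exact e.symm.permCongr.injective h
  have hrow : ∀ x, ∑ y, A x y ^ 2 = ((Finset.univ.filter fun y => A x y ≠ 0).card : ℝ) := by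
    intro x
    rw [Finset.card_filter]
    push_cast
    refine Finset.sum_congr rfl fun y _ => ?_
    by_cases h : A x y = 0
    · simp [h]
    · have hxy : x ≠ y := by
        rintro rfl
        have h3 := congrFun (congrFun hA0 x) x
        simp only [Matrix.transpose_apply, Matrix.neg_apply] at h3
        exact h (by linarith)
      rw [if_pos h, hA x y h, mul_pow, hf1 x y hxy, ← Finset.prod_pow]
      exact (Finset.prod_eq_one fun u _ => hbs x y u).symm ▸ mul_one _
  have hh := hadamard_gen A
  rw [Finset.prod_congr rfl fun x _ => hrow x] at hh
  have h6 := prod_le_six_pow (fun x => ((Finset.univ.filter fun y => A x y ≠ 0).card : ℝ))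
    (fun i => Nat.cast_nonneg _) hE
  have h7 : ((matchPerms A).card : ℝ) ≤ (matchPerms B).card := by exact_mod_cast hcard
  calc ((matchPerms A).card : ℝ) ^ 4 ≤ ((matchPerms B).card : ℝ) ^ 4 := pow_le_pow_left₀ (Nat.cast_nonneg _) h7 4
    _ = (((matchPerms B).card : ℝ) ^ 2) ^ 2 := by ring
    _ = A.det ^ 2 := by rw [hq, hdet]
    _ ≤ _ := hh
    _ ≤ _ := h6

end PartC

section PartD

/-- Orientation determinant. -/
def ori (p q r : Pt) : ℝ := (q.1 - p.1) * (r.2 - p.2) - (q.2 - p.2) * (r.1 - p.1)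

/-- The point at parameter `s` on the line from `p` to `q`. -/
def ptl (p q : Pt) (s : ℝ) : Pt := ((1 - s) * p.1 + s * q.1, (1 - s) * p.2 + s * q.2)

lemma mem_seg2 (p q x : Pt) : x ∈ seg2 s(p, q) ↔ ∃ s, 0 ≤ s ∧ s ≤ 1 ∧ x = ptl p q s := by
  have : seg2 s(p, q) = segment ℝ p q := rfl
  rw [this]
  constructor
  · rintro ⟨a, b, ha, hb, hab, rfl⟩
    refine ⟨b, hb, by linarith, ?_⟩
    have : a = 1 - b := by linarith
    subst this
    ext <;> simp [ptl]
  · rintro ⟨s, h0, h1, rfl⟩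
    refine ⟨1 - s, s, by linarith, h0, by ring, ?_⟩
    ext <;> simp [ptl]

/-- No three points of `S` are on a line (determinant form). -/
def GP (S : Finset Pt) : Prop :=
  ∀ p ∈ S, ∀ q ∈ S, ∀ r ∈ S, p ≠ q → p ≠ r → q ≠ r → ori p q r ≠ 0

lemma gp_of_genPos {S : Finset Pt} (h : GenPos S) : GP S := by
  intro p hp q hq r hr hpq hpr hqr h0
  apply h p hp q hq r hr hpq hpr hqr
  rw [collinear_iff_of_mem (p₀ := p) (by simp)]
  have hd : (q.1 - p.1) ^ 2 + (q.2 - p.2) ^ 2 ≠ 0 := by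
    intro h0
    apply hpq
    have h1 : q.1 - p.1 = 0 := by nlinarith [sq_nonneg (q.1 - p.1), sq_nonneg (q.2 - p.2)]
    have h2 : q.2 - p.2 = 0 := by nlinarith [sq_nonneg (q.1 - p.1), sq_nonneg (q.2 - p.2)]
    ext <;> linarith
  refine ⟨q - p, ?_⟩
  intro y hy
  simp only [Set.mem_insert_iff, Set.mem_singleton_iff] at hy
  rcases hy with rfl | rfl | rfl
  · exact ⟨0, by simp⟩
  · exact ⟨1, by simp⟩
  · refine ⟨((y.1 - p.1) * (q.1 - p.1) + (y.2 - p.2) * (q.2 - p.2)) /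
      ((q.1 - p.1) ^ 2 + (q.2 - p.2) ^ 2), ?_⟩
    unfold ori at h0
    ext
    · simp
      field_simp
      linear_combination (-(q.2 - p.2)) * h0
    · simp
      field_simp
      linear_combination (q.1 - p.1) * h0

lemma ori_cyc (p q r : Pt) : ori q r p = ori p q r := by unfold ori; ring
lemma ori_swap (p q r : Pt) : ori q p r = - ori p q r := by unfold ori; ring
lemma ori_swap' (p q r : Pt) : ori p r q = - ori p q r := by unfold ori; ring
@[simp] lemma ori_self1 (p r : Pt) : ori p p r = 0 := by unfold ori; ring
@[simp] lemma ori_self2 (p r : Pt) : ori p r r = 0 := by unfold ori; ring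
@[simp] lemma ori_self3 (p r : Pt) : ori p r p = 0 := by unfold ori; ring

lemma ori_ptl (a b r t : Pt) (s : ℝ) : ori a b (ptl r t s) = (1 - s) * ori a b r + s * ori a b t := by
  unfold ori ptl; ring

lemma ptl_zero (r t : Pt) : ptl r t 0 = r := by ext <;> simp [ptl]
lemma ptl_one (r t : Pt) : ptl r t 1 = t := by ext <;> simp [ptl]
lemma ptl_symm (r t : Pt) (s : ℝ) : ptl r t s = ptl t r (1 - s) := by ext <;> simp [ptl] <;> ring

lemma gp_eq {S : Finset Pt} (h : GP S) {p q r : Pt} (hp : p ∈ S) (hq : q ∈ S) (hr : r ∈ S)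
    (hpq : p ≠ q) (h0 : ori p q r = 0) : r = p ∨ r = q := by
  by_contra hc
  push Not at hc
  exact h p hp q hq r hr hpq (fun e => hc.1 e.symm) (fun e => hc.2 e.symm) h0

/-- Proper crossing of the segments `pq` and `rt`. -/
def Cr (p q r t : Pt) : Prop := ori p q r * ori p q t < 0 ∧ ori r t p * ori r t q < 0

lemma Cr_symm {p q r t : Pt} (h : Cr p q r t) : Cr r t p q := ⟨h.2, h.1⟩
lemma Cr_flip {p q r t : Pt} (h : Cr p q r t) : Cr p q t r := by
  refine ⟨by rw [mul_comm]; exact h.1, ?_⟩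
  rw [ori_swap r t, ori_swap r t]
  linarith [h.2]
lemma Cr_flip' {p q r t : Pt} (h : Cr p q r t) : Cr q p r t := Cr_symm (Cr_flip (Cr_symm h))

lemma frac01 {a b : ℝ} (h : a * b < 0) : 0 < a / (a - b) ∧ a / (a - b) < 1 ∧ a - b ≠ 0 := by
  rcases lt_trichotomy a 0 with ha | ha | ha
  · have hb : 0 < b := by nlinarith
    have : a - b < 0 := by linarith
    refine ⟨div_pos_of_neg_of_neg ha this, ?_, this.ne⟩
    rw [div_lt_one_of_neg this]; linarith
  · simp [ha] at h
  · have hb : b < 0 := by nlinarith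
    have : 0 < a - b := by linarith
    refine ⟨div_pos ha this, ?_, this.ne'⟩
    rw [div_lt_one this]; linarith

lemma Cr_point {p q r t : Pt} (h : Cr p q r t) :
    ∃ s u : ℝ, 0 < s ∧ s < 1 ∧ 0 < u ∧ u < 1 ∧ ptl p q s = ptl r t u := by
  obtain ⟨h1, h2⟩ := h
  obtain ⟨a1, a2, a3⟩ := frac01 h1
  obtain ⟨b1, b2, b3⟩ := frac01 h2
  refine ⟨_, _, b1, b2, a1, a2, ?_⟩
  ext
  · simp only [ptl]
    field_simp
    unfold ori
    ring
  · simp only [ptl]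
    field_simp
    unfold ori
    ring

lemma Cr_of_point {S : Finset Pt} (hS : GP S) {p q r t : Pt} (hp : p ∈ S) (hq : q ∈ S) (hr : r ∈ S)
    (ht : t ∈ S) (hpq : p ≠ q) (hrt : r ≠ t) (hne : s(p, q) ≠ s(r, t)) {s u : ℝ}
    (h0 : 0 < s) (h1 : s < 1) (h2 : 0 < u) (h3 : u < 1) (h : ptl p q s = ptl r t u) :
    Cr p q r t := by
  have key : ∀ p q r t : Pt, p ∈ S → q ∈ S → r ∈ S → t ∈ S → p ≠ q → r ≠ t → s(p, q) ≠ s(r, t) →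
      ∀ s u : ℝ, 0 < u → u < 1 → ptl p q s = ptl r t u → ori p q r * ori p q t < 0 := by
    intro p q r t hp hq hr ht hpq hrt hne s u h2 h3 h
    have e1 : ori p q (ptl p q s) = 0 := by rw [ori_ptl]; simp
    rw [h, ori_ptl] at e1
    by_cases hz : ori p q r = 0
    · have hz2 : ori p q t = 0 := by
        rw [hz, mul_zero, zero_add] at e1
        exact (mul_eq_zero.1 e1).resolve_left h2.ne'
      exfalso; apply hne
      rcases gp_eq hS hp hq hr hpq hz with rfl | rfl <;>
      rcases gp_eq hS hp hq ht hpq hz2 with rfl | rfl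
      · exact absurd rfl hrt
      · rfl
      · exact Sym2.eq_swap
      · exact absurd rfl hrt
    · have : ori p q t = -((1 - u) / u) * ori p q r := by
        field_simp; linarith
      rw [this]
      have h4 : 0 < (1 - u) / u := div_pos (by linarith) h2
      have h5 : 0 < ori p q r ^ 2 := by positivity
      nlinarith
  exact ⟨key p q r t hp hq hr ht hpq hrt hne s u h2 h3 h,
    key r t p q hr ht hp hq hrt hpq hne.symm u s h0 h1 h.symm⟩

lemma edge_ne {S : Finset Pt} (G : PlaneGraph S) {p q : Pt} (h : s(p, q) ∈ G.edges) : p ≠ q := by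
  have := G.not_isDiag _ h
  simpa using this
lemma edge_l {S : Finset Pt} (G : PlaneGraph S) {p q : Pt} (h : s(p, q) ∈ G.edges) : p ∈ S :=
  G.endpoint_mem _ h p (by simp)
lemma edge_r {S : Finset Pt} (G : PlaneGraph S) {p q : Pt} (h : s(p, q) ∈ G.edges) : q ∈ S :=
  G.endpoint_mem _ h q (by simp)
lemma edge_symm {S : Finset Pt} {G : PlaneGraph S} {p q : Pt} (h : s(p, q) ∈ G.edges) :
    s(q, p) ∈ G.edges := by rw [Sym2.eq_swap]; exact h

lemma edges_meet {S : Finset Pt} (G : PlaneGraph S) {p q r t : Pt} (h1 : s(p, q) ∈ G.edges)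
    (h2 : s(r, t) ∈ G.edges) (hne : s(p, q) ≠ s(r, t)) {s u : ℝ} (hs0 : 0 ≤ s) (hs1 : s ≤ 1)
    (hu0 : 0 ≤ u) (hu1 : u ≤ 1) (h : ptl p q s = ptl r t u) :
    (ptl r t u = p ∨ ptl r t u = q) ∧ (ptl r t u = r ∨ ptl r t u = t) := by
  have := G.noncrossing _ h1 _ h2 hne (ptl r t u)
    ⟨(mem_seg2 _ _ _).2 ⟨s, hs0, hs1, h.symm⟩, (mem_seg2 _ _ _).2 ⟨u, hu0, hu1, rfl⟩⟩
  simpa using this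

lemma not_cr {S : Finset Pt} (G : PlaneGraph S) {p q r t : Pt} (h1 : s(p, q) ∈ G.edges)
    (h2 : s(r, t) ∈ G.edges) : ¬ Cr p q r t := by
  intro hc
  obtain ⟨s, u, a1, a2, a3, a4, h⟩ := Cr_point hc
  have hne : s(p, q) ≠ s(r, t) := by
    intro he
    have h' := hc.1
    rw [Sym2.eq_iff] at he
    rcases he with ⟨rfl, rfl⟩ | ⟨rfl, rfl⟩ <;> simp at h'
  have := (edges_meet G h1 h2 hne a1.le a2.le a3.le a4.le h).1
  have hc2 := hc.2
  have e0 : ori r t (ptl r t u) = 0 := by rw [ori_ptl]; simp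
  rcases this with h' | h' <;> rw [h'] at e0 <;> rw [e0] at hc2 <;> simp at hc2

/-- Inserting an uncrossed segment. -/
def insertEdge {S : Finset Pt} (hS : GP S) (G : PlaneGraph S) {p q : Pt} (hp : p ∈ S) (hq : q ∈ S)
    (hpq : p ≠ q) (h : ∀ r t, s(r, t) ∈ G.edges → ¬ Cr p q r t) : PlaneGraph S where
  edges := insert s(p, q) G.edges
  endpoint_mem := by
    intro e he x hx
    rcases Finset.mem_insert.1 he with rfl | he
    · rcases Sym2.mem_iff.1 hx with rfl | rfl <;> assumption
    · exact G.endpoint_mem e he x hx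
  not_isDiag := by
    intro e he
    rcases Finset.mem_insert.1 he with rfl | he
    · simpa using hpq
    · exact G.not_isDiag e he
  noncrossing := by
    have key : ∀ e ∈ G.edges, s(p, q) ≠ e → ∀ x, x ∈ seg2 s(p, q) → x ∈ seg2 e →
        x ∈ s(p, q) ∧ x ∈ e := by
      intro e
      induction e using Sym2.ind with | _ r t => ?_
      intro he hne x hx1 hx2
      have hr := edge_l G he
      have ht := edge_r G he
      have hrt := edge_ne G he
      rw [mem_seg2] at hx1 hx2
      obtain ⟨s, s0, s1, rfl⟩ := hx1
      obtain ⟨u, u0, u1, hx⟩ := hx2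
      have end1 : ∀ a ∈ S, ptl p q s = a → a ∈ s(r, t) := by
        intro a ha hax
        have : ori r t a = 0 := by rw [← hax, hx, ori_ptl]; simp
        rcases gp_eq hS hr ht ha hrt this with rfl | rfl <;> simp
      have end2 : ∀ a ∈ S, ptl p q s = a → a ∈ s(p, q) := by
        intro a ha hax
        have : ori p q a = 0 := by rw [← hax, ori_ptl]; simp
        rcases gp_eq hS hp hq ha hpq this with rfl | rfl <;> simp
      have end3 : ∀ a ∈ S, ptl p q s = a → ptl p q s ∈ s(p, q) ∧ ptl p q s ∈ s(r, t) := by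
        intro a ha hax
        rw [hax]; exact ⟨end2 a ha hax, end1 a ha hax⟩
      rcases eq_or_lt_of_le s0 with hs | hs
      · exact end3 p hp (by rw [← hs, ptl_zero])
      rcases eq_or_lt_of_le s1 with hs' | hs'
      · exact end3 q hq (by rw [hs', ptl_one])
      rcases eq_or_lt_of_le u0 with hu | hu
      · exact end3 r hr (by rw [hx, ← hu, ptl_zero])
      rcases eq_or_lt_of_le u1 with hu' | hu'
      · exact end3 t ht (by rw [hx, hu', ptl_one])
      exact absurd (Cr_of_point hS hp hq hr ht hpq hrt hne hs hs' hu hu' hx) (h r t he)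
    intro e₁ h1 e₂ h2 hne x hx
    rcases Finset.mem_insert.1 h1 with rfl | h1 <;> rcases Finset.mem_insert.1 h2 with rfl | h2
    · exact absurd rfl hne
    · exact key _ h2 hne x hx.1 hx.2
    · exact (key _ h1 hne.symm x hx.2 hx.1).symm
    · exact G.noncrossing _ h1 _ h2 hne x hx

lemma tri_edge {S : Finset Pt} (hS : GP S) {T : PlaneGraph S} (hT : IsTriangulation T) {p q : Pt}
    (hp : p ∈ S) (hq : q ∈ S) (hpq : p ≠ q) (h : ∀ r t, s(r, t) ∈ T.edges → ¬ Cr p q r t) :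
    s(p, q) ∈ T.edges := by
  have := hT (insertEdge hS T hp hq hpq h) (Finset.subset_insert _ _)
  rw [← this]
  exact Finset.mem_insert_self _ _

/-- Sub-plane-graph. -/
def subGraph {S : Finset Pt} (G : PlaneGraph S) (E : Finset (Sym2 Pt)) (h : E ⊆ G.edges) :
    PlaneGraph S where
  edges := E
  endpoint_mem := fun e he => G.endpoint_mem e (h he)
  not_isDiag := fun e he => G.not_isDiag e (h he)
  noncrossing := fun e₁ h1 e₂ h2 => G.noncrossing e₁ (h h1) e₂ (h h2)

lemma pg_ext {S : Finset Pt} {G H : PlaneGraph S} (h : G.edges = H.edges) : G = H := by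
  cases G; cases H; cases h; rfl

lemma edges_sub {S : Finset Pt} (G : PlaneGraph S) : G.edges ⊆ S.sym2 := by
  intro e he
  rw [Finset.mem_sym2_iff]
  exact fun a ha => G.endpoint_mem e he a ha

instance pgFinite (S : Finset Pt) : Finite (PlaneGraph S) :=
  Finite.of_injective (β := {E : Finset (Sym2 Pt) // E ∈ S.sym2.powerset})
    (fun G => ⟨G.edges, Finset.mem_powerset.2 (edges_sub G)⟩)
    (fun G H h => pg_ext (congrArg Subtype.val h))

lemma exists_tri {S : Finset Pt} (G : PlaneGraph S) :
    ∃ T : PlaneGraph S, IsTriangulation T ∧ G.edges ⊆ T.edges := by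
  obtain ⟨T, hT, hmax⟩ := Set.Finite.exists_maximalFor (fun H : PlaneGraph S => H.edges.card)
    {H | G.edges ⊆ H.edges} (Set.toFinite _) ⟨G, Finset.Subset.refl _⟩
  refine ⟨T, ?_, hT⟩
  intro H hH
  have : T.edges.card ≤ H.edges.card := Finset.card_le_card hH
  exact (Finset.eq_of_subset_of_card_le hH (hmax (hT.trans hH) this)).symm


end PartD

section PartE

/-- `det (d, u - v)`. -/
def dt (d u v : Pt) : ℝ := d.1 * (u.2 - v.2) - d.2 * (u.1 - v.1)

lemma dt_ptl (d r t v : Pt) (s : ℝ) : dt d (ptl r t s) v = (1 - s) * dt d r v + s * dt d t v := by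
  unfold dt ptl; ring

/-- The open ray from `v` in direction `d` properly hits the segment `pq` (with `q` on the right). -/
def Hit (d v q p : Pt) : Prop := dt d q v < 0 ∧ 0 < dt d p v ∧ 0 < ori v q p

/-- The hit parameter. -/
def hitT (d v q p : Pt) : ℝ := ori v q p / (dt d p v - dt d q v)

lemma pl1 (d v a b c : Pt) :
    ori v a b * dt d c v + ori v b c * dt d a v = ori v a c * dt d b v := by
  unfold ori dt; ring

lemma exit_lem (A B C : ℝ → ℝ) (hA : Continuous A) (hB : Continuous B) (hC : Continuous C)
    {s : ℝ} (hs : 0 ≤ s) (h1 : 0 < A s) (h2 : 0 < B s) (h3 : 0 < C s)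
    (h : ¬ (0 < A 0 ∧ 0 < B 0 ∧ 0 < C 0)) :
    ∃ α, 0 ≤ α ∧ α < s ∧ 0 ≤ A α ∧ 0 ≤ B α ∧ 0 ≤ C α ∧ (A α = 0 ∨ B α = 0 ∨ C α = 0) := by
  have hg : Continuous fun x => min (A x) (min (B x) (C x)) := hA.min (hB.min hC)
  have hiv := intermediate_value_Icc hs hg.continuousOn
  have hmem : (0 : ℝ) ∈ Set.Icc (min (A 0) (min (B 0) (C 0))) (min (A s) (min (B s) (C s))) := by
    refine ⟨?_, (lt_min h1 (lt_min h2 h3)).le⟩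
    by_contra hc
    push Not at hc
    simp only [lt_min_iff] at hc
    exact h hc
  obtain ⟨α, ⟨ha0, ha1⟩, hα⟩ := hiv hmem
  simp only at hα
  have hα' : α < s := by
    rcases eq_or_lt_of_le ha1 with rfl | h'
    · exact absurd hα (lt_min h1 (lt_min h2 h3)).ne'
    · exact h'
  refine ⟨α, ha0, hα', ?_, ?_, ?_, ?_⟩
  · rw [← hα]; exact min_le_left _ _
  · rw [← hα]; exact (min_le_right _ _).trans (min_le_left _ _)
  · rw [← hα]; exact (min_le_right _ _).trans (min_le_right _ _)
  · rcases min_choice (A α) (min (B α) (C α)) with h' | h'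
    · left; rw [← h', hα]
    · rcases min_choice (B α) (C α) with h'' | h''
      · right; left; rw [← h'', ← h', hα]
      · right; right; rw [← h'', ← h', hα]

lemma exit_ori {a b c d e f r t : Pt} {s : ℝ} (hs : 0 ≤ s)
    (h1 : 0 < ori a b (ptl r t s)) (h2 : 0 < ori c d (ptl r t s)) (h3 : 0 < ori e f (ptl r t s))
    (h : ¬ (0 < ori a b r ∧ 0 < ori c d r ∧ 0 < ori e f r)) :
    ∃ α, 0 ≤ α ∧ α < s ∧ 0 ≤ ori a b (ptl r t α) ∧ 0 ≤ ori c d (ptl r t α) ∧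
      0 ≤ ori e f (ptl r t α) ∧
      (ori a b (ptl r t α) = 0 ∨ ori c d (ptl r t α) = 0 ∨ ori e f (ptl r t α) = 0) := by
  apply exit_lem (fun x => ori a b (ptl r t x)) (fun x => ori c d (ptl r t x))
    (fun x => ori e f (ptl r t x)) _ _ _ hs h1 h2 h3
  · simpa only [ptl_zero] using h
  all_goals (simp only [ori_ptl]; fun_prop)

lemma exit_ori' {a b c d e f r t : Pt} {s : ℝ} (hs : s ≤ 1)
    (h1 : 0 < ori a b (ptl r t s)) (h2 : 0 < ori c d (ptl r t s)) (h3 : 0 < ori e f (ptl r t s))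
    (h : ¬ (0 < ori a b t ∧ 0 < ori c d t ∧ 0 < ori e f t)) :
    ∃ α, α ≤ 1 ∧ s < α ∧ 0 ≤ ori a b (ptl r t α) ∧ 0 ≤ ori c d (ptl r t α) ∧
      0 ≤ ori e f (ptl r t α) ∧
      (ori a b (ptl r t α) = 0 ∨ ori c d (ptl r t α) = 0 ∨ ori e f (ptl r t α) = 0) := by
  rw [ptl_symm] at h1 h2 h3
  obtain ⟨α, g1, g2, g3⟩ := exit_ori (by linarith) h1 h2 h3 h
  refine ⟨1 - α, by linarith, by linarith, ?_⟩
  rw [ptl_symm r t, sub_sub_cancel]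
  exact g3

lemma ori_mid {a b r t : Pt} (α s β : ℝ) :
    (β - s) * ori a b (ptl r t α) + (s - α) * ori a b (ptl r t β) =
      (β - α) * ori a b (ptl r t s) := by
  simp only [ori_ptl]; ring

lemma hit_C {d v q p r t : Pt} (h1 : Hit d v q p) (h2 : Hit d v r t) :
    ori q p (ptl r t (- dt d r v / (dt d t v - dt d r v))) =
      (dt d p v - dt d q v) * (hitT d v q p - hitT d v r t) := by
  have e1 : dt d t v - dt d r v ≠ 0 := by have := h2.1; have := h2.2.1; linarith
  have e2 : dt d p v - dt d q v ≠ 0 := by have := h1.1; have := h1.2.1; linarith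
  unfold hitT
  rw [ori_ptl]
  field_simp
  unfold ori dt
  ring

lemma two_zero {m n a b : ℝ} (hm : 0 < m) (hn : 0 < n) (ha : 0 ≤ a) (hb : 0 ≤ b)
    (h : m * a + n * b ≤ 0) : a = 0 ∧ b = 0 := by
  have h1 := mul_nonneg hm.le ha
  have h2 := mul_nonneg hn.le hb
  have h3 : m * a = 0 := by linarith
  have h4 : n * b = 0 := by linarith
  exact ⟨(mul_eq_zero.1 h3).resolve_left hm.ne', (mul_eq_zero.1 h4).resolve_left hn.ne'⟩

set_option maxHeartbeats 1000000 in
lemma region_free {S : Finset Pt} (hS : GP S) (T : PlaneGraph S) {v p q w w' d : Pt}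
    (hf : s(q, p) ∈ T.edges) (hit : Hit d v q p)
    (hmin : ∀ r t, s(r, t) ∈ T.edges → Hit d v r t → hitT d v q p ≤ hitT d v r t)
    (hwD : 0 < dt d w v) (hwp : 0 ≤ ori v w p) (hw'D : dt d w' v < 0) (hw'q : 0 ≤ ori v q w')
    (hW : 0 < ori v w' w)
    (hno : ∀ u ∈ S, ¬ (0 < ori v w' u ∧ 0 < ori w v u ∧ 0 < ori q p u))
    {r t : Pt} (hrt : s(r, t) ∈ T.edges) {s : ℝ} (hs0 : 0 ≤ s) (hs1 : s ≤ 1) :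
    ¬ (0 < ori v w' (ptl r t s) ∧ 0 < ori w v (ptl r t s) ∧ 0 < ori q p (ptl r t s)) := by
  rintro ⟨zA, zB, zC⟩
  have hr := edge_l T hrt
  have ht := edge_r T hrt
  obtain ⟨α, α0, αs, αA, αB, αC, αz⟩ := exit_ori hs0 zA zB zC (hno r hr)
  obtain ⟨β, β1, βs, βA, βB, βC, βz⟩ := exit_ori' hs1 zA zB zC (hno t ht)
  have hne : s(q, p) ≠ s(r, t) := by
    intro he
    rw [ori_ptl] at zC
    rw [Sym2.eq_iff] at he
    rcases he with ⟨rfl, rfl⟩ | ⟨rfl, rfl⟩ <;> simp at zC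
  have hbd : ∀ γ, 0 ≤ γ → γ ≤ 1 → 0 ≤ ori v w' (ptl r t γ) → 0 ≤ ori w v (ptl r t γ) →
      ori q p (ptl r t γ) = 0 → ori v w' (ptl r t γ) = 0 ∨ ori w v (ptl r t γ) = 0 := by
    intro γ γ0 γ1 hA hB hC
    obtain ⟨i1, i2, i3⟩ := hit
    set y := ptl r t γ with hy
    have hd : 0 < dt d p v - dt d q v := by linarith
    have hline : ptl q p ((dt d y v - dt d q v) / (dt d p v - dt d q v)) = y := by
      have hC' := hC
      unfold ori at hC'
      ext
      · simp only [ptl]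
        field_simp
        unfold dt
        linear_combination d.1 * hC'
      · simp only [ptl]
        field_simp
        unfold dt
        linear_combination d.2 * hC'
    have hσ0 : 0 ≤ (dt d y v - dt d q v) / (dt d p v - dt d q v) := by
      by_contra hneg
      push Not at hneg
      have h1 : dt d y v < dt d q v := by
        by_contra hh
        push Not at hh
        have := div_nonneg (sub_nonneg.2 hh) hd.le
        linarith
      have e1 := ori_ptl v q q p ((dt d y v - dt d q v) / (dt d p v - dt d q v))
      rw [hline, ori_self2, mul_zero, zero_add] at e1
      have e2 := pl1 d v q w' y
      have : ori v q y < 0 := by rw [e1]; exact mul_neg_of_neg_of_pos hneg i3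
      nlinarith
    have hσ1 : (dt d y v - dt d q v) / (dt d p v - dt d q v) ≤ 1 := by
      by_contra hneg
      push Not at hneg
      have h1 : dt d p v < dt d y v := by
        rw [one_lt_div hd] at hneg; linarith
      have e1 := ori_ptl p v q p ((dt d y v - dt d q v) / (dt d p v - dt d q v))
      rw [hline, ori_self3, mul_zero, add_zero] at e1
      have e2 := pl1 d v y w p
      have e3 : ori p v q = ori v q p := by unfold ori; ring
      have e4 : ori v y w = ori w v y := by unfold ori; ring
      have e5 : ori v y p = ori p v y := by unfold ori; ring
      rw [e4, e5] at e2
      have : ori p v y < 0 := by rw [e1, e3]; exact mul_neg_of_neg_of_pos (by linarith) i3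
      nlinarith
    rcases (edges_meet T hf hrt hne hσ0 hσ1 γ0 γ1 hline).1 with h' | h'
    · left
      rw [← hy] at h'
      rw [h'] at hA ⊢
      have := ori_swap' v q w'
      linarith
    · right
      rw [← hy] at h'
      rw [h'] at hB ⊢
      have := ori_swap v w p
      linarith
  have main : ∀ r t α s β, s(r, t) ∈ T.edges → α < s → s < β → 0 ≤ α → β ≤ 1 →
      0 < ori v w' (ptl r t s) → 0 < ori w v (ptl r t s) → 0 < ori q p (ptl r t s) →
      0 ≤ ori w v (ptl r t α) → 0 ≤ ori q p (ptl r t α) → 0 ≤ ori v w' (ptl r t β) →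
      0 ≤ ori q p (ptl r t β) → ori v w' (ptl r t α) = 0 → ori w v (ptl r t β) = 0 → False := by
    intro r t α s β hrt h1 h2 h3 h4 zA zB zC αB αC βA βC αz βz
    have αB' : 0 < ori w v (ptl r t α) := by
      have := ori_mid (a := w) (b := v) (r := r) (t := t) α s β
      rw [βz] at this
      nlinarith
    have βA' : 0 < ori v w' (ptl r t β) := by
      have := ori_mid (a := v) (b := w') (r := r) (t := t) α s β
      rw [αz] at this
      nlinarith
    have pα := pl1 d v w' (ptl r t α) w
    have pβ := pl1 d v w' (ptl r t β) w
    have e4 : ∀ y, ori v y w = ori w v y := fun y => by unfold ori; ring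
    rw [e4, αz] at pα
    rw [e4, βz] at pβ
    have Dα : dt d (ptl r t α) v < 0 := by
      by_contra hh; push Not at hh; nlinarith
    have Dβ : 0 < dt d (ptl r t β) v := by
      by_contra hh; push Not at hh; nlinarith
    have horient : ori v (ptl r t α) (ptl r t β) * ori v w' w =
        ori w v (ptl r t α) * ori v w' (ptl r t β) - ori v w' (ptl r t α) * ori w v (ptl r t β) := by
      unfold ori; ring
    have hor2 : ori v (ptl r t α) (ptl r t β) = (β - α) * ori v r t := by
      unfold ori ptl; ring
    rw [hor2, βz, mul_zero, sub_zero] at horient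
    have hrt0 : 0 < ori v r t := by
      have : 0 < ori w v (ptl r t α) * ori v w' (ptl r t β) := mul_pos αB' βA'
      rw [← horient] at this
      have h5 : 0 < (β - α) * ori v r t := pos_of_mul_pos_left this hW.le
      exact pos_of_mul_pos_right h5 (by linarith)
    have dα := dt_ptl d r t v α
    have dβ := dt_ptl d r t v β
    have hslope : 0 < dt d t v - dt d r v := by
      have : (β - α) * (dt d t v - dt d r v) = dt d (ptl r t β) v - dt d (ptl r t α) v := by
        rw [dα, dβ]; ring
      have h6 : 0 < (β - α) * (dt d t v - dt d r v) := by rw [this]; linarith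
      exact pos_of_mul_pos_right h6 (by linarith)
    have hDr : dt d r v < 0 := by nlinarith
    have hDt : 0 < dt d t v := by nlinarith
    have hit2 : Hit d v r t := ⟨hDr, hDt, hrt0⟩
    have hm := hmin r t hrt hit2
    have hc := hit_C hit hit2
    have hx : - dt d r v / (dt d t v - dt d r v) * (dt d t v - dt d r v) = - dt d r v := by
      field_simp
    set x := - dt d r v / (dt d t v - dt d r v)
    have hxα : α < x := by
      by_contra hh; push Not at hh; nlinarith
    have hxβ : x < β := by
      by_contra hh; push Not at hh; nlinarith
    have m1 := ori_mid (a := q) (b := p) (r := r) (t := t) α x β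
    have m2 := ori_mid (a := q) (b := p) (r := r) (t := t) α s β
    have hd : 0 < dt d p v - dt d q v := by have := hit.1; have := hit.2.1; linarith
    have : ori q p (ptl r t x) ≤ 0 := by rw [hc]; exact mul_nonpos_of_nonneg_of_nonpos hd.le (by linarith)
    have c1 : (β - x) * ori q p (ptl r t α) + (x - α) * ori q p (ptl r t β) ≤ 0 := by
      rw [m1]; exact mul_nonpos_of_nonneg_of_nonpos (by linarith) this
    have c2 : 0 < (β - s) * ori q p (ptl r t α) + (s - α) * ori q p (ptl r t β) := by
      rw [m2]; exact mul_pos (by linarith) zC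
    obtain ⟨c3, c4⟩ := two_zero (by linarith) (by linarith) αC βC c1
    rw [c3, c4] at c2
    simp at c2
  have hα : ori v w' (ptl r t α) = 0 ∨ ori w v (ptl r t α) = 0 := by
    rcases αz with h | h | h
    · exact Or.inl h
    · exact Or.inr h
    · exact hbd α α0 (by linarith) αA αB h
  have hβ : ori v w' (ptl r t β) = 0 ∨ ori w v (ptl r t β) = 0 := by
    rcases βz with h | h | h
    · exact Or.inl h
    · exact Or.inr h
    · exact hbd β (by linarith) β1 βA βB h
  rcases hα with hα | hα <;> rcases hβ with hβ | hβ
  · have := ori_mid (a := v) (b := w') (r := r) (t := t) α s β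
    rw [hα, hβ] at this
    nlinarith
  · exact main r t α s β hrt αs βs α0 β1 zA zB zC αB αC βA βC hα hβ
  · have hs := fun γ => ptl_symm r t γ
    rw [hs] at zA zB zC αB αC βA βC hα hβ αA βB
    exact main t r (1 - β) (1 - s) (1 - α) (edge_symm hrt) (by linarith) (by linarith) (by linarith)
      (by linarith) zA zB zC βB βC αA αC hβ hα
  · have := ori_mid (a := w) (b := v) (r := r) (t := t) α s β
    rw [hα, hβ] at this
    nlinarith

end PartE

section PartF
open Filter Topology

/-- A triangular face (counterclockwise). -/
def Face {S : Finset Pt} (T : PlaneGraph S) (a b c : Pt) : Prop :=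
  0 < ori a b c ∧ s(a, b) ∈ T.edges ∧ s(b, c) ∈ T.edges ∧ s(c, a) ∈ T.edges ∧
  ∀ u ∈ S, ¬ (0 < ori a b u ∧ 0 < ori b c u ∧ 0 < ori c a u)

lemma Face.cyc {S : Finset Pt} {T : PlaneGraph S} {a b c : Pt} (h : Face T a b c) : Face T b c a := by
  obtain ⟨h1, h2, h3, h4, h5⟩ := h
  exact ⟨by rw [ori_cyc]; exact h1, h3, h4, h2, fun u hu ⟨x, y, z⟩ => h5 u hu ⟨z, x, y⟩⟩

lemma enter_aux {a b r t : Pt} {u : ℝ} (hu : 0 < u)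
    (h : 0 < ori a b (ptl r t u) ∨ (ori a b (ptl r t u) = 0 ∧ 0 < ori a b r)) :
    ∀ᶠ x in 𝓝[<] u, 0 < ori a b (ptl r t x) := by
  rcases h with h | ⟨h, h'⟩
  · have hc : Continuous fun x => ori a b (ptl r t x) := by simp only [ori_ptl]; fun_prop
    exact nhdsWithin_le_nhds (hc.continuousAt.eventually (lt_mem_nhds h))
  · filter_upwards [self_mem_nhdsWithin] with x hx
    have hx : x < u := hx
    rw [ori_ptl] at h ⊢
    have : u * ((1 - x) * ori a b r + x * ori a b t) = (u - x) * ori a b r := by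
      linear_combination x * h
    have h2 : 0 < u * ((1 - x) * ori a b r + x * ori a b t) := by
      rw [this]; exact mul_pos (by linarith) h'
    exact pos_of_mul_pos_right h2 hu.le

lemma enter {a b c d e f r t : Pt} {u : ℝ} (hu : 0 < u)
    (h1 : 0 < ori a b (ptl r t u) ∨ (ori a b (ptl r t u) = 0 ∧ 0 < ori a b r))
    (h2 : 0 < ori c d (ptl r t u) ∨ (ori c d (ptl r t u) = 0 ∧ 0 < ori c d r))
    (h3 : 0 < ori e f (ptl r t u) ∨ (ori e f (ptl r t u) = 0 ∧ 0 < ori e f r)) :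
    ∃ x, 0 < x ∧ x < u ∧ 0 < ori a b (ptl r t x) ∧ 0 < ori c d (ptl r t x) ∧
      0 < ori e f (ptl r t x) := by
  have hm : ∀ᶠ x in 𝓝[<] u, 0 < x ∧ x < u := Ioo_mem_nhdsLT hu
  obtain ⟨x, hx, a1, a2, a3⟩ := (hm.and ((enter_aux hu h1).and ((enter_aux hu h2).and
    (enter_aux hu h3)))).exists
  exact ⟨x, hx.1, hx.2, a1, a2, a3⟩

lemma face_free {S : Finset Pt} (T : PlaneGraph S) {a b c : Pt} (hF : Face T a b c)
    {r t : Pt} (hrt : s(r, t) ∈ T.edges) {s : ℝ} (hs0 : 0 ≤ s) (hs1 : s ≤ 1) :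
    ¬ (0 < ori a b (ptl r t s) ∧ 0 < ori b c (ptl r t s) ∧ 0 < ori c a (ptl r t s)) := by
  rintro ⟨zA, zB, zC⟩
  obtain ⟨h1, h2, h3, h4, hno⟩ := hF
  have hr := edge_l T hrt
  have ht := edge_r T hrt
  obtain ⟨α, α0, αs, αA, αB, αC, αz⟩ := exit_ori hs0 zA zB zC (hno r hr)
  obtain ⟨β, β1, βs, βA, βB, βC, βz⟩ := exit_ori' hs1 zA zB zC (hno t ht)
  have side : ∀ a b c : Pt, 0 < ori a b c → s(a, b) ∈ T.edges → 0 < ori a b (ptl r t s) →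
      ∀ γ, 0 ≤ γ → γ ≤ 1 → ori a b (ptl r t γ) = 0 → 0 ≤ ori b c (ptl r t γ) →
      0 ≤ ori c a (ptl r t γ) → ptl r t γ = a ∨ ptl r t γ = b := by
    intro a b c h1 h2 hz γ γ0 γ1 hA hB hC
    have hne : s(a, b) ≠ s(r, t) := by
      intro he
      rw [ori_ptl] at hz
      rw [Sym2.eq_iff] at he
      rcases he with ⟨rfl, rfl⟩ | ⟨rfl, rfl⟩ <;> simp at hz
    set y := ptl r t γ with hy
    have hsum : ori a b y + ori b c y + ori c a y = ori a b c := by unfold ori; ring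
    have hline : ptl a b (ori c a y / ori a b c) = y := by
      have hA' := hA
      have hne0 : ori a b c ≠ 0 := h1.ne'
      ext
      · simp only [ptl]
        field_simp
        unfold ori at hA' ⊢
        linear_combination (c.1 - a.1) * (-1) * hA'
      · simp only [ptl]
        field_simp
        unfold ori at hA' ⊢
        linear_combination (c.2 - a.2) * (-1) * hA'
    exact (edges_meet T h2 hrt hne (div_nonneg hC h1.le)
      (by rw [div_le_one h1]; linarith) γ0 γ1 hline).1
  have vert : ∀ γ, 0 ≤ γ → γ ≤ 1 → 0 ≤ ori a b (ptl r t γ) → 0 ≤ ori b c (ptl r t γ) →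
      0 ≤ ori c a (ptl r t γ) → (ori a b (ptl r t γ) = 0 ∨ ori b c (ptl r t γ) = 0 ∨
      ori c a (ptl r t γ) = 0) → ptl r t γ = a ∨ ptl r t γ = b ∨ ptl r t γ = c := by
    intro γ γ0 γ1 hA hB hC hz
    rcases hz with hz | hz | hz
    · have := side a b c h1 h2 zA γ γ0 γ1 hz hB hC
      tauto
    · have := side b c a (by rw [ori_cyc]; exact h1) h3 zB γ γ0 γ1 hz hC hA
      tauto
    · have := side c a b (by rw [ori_cyc, ori_cyc]; exact h1) h4 zC γ γ0 γ1 hz hA hB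
      tauto
  have fin : ∀ x y, ori x y (ptl r t α) = 0 → ori x y (ptl r t β) = 0 → 0 < ori x y (ptl r t s) →
      False := by
    intro x y e1 e2 e3
    have := ori_mid (a := x) (b := y) (r := r) (t := t) α s β
    rw [e1, e2] at this
    have h5 : 0 < (β - α) * ori x y (ptl r t s) := mul_pos (by linarith) e3
    linarith
  rcases vert α α0 (by linarith) αA αB αC αz with h | h | h <;>
  rcases vert β (by linarith) β1 βA βB βC βz with h' | h' | h'
  · exact fin a b (by simp [h]) (by simp [h']) zA
  · exact fin a b (by simp [h]) (by simp [h']) zA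
  · exact fin c a (by simp [h]) (by simp [h']) zC
  · exact fin a b (by simp [h]) (by simp [h']) zA
  · exact fin a b (by simp [h]) (by simp [h']) zA
  · exact fin b c (by simp [h]) (by simp [h']) zB
  · exact fin c a (by simp [h]) (by simp [h']) zC
  · exact fin b c (by simp [h]) (by simp [h']) zB
  · exact fin b c (by simp [h]) (by simp [h']) zB

/-- Step 1 of the key lemma: some edge of the triangulation is hit. -/
lemma exists_hit_edge {S : Finset Pt} (hS : GP S) {T : PlaneGraph S} (hT : IsTriangulation T)
    {v d : Pt} (H0 : ∀ u ∈ S, u ≠ v → dt d u v ≠ 0)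
    (hex : ∃ p ∈ S, ∃ q ∈ S, Hit d v q p) :
    ∃ q p, s(q, p) ∈ T.edges ∧ Hit d v q p := by
  let P : Finset (Pt × Pt) := (S ×ˢ S).filter (fun x => Hit d v x.1 x.2)
  have hne : P.Nonempty := by
    obtain ⟨p, hp, q, hq, h⟩ := hex
    exact ⟨(q, p), by simp [P, hp, hq, h]⟩
  obtain ⟨⟨q, p⟩, hmem, hmax⟩ := P.exists_max_image (fun x => hitT d v x.1 x.2) hne
  simp only [P, Finset.mem_filter, Finset.mem_product] at hmem hmax
  obtain ⟨⟨hq, hp⟩, i1, i2, i3⟩ := hmem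
  refine ⟨q, p, ?_, i1, i2, i3⟩
  have above : ∀ u ∈ S, 0 ≤ ori q p u := by
    intro u hu
    by_contra hneg
    push Not at hneg
    have huv : u ≠ v := by
      rintro rfl
      have : ori q p u = ori u q p := by unfold ori; ring
      linarith
    have hd : 0 < dt d p v - dt d q v := by linarith
    rcases lt_or_gt_of_ne (H0 u hu huv) with hD | hD
    · have e1 : ori v u p * (dt d p v - dt d q v) - ori v q p * (dt d p v - dt d u v) =
          - dt d p v * ori q p u := by unfold ori dt; ring
      have e2 : 0 < - dt d p v * ori q p u := mul_pos_of_neg_of_neg (by linarith) hneg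
      have e3 : 0 < ori v q p * (dt d p v - dt d u v) := mul_pos i3 (by linarith)
      have e4 : 0 < ori v u p := by
        have : 0 < ori v u p * (dt d p v - dt d q v) := by linarith
        exact pos_of_mul_pos_left this hd.le
      have := hmax (u, p) ⟨⟨hu, hp⟩, hD, i2, e4⟩
      simp only [hitT] at this
      rw [div_le_div_iff₀ (by linarith) hd] at this
      linarith
    · have e1 : ori v q u * (dt d p v - dt d q v) - ori v q p * (dt d u v - dt d q v) =
          dt d q v * ori q p u := by unfold ori dt; ring
      have e2 : 0 < dt d q v * ori q p u := mul_pos_of_neg_of_neg i1 hneg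
      have e3 : 0 < ori v q p * (dt d u v - dt d q v) := mul_pos i3 (by linarith)
      have e4 : 0 < ori v q u := by
        have : 0 < ori v q u * (dt d p v - dt d q v) := by linarith
        exact pos_of_mul_pos_left this hd.le
      have := hmax (q, u) ⟨⟨hq, hu⟩, i1, hD, e4⟩
      simp only [hitT] at this
      rw [div_le_div_iff₀ (by linarith) hd] at this
      linarith
  apply tri_edge hS hT hq hp
  · rintro rfl; linarith
  · intro r t hrt hc
    have a1 := above r (edge_l T hrt)
    have a2 := above t (edge_r T hrt)
    have := hc.1
    have := mul_nonneg a1 a2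
    linarith

/-- Points in the closed left wedge, extremal one. -/
lemma exists_left {S : Finset Pt} {v d p q : Pt} (hp : p ∈ S) (i2 : 0 < dt d p v) :
    ∃ w ∈ S, 0 < dt d w v ∧ 0 ≤ ori v w p ∧ 0 ≤ ori q p w ∧
      ∀ u ∈ S, 0 < dt d u v → 0 ≤ ori v u p → 0 ≤ ori q p u → 0 ≤ ori v w u := by
  let L := S.filter (fun u => 0 < dt d u v ∧ 0 ≤ ori v u p ∧ 0 ≤ ori q p u)
  have hne : L.Nonempty := ⟨p, by simp [L, hp, i2]⟩
  obtain ⟨w, hmem, hmax⟩ := L.exists_max_image (fun u => ori v u p / dt d u v) hne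
  simp only [L, Finset.mem_filter] at hmem hmax
  obtain ⟨hw, w1, w2, w3⟩ := hmem
  refine ⟨w, hw, w1, w2, w3, ?_⟩
  intro u hu u1 u2 u3
  have h := hmax u ⟨hu, u1, u2, u3⟩
  rw [div_le_div_iff₀ u1 w1] at h
  have := pl1 d v w u p
  have h2 : 0 ≤ ori v w u * dt d p v := by linarith
  exact nonneg_of_mul_nonneg_left h2 i2

lemma exists_right {S : Finset Pt} {v d p q : Pt} (hq : q ∈ S) (i1 : dt d q v < 0) :
    ∃ w ∈ S, dt d w v < 0 ∧ 0 ≤ ori v q w ∧ 0 ≤ ori q p w ∧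
      ∀ u ∈ S, dt d u v < 0 → 0 ≤ ori v q u → 0 ≤ ori q p u → 0 ≤ ori v u w := by
  let L := S.filter (fun u => dt d u v < 0 ∧ 0 ≤ ori v q u ∧ 0 ≤ ori q p u)
  have hne : L.Nonempty := ⟨q, by simp [L, hq, i1]⟩
  obtain ⟨w, hmem, hmax⟩ := L.exists_max_image (fun u => ori v q u / (- dt d u v)) hne
  simp only [L, Finset.mem_filter] at hmem hmax
  obtain ⟨hw, w1, w2, w3⟩ := hmem
  refine ⟨w, hw, w1, w2, w3, ?_⟩
  intro u hu u1 u2 u3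
  have h := hmax u ⟨hu, u1, u2, u3⟩
  rw [div_le_div_iff₀ (by linarith) (by linarith)] at h
  have := pl1 d v q u w
  have h2 : 0 ≤ ori v u w * (- dt d q v) := by linarith
  exact nonneg_of_mul_nonneg_left h2 (by linarith)

lemma key_lemma {S : Finset Pt} (hS : GP S) {T : PlaneGraph S} (hT : IsTriangulation T)
    {v d : Pt} (hv : v ∈ S) (H0 : ∀ u ∈ S, u ≠ v → dt d u v ≠ 0)
    (hex : ∃ p ∈ S, ∃ q ∈ S, Hit d v q p) :
    ∃ q p, Hit d v q p ∧ Face T v q p := by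
  obtain ⟨q0, p0, he0, hh0⟩ := exists_hit_edge hS hT H0 hex
  let P : Finset (Pt × Pt) := (S ×ˢ S).filter (fun x => s(x.1, x.2) ∈ T.edges ∧ Hit d v x.1 x.2)
  have hne : P.Nonempty :=
    ⟨(q0, p0), by simp [P, edge_l T he0, edge_r T he0, he0, hh0]⟩
  obtain ⟨⟨q, p⟩, hmem, hmin'⟩ := P.exists_min_image (fun x => hitT d v x.1 x.2) hne
  simp only [P, Finset.mem_filter, Finset.mem_product] at hmem hmin'
  obtain ⟨⟨hq, hp⟩, hf, hit⟩ := hmem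
  have hmin : ∀ r t, s(r, t) ∈ T.edges → Hit d v r t → hitT d v q p ≤ hitT d v r t :=
    fun r t h1 h2 => hmin' (r, t) ⟨⟨edge_l T h1, edge_r T h1⟩, h1, h2⟩
  clear hmin' hne P
  have hit' := hit
  obtain ⟨i1, i2, i3⟩ := hit'
  have hqp : q ≠ p := edge_ne T hf
  obtain ⟨w, hw, w1, w2, w3, w4⟩ := exists_left (S := S) (v := v) (d := d) (q := q) hp i2
  obtain ⟨w', hw', x1, x2, x3, x4⟩ := exists_right (S := S) (v := v) (d := d) (p := p) hq i1
  have hW : 0 < ori v w' w := by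
    have e : ori v w' w * (- dt d q v * dt d p v) = (- dt d w' v) * ori v w p * (- dt d q v) +
        (- dt d w' v) * dt d w v * ori v q p + ori v q w' * dt d w v * dt d p v := by
      unfold ori dt; ring
    have a1 : 0 ≤ (- dt d w' v) * ori v w p * (- dt d q v) :=
      mul_nonneg (mul_nonneg (by linarith) w2) (by linarith)
    have a2 : 0 < (- dt d w' v) * dt d w v * ori v q p :=
      mul_pos (mul_pos (by linarith) w1) i3
    have a3 : 0 ≤ ori v q w' * dt d w v * dt d p v :=
      mul_nonneg (mul_nonneg x2 w1.le) i2.le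
    have a4 : 0 < ori v w' w * (- dt d q v * dt d p v) := by linarith
    exact pos_of_mul_pos_left a4 (mul_nonneg (by linarith) i2.le)
  have hno : ∀ u ∈ S, ¬ (0 < ori v w' u ∧ 0 < ori w v u ∧ 0 < ori q p u) := by
    rintro u hu ⟨b1, b2, b3⟩
    have huv : u ≠ v := by rintro rfl; simp at b1
    rcases lt_or_gt_of_ne (H0 u hu huv) with hD | hD
    · have e := pl1 d v q w' u
      have e1 : 0 ≤ ori v q u := by
        have g1 : ori v q w' * dt d u v ≤ 0 := mul_nonpos_of_nonneg_of_nonpos x2 hD.le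
        have g2 : ori v w' u * dt d q v ≤ 0 := mul_nonpos_of_nonneg_of_nonpos b1.le i1.le
        have g3 : 0 ≤ ori v q u * (- dt d w' v) := by linarith
        exact nonneg_of_mul_nonneg_left g3 (by linarith)
      have := x4 u hu hD e1 b3.le
      rw [ori_swap'] at this
      linarith
    · have e := pl1 d v u w p
      have e4 : ori v u w = ori w v u := by unfold ori; ring
      rw [e4] at e
      have e1 : 0 ≤ ori v u p := by
        have g1 : 0 ≤ ori w v u * dt d p v := mul_nonneg b2.le i2.le
        have g2 : 0 ≤ ori v w p * dt d u v := mul_nonneg w2 hD.le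
        have g3 : 0 ≤ ori v u p * dt d w v := by linarith
        exact nonneg_of_mul_nonneg_left g3 w1
      have := w4 u hu hD e1 b3.le
      rw [ori_swap] at this
      linarith
  have hfree := fun {r t : Pt} (hrt : s(r, t) ∈ T.edges) {s : ℝ} (hs0 : 0 ≤ s) (hs1 : s ≤ 1) =>
    region_free hS T hf hit hmin w1 w2 x1 x2 hW hno hrt hs0 hs1
  have heq : w = p ∧ w' = q := by
    by_contra hcon
    have hC : 0 < ori q p w ∨ 0 < ori q p w' := by
      by_contra hh
      push Not at hh
      have c1 : ori q p w = 0 := le_antisymm hh.1 w3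
      have c2 : ori q p w' = 0 := le_antisymm hh.2 x3
      apply hcon
      constructor
      · rcases gp_eq hS hq hp hw hqp c1 with rfl | rfl
        · linarith
        · rfl
      · rcases gp_eq hS hq hp hw' hqp c2 with rfl | rfl
        · rfl
        · linarith
    have hCs : ∀ s : ℝ, 0 < s → s < 1 → 0 < ori q p (ptl w' w s) := by
      intro s s0 s1
      rw [ori_ptl]
      rcases hC with h | h
      · have g1 := mul_pos s0 h
        have g2 := mul_nonneg (by linarith : 0 ≤ 1 - s) x3
        linarith
      · have g1 := mul_nonneg s0.le w3
        have g2 := mul_pos (by linarith : 0 < 1 - s) h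
        linarith
    have hedge : s(w', w) ∈ T.edges := by
      apply tri_edge hS hT hw' hw
      · rintro rfl; linarith
      · intro r t hrt hc
        obtain ⟨s, u, s0, s1, u0, u1, h⟩ := Cr_point hc
        apply hfree hrt u0.le u1.le
        rw [← h]
        refine ⟨?_, ?_, hCs s s0 s1⟩
        · rw [ori_ptl, ori_self2, mul_zero, zero_add]; exact mul_pos s0 hW
        · rw [ori_ptl, ori_self3, mul_zero, add_zero]
          have : ori w v w' = ori v w' w := by unfold ori; ring
          rw [this]; exact mul_pos (by linarith) hW
    have hit2 : Hit d v w' w := ⟨x1, w1, hW⟩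
    have hm := hmin w' w hedge hit2
    have hc := hit_C hit hit2
    have hdd : 0 < dt d w v - dt d w' v := by linarith
    have hx := hCs (- dt d w' v / (dt d w v - dt d w' v)) (div_pos (by linarith) hdd)
      (by rw [div_lt_one hdd]; linarith)
    rw [hc] at hx
    have : (dt d p v - dt d q v) * (hitT d v q p - hitT d v w' w) ≤ 0 :=
      mul_nonpos_of_nonneg_of_nonpos (by linarith) (by linarith)
    linarith
  obtain ⟨rfl, rfl⟩ := heq
  have hwv : w ≠ v := by rintro rfl; simp at hW
  have hw'v : w' ≠ v := by rintro rfl; simp at hW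
  have o1 : ori w v w' = ori v w' w := by unfold ori; ring
  have o2 : ori w' w v = ori v w' w := by unfold ori; ring
  refine ⟨w', w, hit, hW, ?_, hf, ?_, ?_⟩
  · apply tri_edge hS hT hv hw' hw'v.symm
    have main : ∀ r t, s(r, t) ∈ T.edges → Cr v w' r t → 0 < ori v w' r → False := by
      intro r t hrt hc hr0
      obtain ⟨s, u, s0, s1, u0, u1, h⟩ := Cr_point hc
      obtain ⟨x, y1, y2, y3⟩ := enter (a := v) (b := w') (c := w) (d := v) (e := w') (f := w)
        (r := r) (t := t) u0
        (Or.inr ⟨by rw [← h, ori_ptl]; simp, hr0⟩)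
        (Or.inl (by
          rw [← h, ori_ptl, ori_self2, mul_zero, zero_add, o1]; exact mul_pos s0 hW))
        (Or.inl (by
          rw [← h, ori_ptl, ori_self3, mul_zero, add_zero, o2]; exact mul_pos (by linarith) hW))
      exact hfree hrt y1.le (by linarith) y3
    intro r t hrt hc
    rcases lt_trichotomy (ori v w' r) 0 with hr0 | hr0 | hr0
    · refine main t r (edge_symm hrt) (Cr_flip hc) ?_
      have := hc.1
      by_contra hh; push Not at hh
      have := mul_nonneg_of_nonpos_of_nonpos hr0.le hh
      linarith
    · have := hc.1; rw [hr0] at this; simp at this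
    · exact main r t hrt hc hr0
  · apply tri_edge hS hT hw hv hwv
    have main : ∀ r t, s(r, t) ∈ T.edges → Cr w v r t → 0 < ori w v r → False := by
      intro r t hrt hc hr0
      obtain ⟨s, u, s0, s1, u0, u1, h⟩ := Cr_point hc
      obtain ⟨x, y1, y2, y3⟩ := enter (a := v) (b := w') (c := w) (d := v) (e := w') (f := w)
        (r := r) (t := t) u0
        (Or.inl (by
          rw [← h, ori_ptl, ori_self3, mul_zero, add_zero]; exact mul_pos (by linarith) hW))
        (Or.inr ⟨by rw [← h, ori_ptl]; simp, hr0⟩)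
        (Or.inl (by
          rw [← h, ori_ptl, ori_self2, mul_zero, zero_add, o2]; exact mul_pos s0 hW))
      exact hfree hrt y1.le (by linarith) y3
    intro r t hrt hc
    rcases lt_trichotomy (ori w v r) 0 with hr0 | hr0 | hr0
    · refine main t r (edge_symm hrt) (Cr_flip hc) ?_
      have := hc.1
      by_contra hh; push Not at hh
      have := mul_nonneg_of_nonpos_of_nonpos hr0.le hh
      linarith
    · have := hc.1; rw [hr0] at this; simp at this
    · exact main r t hrt hc hr0
  · rintro u hu ⟨a1, a2, a3⟩
    exact hno u hu ⟨a1, a3, a2⟩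

lemma exists_eps {ι : Type} (S : Finset ι) (f g : ι → ℝ) (h : ∀ i ∈ S, f i ≠ 0 ∨ g i ≠ 0) :
    ∃ ε : ℝ, 0 < ε ∧ ∀ i ∈ S, f i + ε * g i ≠ 0 := by
  obtain ⟨ε, h1, h2⟩ := (Set.Ioi_infinite (0 : ℝ)).exists_notMem_finset (S.image fun i => - f i / g i)
  refine ⟨ε, h1, ?_⟩
  intro i hi h0
  apply h2
  rw [Finset.mem_image]
  refine ⟨i, hi, ?_⟩
  have hg : g i ≠ 0 := by
    intro hg
    rw [hg] at h0
    rcases h i hi with h' | h'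
    · exact h' (by linarith)
    · exact h' hg
  field_simp
  linarith

lemma exists_face {S : Finset Pt} (hS : GP S) {T : PlaneGraph S} (hT : IsTriangulation T)
    {a b : Pt} (hab : s(a, b) ∈ T.edges) (hex : ∃ u ∈ S, 0 < ori a b u) :
    ∃ c, Face T a b c := by
  have ha := edge_l T hab
  have hb := edge_r T hab
  have hne := edge_ne T hab
  obtain ⟨u0, hu0, hu0'⟩ := hex
  let L := S.filter (fun u => 0 < ori a b u)
  obtain ⟨c, hmem, hmax⟩ := L.exists_max_image (fun u => ori a u u0 / ori a b u)
    ⟨u0, by simp [L, hu0, hu0']⟩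
  simp only [L, Finset.mem_filter] at hmem hmax
  obtain ⟨hc, hc'⟩ := hmem
  have hmin : ∀ u ∈ S, 0 < ori a b u → 0 ≤ ori a c u := by
    intro u hu hu'
    have h := hmax u ⟨hu, hu'⟩
    rw [div_le_div_iff₀ hu' hc'] at h
    have e : ori a c u * ori a b u0 + ori a u u0 * ori a b c = ori a c u0 * ori a b u := by
      unfold ori; ring
    have : 0 ≤ ori a c u * ori a b u0 := by linarith
    exact nonneg_of_mul_nonneg_left this hu0'
  clear hmax L
  obtain ⟨ε, hε, hgen⟩ := exists_eps (S.erase a) (fun u => ori a b u) (fun u => ori a c u) (by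
    intro u hu
    by_contra hh
    push Not at hh
    have hu1 := (Finset.mem_erase.1 hu).1
    have hu2 := (Finset.mem_erase.1 hu).2
    rcases gp_eq hS ha hb hu2 hne hh.1 with rfl | rfl
    · exact hu1 rfl
    · have := ori_swap' a u c
      have := hh.2
      linarith)
  let d : Pt := ((b.1 - a.1) + ε * (c.1 - a.1), (b.2 - a.2) + ε * (c.2 - a.2))
  have hd : ∀ u, dt d u a = ori a b u + ε * ori a c u := by
    intro u; simp only [d, dt, ori]; ring
  have hdb : dt d b a < 0 := by
    rw [hd, ori_self2, zero_add, ori_swap']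
    have := mul_pos hε hc'
    linarith
  have hdc : 0 < dt d c a := by rw [hd]; simp [hc']
  obtain ⟨q, p, hit, hF⟩ := key_lemma hS hT (d := d) ha
    (fun u hu hua => by rw [hd]; exact hgen u (Finset.mem_erase.2 ⟨hua, hu⟩))
    ⟨c, hc, b, hb, hdb, hdc, hc'⟩
  obtain ⟨i1, i2, i3⟩ := hit
  have hq : q ∈ S := edge_r T hF.2.1
  by_cases hqb : q = b
  · subst hqb; exact ⟨p, hF⟩
  exfalso
  have hqa : q ≠ a := (edge_ne T hF.2.1).symm
  have hbq : ori a b q < 0 := by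
    rcases lt_trichotomy (ori a b q) 0 with h | h | h
    · exact h
    · rcases gp_eq hS ha hb hq hne h with h | h
      · exact absurd h hqa
      · exact absurd h hqb
    · have h2 := hmin q hq h
      rw [hd] at i1
      have := mul_nonneg hε.le h2
      linarith
  by_cases hbp : 0 < ori a b p
  · obtain ⟨x, x0, x1, y1, y2, y3⟩ := enter (a := a) (b := q) (c := q) (d := p) (e := p) (f := a)
      (r := b) (t := a) (u := 1) one_pos
      (Or.inr ⟨by rw [ptl_one]; simp, by rw [ori_swap']; linarith⟩)
      (Or.inl (by rw [ptl_one]; have : ori q p a = ori a q p := by { unfold ori; ring }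
                  rw [this]; exact i3))
      (Or.inr ⟨by rw [ptl_one]; simp, by
        have : ori p a b = ori a b p := by unfold ori; ring
        rw [this]; exact hbp⟩)
    exact face_free T hF (edge_symm hab) x0.le x1.le ⟨y1, y2, y3⟩
  · push Not at hbp
    have e := pl1 d a q b p
    have g1 : 0 < ori a q b * dt d p a := mul_pos (by rw [ori_swap']; linarith) i2
    have g2 : 0 ≤ ori a b p * dt d q a := mul_nonneg_of_nonpos_of_nonpos hbp i1.le
    have g3 : ori a q p * dt d b a < 0 := mul_neg_of_pos_of_neg i3 hdb
    linarith

end PartF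

section PartG

lemma on_side {a b c y : Pt} (h1 : 0 < ori a b c) (hA : ori a b y = 0) :
    ptl a b (ori c a y / ori a b c) = y := by
  have hne0 : ori a b c ≠ 0 := h1.ne'
  ext
  · simp only [ptl]
    field_simp
    unfold ori at hA ⊢
    linear_combination (c.1 - a.1) * (-1) * hA
  · simp only [ptl]
    field_simp
    unfold ori at hA ⊢
    linear_combination (c.2 - a.2) * (-1) * hA

lemma ori_sum (a b c y : Pt) : ori a b y + ori b c y + ori c a y = ori a b c := by
  unfold ori; ring

/-- Every open half plane through `a` contains an edge of `G` at `a`. -/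
def GoodAt (E : Finset (Sym2 Pt)) (a : Pt) : Prop :=
  ∀ δ : Pt, δ ≠ 0 → ∃ n, s(a, n) ∈ E ∧ 0 < dt δ n a

/-- A supporting line at `a`. -/
def SuppAt (S : Finset Pt) (a : Pt) : Prop :=
  ∃ δ : Pt, δ ≠ 0 ∧ ∀ u ∈ S, 0 ≤ dt δ u a

/-- The edge set forces a convex decomposition. -/
structure GoodD (S : Finset Pt) (E : Finset (Sym2 Pt)) : Prop where
  hull : ∀ a ∈ S, ∀ b ∈ S, a ≠ b → (∀ u ∈ S, 0 ≤ ori a b u) → s(a, b) ∈ E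
  good : ∀ a ∈ S, GoodAt E a ∨ SuppAt S a

lemma GoodD.mono {S : Finset Pt} {E F : Finset (Sym2 Pt)} (h : GoodD S E) (hEF : E ⊆ F) :
    GoodD S F := by
  refine ⟨fun a ha b hb hab hu => hEF (h.hull a ha b hb hab hu), fun a ha => ?_⟩
  rcases h.good a ha with hg | hg
  · left
    intro δ hδ
    obtain ⟨n, h1, h2⟩ := hg δ hδ
    exact ⟨n, hEF h1, h2⟩
  · exact Or.inr hg

lemma convex_at {S : Finset Pt} (hS : GP S) {T : PlaneGraph S} {E : Finset (Sym2 Pt)}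
    (hE : E ⊆ T.edges) (hD : GoodD S E) {a b c d : Pt} (h1 : Face T a b c) (h2 : Face T b a d)
    (hab : s(a, b) ∉ E) : 0 < ori a d c := by
  have ha : a ∈ S := edge_l T h1.2.1
  have hb : b ∈ S := edge_r T h1.2.1
  have hc : c ∈ S := edge_r T h1.2.2.1
  have hd : d ∈ S := edge_r T h2.2.2.1
  have hne : a ≠ b := edge_ne T h1.2.1
  have hca : c ≠ a := edge_ne T h1.2.2.2.1
  have had : a ≠ d := edge_ne T h2.2.2.1
  have o1 : 0 < ori a b c := h1.1
  have o2 : 0 < ori a d b := by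
    have := h2.1
    have e : ori b a d = ori a d b := by unfold ori; ring
    rwa [e] at this
  have hcd : c ≠ d := by
    rintro rfl
    rw [ori_swap'] at o2
    linarith
  rcases lt_trichotomy (ori a d c) 0 with hlt | heq | hgt
  rotate_left
  · exact absurd heq (hS a ha d hd c hc had hca.symm hcd.symm)
  · exact hgt
  exfalso
  rcases hD.good a ha with hg | ⟨δ, hδ, hs⟩
  · obtain ⟨n, hn, hn'⟩ := hg (d.1 - a.1, d.2 - a.2) (by
      intro h
      have h1 := congrArg Prod.fst h
      have h2 := congrArg Prod.snd h
      simp at h1 h2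
      apply had
      ext <;> linarith)
    have hn2 : 0 < ori a d n := hn'
    have hnT := hE hn
    have hnS := edge_r T hnT
    have hna : a ≠ n := edge_ne T hnT
    have hnb : b ≠ n := by rintro rfl; exact hab hn
    rcases lt_or_gt_of_ne (hS a ha b hb n hnS hne hna hnb) with hh | hh
    · obtain ⟨x, x0, x1, y⟩ := enter (a := b) (b := a) (c := a) (d := d) (e := d) (f := b)
        (r := n) (t := a) (u := 1) one_pos
        (Or.inr ⟨by rw [ptl_one]; simp, by rw [ori_swap]; linarith⟩)
        (Or.inr ⟨by rw [ptl_one]; simp, hn2⟩)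
        (Or.inl (by
          rw [ptl_one]
          have e : ori d b a = ori a d b := by unfold ori; ring
          rw [e]; exact o2))
      exact face_free T h2 (edge_symm hnT) x0.le x1.le y
    · have hnc : 0 < ori c a n := by
        by_contra hcon
        push Not at hcon
        have e : ori a b n * ori a d c + ori c a n * ori a d b = ori a b c * ori a d n := by
          unfold ori; ring
        have g1 : ori a b n * ori a d c ≤ 0 := mul_nonpos_of_nonneg_of_nonpos hh.le hlt.le
        have g2 : ori c a n * ori a d b ≤ 0 := mul_nonpos_of_nonpos_of_nonneg hcon o2.le
        have g3 := mul_pos o1 hn2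
        linarith
      obtain ⟨x, x0, x1, y⟩ := enter (a := a) (b := b) (c := b) (d := c) (e := c) (f := a)
        (r := n) (t := a) (u := 1) one_pos
        (Or.inr ⟨by rw [ptl_one]; simp, hh⟩)
        (Or.inl (by
          rw [ptl_one]
          have e : ori b c a = ori a b c := by unfold ori; ring
          rw [e]; exact o1))
        (Or.inr ⟨by rw [ptl_one]; simp, hnc⟩)
      exact face_free T h1 (edge_symm hnT) x0.le x1.le y
  · have e := pl1 δ a d b c
    have k1 := hs c hc
    have k2 := hs d hd
    have k3 := hs b hb
    have g : ori a d c * dt δ b a ≤ 0 := mul_nonpos_of_nonpos_of_nonneg hlt.le k3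
    obtain ⟨z1, z2⟩ := two_zero o2 o1 k1 k2 (by linarith)
    apply hδ
    unfold dt at z1 z2
    have t1 : δ.1 * ori a d c = 0 := by
      unfold ori
      linear_combination (d.1 - a.1) * z1 - (c.1 - a.1) * z2
    have t2 : δ.2 * ori a d c = 0 := by
      unfold ori
      linear_combination (d.2 - a.2) * z1 - (c.2 - a.2) * z2
    ext
    · exact (mul_eq_zero.1 t1).resolve_right hlt.ne
    · exact (mul_eq_zero.1 t2).resolve_right hlt.ne

lemma flip_lemma {S : Finset Pt} (hS : GP S) {T : PlaneGraph S} (hT : IsTriangulation T)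
    {E : Finset (Sym2 Pt)} (hE : E ⊆ T.edges) (hD : GoodD S E) {a b : Pt}
    (hab : s(a, b) ∈ T.edges) (habE : s(a, b) ∉ E) :
    ∃ c d, Cr a b c d ∧ ∃ T' : PlaneGraph S,
      T'.edges = insert s(c, d) (T.edges.erase s(a, b)) := by
  have ha : a ∈ S := edge_l T hab
  have hb : b ∈ S := edge_r T hab
  have hne : a ≠ b := edge_ne T hab
  have u1 : ∃ u ∈ S, 0 < ori b a u := by
    by_contra hh
    push Not at hh
    apply habE
    apply hD.hull a ha b hb hne
    intro u hu
    have := hh u hu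
    rw [ori_swap] at this
    linarith
  have u2 : ∃ u ∈ S, 0 < ori a b u := by
    by_contra hh
    push Not at hh
    apply habE
    rw [Sym2.eq_swap]
    apply hD.hull b hb a ha hne.symm
    intro u hu
    have := hh u hu
    rw [ori_swap]
    linarith
  obtain ⟨c, hc⟩ := exists_face hS hT hab u2
  obtain ⟨d, hd⟩ := exists_face hS hT (edge_symm hab) u1
  have k1 := convex_at hS hE hD hc hd habE
  have k2 := convex_at hS hE hD hd hc (by rw [Sym2.eq_swap]; exact habE)
  have hcS : c ∈ S := edge_r T hc.2.2.1
  have hdS : d ∈ S := edge_r T hd.2.2.1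
  have hcd : c ≠ d := by rintro rfl; simp at k1
  have o1 : 0 < ori a b c := hc.1
  have o2 : 0 < ori b a d := hd.1
  have e1 : ori b c d = ori c d b := by unfold ori; ring
  have e2 : ori a d c = - ori c d a := by unfold ori; ring
  have e3 : ori b a d = - ori a b d := by unfold ori; ring
  have e4 : ori c a d = ori a d c := by unfold ori; ring
  have e5 : ori d b c = ori b c d := by unfold ori; ring
  refine ⟨c, d, ⟨mul_neg_of_pos_of_neg o1 (by linarith),
    mul_neg_of_neg_of_pos (by linarith) (by linarith)⟩, ?_⟩
  refine ⟨insertEdge hS (subGraph T (T.edges.erase s(a, b)) (Finset.erase_subset _ _)) hcS hdS hcd ?_, rfl⟩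
  intro r t hrt' hcr
  have hrt : s(r, t) ∈ T.edges := (Finset.mem_erase.1 hrt').2
  have hrt'' : s(r, t) ≠ s(a, b) := (Finset.mem_erase.1 hrt').1
  obtain ⟨s, u, s0, s1, v0, v1, hz⟩ := Cr_point hcr
  have z1 : 0 < ori b c (ptl r t u) := by
    rw [← hz, ori_ptl, ori_self2, mul_zero, zero_add]; exact mul_pos s0 k2
  have z2 : 0 < ori c a (ptl r t u) := by
    rw [← hz, ori_ptl, ori_self3, mul_zero, zero_add, e4]; exact mul_pos s0 k1
  have z3 : 0 < ori a d (ptl r t u) := by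
    rw [← hz, ori_ptl, ori_self2, mul_zero, add_zero]; exact mul_pos (by linarith) k1
  have z4 : 0 < ori d b (ptl r t u) := by
    rw [← hz, ori_ptl, ori_self3, mul_zero, add_zero, e5]; exact mul_pos (by linarith) k2
  rcases lt_trichotomy (ori a b (ptl r t u)) 0 with h | h | h
  · exact face_free T hd hrt v0.le v1.le ⟨by rw [ori_swap]; linarith, z3, z4⟩
  · have hsum := ori_sum a b c (ptl r t u)
    have := (edges_meet T hab hrt hrt''.symm (div_nonneg z2.le o1.le)
      (by rw [div_le_one o1]; linarith) v0.le v1.le (on_side o1 h)).1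
    rcases this with h' | h'
    · rw [h'] at z2; simp at z2
    · rw [h'] at z1; simp at z1
  · exact face_free T hc hrt v0.le v1.le ⟨h, z1, z2⟩

/-- The triangulations containing `E`. -/
def triSup (S : Finset Pt) (E : Finset (Sym2 Pt)) : Set (PlaneGraph S) :=
  {T | IsTriangulation T ∧ E ⊆ T.edges}

lemma count_lower {S : Finset Pt} (hS : GP S) (k : ℕ) : ∀ (T : PlaneGraph S)
    (E : Finset (Sym2 Pt)), E ⊆ T.edges → GoodD S E → k ≤ (T.edges \ E).card →
    2 ^ k ≤ (triSup S E).ncard := by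
  induction k with
  | zero =>
    intro T E hE _ _
    obtain ⟨T', h1, h2⟩ := exists_tri T
    rw [pow_zero, Nat.one_le_iff_ne_zero]
    exact Set.ncard_ne_zero_of_mem (a := T') ⟨h1, hE.trans h2⟩ (Set.toFinite _)
  | succ k ih =>
    intro T0 E hE0 hD hk0
    obtain ⟨T, hT, hTT⟩ := exists_tri T0
    have hE := hE0.trans hTT
    have hk : k + 1 ≤ (T.edges \ E).card :=
      hk0.trans (Finset.card_le_card (Finset.sdiff_subset_sdiff hTT (Finset.Subset.refl _)))
    clear hk0 hE0 hTT
    obtain ⟨e, he⟩ := Finset.card_pos.1 (by omega : 0 < (T.edges \ E).card)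
    obtain ⟨he1, he2⟩ := Finset.mem_sdiff.1 he
    induction e using Sym2.ind with | _ a b => ?_
    obtain ⟨c, d, hcr, T', hT'⟩ := flip_lemma hS hT hE hD he1 he2
    have hcd : s(c, d) ∉ T.edges := fun h => not_cr T he1 h hcr
    have i1 := ih T (insert s(a, b) E) (Finset.insert_subset he1 hE)
      (hD.mono (Finset.subset_insert _ _)) (by
        have : (T.edges \ E).erase s(a, b) ⊆ T.edges \ insert s(a, b) E := by
          intro x hx
          simp only [Finset.mem_erase, Finset.mem_sdiff] at hx
          simp only [Finset.mem_sdiff, Finset.mem_insert, not_or]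
          exact ⟨hx.2.1, hx.1, hx.2.2⟩
        have h2 := Finset.card_le_card this
        rw [Finset.card_erase_of_mem he] at h2
        omega)
    have i2 := ih T' (insert s(c, d) E) (by
        rw [hT']
        apply Finset.insert_subset_insert
        intro x hx
        rw [Finset.mem_erase]
        exact ⟨fun h => he2 (h ▸ hx), hE hx⟩)
      (hD.mono (Finset.subset_insert _ _)) (by
        have : (T.edges \ E).erase s(a, b) ⊆ T'.edges \ insert s(c, d) E := by
          intro x hx
          simp only [Finset.mem_erase, Finset.mem_sdiff] at hx
          simp only [Finset.mem_sdiff, hT', Finset.mem_insert, Finset.mem_erase, not_or]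
          exact ⟨Or.inr ⟨hx.1, hx.2.1⟩, fun h => hcd (h ▸ hx.2.1), hx.2.2⟩
        have h2 := Finset.card_le_card this
        rw [Finset.card_erase_of_mem he] at h2
        omega)
    have hdisj : Disjoint (triSup S (insert s(a, b) E)) (triSup S (insert s(c, d) E)) := by
      rw [Set.disjoint_left]
      rintro G ⟨_, g1⟩ ⟨_, g2⟩
      exact not_cr G (g1 (Finset.mem_insert_self _ _)) (g2 (Finset.mem_insert_self _ _)) hcr
    have hsub : triSup S (insert s(a, b) E) ∪ triSup S (insert s(c, d) E) ⊆ triSup S E := by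
      rintro G (⟨g0, g1⟩ | ⟨g0, g1⟩) <;>
        exact ⟨g0, (Finset.subset_insert _ _).trans g1⟩
    have := Set.ncard_le_ncard hsub (Set.toFinite _)
    rw [Set.ncard_union_eq hdisj (Set.toFinite _) (Set.toFinite _)] at this
    rw [pow_succ]
    omega

end PartG

section PartH

/-- `d` is a generic direction. -/
def Gen (S : Finset Pt) (d : Pt) : Prop := ∀ u ∈ S, ∀ v ∈ S, u ≠ v → dt d u v ≠ 0

lemma dt_neg (d u v : Pt) : dt (-d) u v = - dt d u v := by
  simp only [dt, Prod.fst_neg, Prod.snd_neg]; ring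
lemma dt_anti (d u v : Pt) : dt d u v = - dt d v u := by unfold dt; ring
lemma dt_tri (d u v w : Pt) : dt d u v + dt d v w = dt d u w := by unfold dt; ring

lemma Gen.neg {S : Finset Pt} {d : Pt} (h : Gen S d) : Gen S (-d) := by
  intro u hu v hv huv h0
  rw [dt_neg] at h0
  exact h u hu v hv huv (by linarith)

lemma Gen.at {S : Finset Pt} {d v : Pt} (h : Gen S d) (hv : v ∈ S) :
    ∀ u ∈ S, u ≠ v → dt d u v ≠ 0 := fun u hu huv => h u hu v hv huv

lemma gen_exists (S : Finset Pt) : ∃ d : Pt, Gen S d := by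
  obtain ⟨ε, -, h2⟩ := exists_eps ((S ×ˢ S).filter fun x => x.1 ≠ x.2)
    (fun x => x.1.2 - x.2.2) (fun x => - (x.1.1 - x.2.1)) (by
      rintro ⟨u, v⟩ hi
      simp only [Finset.mem_filter, Finset.mem_product] at hi
      by_contra hc
      push Not at hc
      apply hi.2
      ext
      · have := hc.2; simp only at this; linarith
      · have := hc.1; simp only at this; linarith)
  refine ⟨(1, ε), ?_⟩
  intro u hu v hv huv h0
  apply h2 (u, v) (by simp [hu, hv, huv])
  unfold dt at h0
  simp only at h0 ⊢
  linarith

lemma cone_free {S : Finset Pt} {T : PlaneGraph S} {a b c n : Pt} (h : Face T a b c)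
    (hn : s(a, n) ∈ T.edges) (hh : 0 < ori a b n) (h' : 0 < ori a n c) : False := by
  have hnc : 0 < ori c a n := by rw [← ori_cyc] at h'; rw [ori_cyc] at h' ⊢; rw [ori_cyc]; exact h'
  obtain ⟨x, x0, x1, y⟩ := enter (a := a) (b := b) (c := b) (d := c) (e := c) (f := a)
    (r := n) (t := a) (u := 1) one_pos
    (Or.inr ⟨by rw [ptl_one]; simp, hh⟩)
    (Or.inl (by
      rw [ptl_one]
      have e : ori b c a = ori a b c := by unfold ori; ring
      rw [e]; exact h.1))
    (Or.inr ⟨by rw [ptl_one]; simp, hnc⟩)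
  exact face_free T h (edge_symm hn) x0.le x1.le y

lemma face_unique {S : Finset Pt} (hS : GP S) {T : PlaneGraph S} {a b c c' : Pt}
    (h : Face T a b c) (h' : Face T a b c') : c = c' := by
  have ha : a ∈ S := edge_l T h.2.1
  have hc : c ∈ S := edge_r T h.2.2.1
  have hc' : c' ∈ S := edge_r T h'.2.2.1
  rcases lt_trichotomy (ori a c' c) 0 with g | g | g
  · exact (cone_free h' (edge_symm h.2.2.2.1) h.1 (by rw [ori_swap']; linarith)).elim
  · rcases gp_eq hS ha hc' hc (edge_ne T h'.2.2.2.1).symm g with r | r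
    · exact absurd r (edge_ne T h.2.2.2.1)
    · exact r
  · exact (cone_free h (edge_symm h'.2.2.2.1) h'.1 g).elim

lemma hit_unique {S : Finset Pt} (hS : GP S) {T : PlaneGraph S} {d v q p q' p' : Pt}
    (h : Face T v q p) (h' : Face T v q' p') (i : Hit d v q p) (i' : Hit d v q' p') :
    q = q' ∧ p = p' := by
  have key : ∀ q p q' p', Face T v q p → Face T v q' p' → Hit d v q p → Hit d v q' p' →
      0 < ori v p' p → False := by
    intro q p q' p' h h' i i' g
    obtain ⟨i1, i2, i3⟩ := i
    refine cone_free h (edge_symm h'.2.2.2.1) ?_ g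
    have e := pl1 d v q p' p
    have m1 := mul_pos i3 i'.2.1
    have m2 := mul_neg_of_pos_of_neg g i1
    exact pos_of_mul_pos_left (by linarith : 0 < ori v q p' * dt d p v) i2.le
  have hp : p = p' := by
    rcases lt_trichotomy (ori v p' p) 0 with g | g | g
    · exact (key q' p' q p h' h i' i (by rw [ori_swap']; linarith)).elim
    · rcases gp_eq hS (edge_l T h.2.1) (edge_r T h'.2.2.1) (edge_r T h.2.2.1)
        (edge_ne T h'.2.2.2.1).symm g with r | r
      · exact absurd r (edge_ne T h.2.2.2.1)
      · exact r
    · exact (key q p q' p' h h' i i' g).elim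
  subst hp
  exact ⟨face_unique hS h.cyc.cyc h'.cyc.cyc, rfl⟩

lemma ext_low {L : Finset Pt} {d v : Pt} (hne : L.Nonempty) (hL : ∀ u ∈ L, dt d u v < 0) :
    ∃ q ∈ L, ∀ u ∈ L, 0 ≤ ori v q u := by
  obtain ⟨w0, hw0⟩ := hne
  obtain ⟨w, hw, hmax⟩ := L.exists_max_image (fun u => ori v u w0 / (- dt d u v)) ⟨w0, hw0⟩
  refine ⟨w, hw, ?_⟩
  intro u hu
  have h := hmax u hu
  have k0 := hL w0 hw0
  have k1 := hL w hw
  have k2 := hL u hu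
  rw [div_le_div_iff₀ (by linarith) (by linarith)] at h
  have := pl1 d v w u w0
  by_contra hc
  push Not at hc
  have := mul_pos_of_neg_of_neg hc k0
  linarith

lemma ext_high {L : Finset Pt} {d v : Pt} (hne : L.Nonempty) (hL : ∀ u ∈ L, dt d u v < 0) :
    ∃ q ∈ L, ∀ u ∈ L, ori v q u ≤ 0 := by
  obtain ⟨w0, hw0⟩ := hne
  obtain ⟨w, hw, hmax⟩ := L.exists_min_image (fun u => ori v u w0 / (- dt d u v)) ⟨w0, hw0⟩
  refine ⟨w, hw, ?_⟩
  intro u hu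
  have h := hmax u hu
  have k0 := hL w0 hw0
  have k1 := hL w hw
  have k2 := hL u hu
  rw [div_le_div_iff₀ (by linarith) (by linarith)] at h
  have := pl1 d v w u w0
  by_contra hc
  push Not at hc
  have := mul_neg_of_pos_of_neg hc k0
  linarith

/-- `v` is exposed in direction `d`. -/
def Expo (S : Finset Pt) (d v : Pt) : Prop := ∀ p ∈ S, ∀ q ∈ S, ¬ Hit d v q p

/-- Hull pairs. -/
def HP (S : Finset Pt) (a b : Pt) : Prop :=
  a ∈ S ∧ b ∈ S ∧ a ≠ b ∧ ∀ u ∈ S, 0 ≤ ori a b u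

lemma exp_hull {S : Finset Pt} {d v : Pt} (hd : Gen S d) (hv : v ∈ S) (he : Expo S d v)
    (hr : ∃ u ∈ S, dt d u v < 0) : ∃ q, dt d q v < 0 ∧ HP S q v := by
  obtain ⟨q, hq, h⟩ := ext_high (L := S.filter fun u => dt d u v < 0) (d := d) (v := v) (by
    obtain ⟨u, hu, hu'⟩ := hr
    exact ⟨u, by simp [hu, hu']⟩) (by intro u hu; exact (Finset.mem_filter.1 hu).2)
  obtain ⟨hq, hq'⟩ := Finset.mem_filter.1 hq
  refine ⟨q, hq', hq, hv, ?_, ?_⟩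
  · rintro rfl
    simp [dt] at hq'
  · intro u hu
    rw [ori_swap]
    by_cases huv : u = v
    · rw [huv]; simp
    rcases lt_or_gt_of_ne (hd u hu v hv huv) with k | k
    · have := h u (Finset.mem_filter.2 ⟨hu, k⟩); linarith
    · by_contra hc
      exact he u hu q hq ⟨hq', k, by linarith⟩

lemma hull_edge {S : Finset Pt} (hS : GP S) {T : PlaneGraph S} (hT : IsTriangulation T) {a b : Pt}
    (h : HP S a b) : s(a, b) ∈ T.edges := by
  obtain ⟨ha, hb, hab, h⟩ := h
  apply tri_edge hS hT ha hb hab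
  intro r t hrt hcr
  have := mul_nonneg (h r (edge_l T hrt)) (h t (edge_r T hrt))
  have := hcr.1
  linarith

lemma hull_exp {S : Finset Pt} {d a b : Pt} (h : HP S a b) (hab : dt d a b < 0) : Expo S d b := by
  rintro p hp q hq ⟨i1, i2, i3⟩
  have e := pl1 d b a q p
  have k1 := h.2.2.2 p hp
  have k2 := h.2.2.2 q hq
  rw [ori_swap] at k1 k2
  have m1 := mul_nonneg_of_nonpos_of_nonpos (by linarith : ori b a p ≤ 0) i1.le
  have m2 := mul_nonpos_of_nonpos_of_nonneg (by linarith : ori b a q ≤ 0) i2.le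
  have m3 := mul_neg_of_pos_of_neg i3 hab
  linarith

lemma hull_unique {S : Finset Pt} (hS : GP S) {a a' b : Pt} (h : HP S a b) (h' : HP S a' b) :
    a = a' := by
  have k1 := h.2.2.2 a' h'.1
  have k2 := h'.2.2.2 a h.1
  have e : ori a' b a = - ori a b a' := by unfold ori; ring
  rcases gp_eq hS h.1 h.2.1 h'.1 h.2.2.1 (by linarith) with r | r
  · exact r.symm
  · exact absurd r h'.2.2.1

lemma exp_both {S : Finset Pt} (hS : GP S) {d v : Pt} (hd : Gen S d) (hv : v ∈ S)
    (h1 : Expo S d v) (h2 : Expo S (-d) v) :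
    (∀ u ∈ S, 0 ≤ dt d u v) ∨ (∀ u ∈ S, dt d u v ≤ 0) := by
  by_contra hc
  push Not at hc
  obtain ⟨⟨u, hu, hu'⟩, ⟨w, hw, hw'⟩⟩ := hc
  obtain ⟨q, hq, k⟩ := exp_hull hd hv h1 ⟨u, hu, hu'⟩
  obtain ⟨q', hq', k'⟩ := exp_hull hd.neg hv h2 ⟨w, hw, by rw [dt_neg]; linarith⟩
  have := hull_unique hS k k'
  subst this
  rw [dt_neg] at hq'
  linarith

lemma gen_ne {S : Finset Pt} {d v : Pt} (hd : Gen S d) (hv : v ∈ S) (hu : ∃ u ∈ S, u ≠ v) :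
    d ≠ 0 := by
  rintro rfl
  obtain ⟨u, hu, huv⟩ := hu
  exact hd u hu v hv huv (by simp [dt])

lemma exp_supp {S : Finset Pt} {d v : Pt} (hd : Gen S d) (hd0 : d ≠ 0) (hv : v ∈ S)
    (h : Expo S d v) : SuppAt S v := by
  by_cases hr : ∃ u ∈ S, dt d u v < 0
  · obtain ⟨q, hq, k⟩ := exp_hull hd hv h hr
    refine ⟨(v.1 - q.1, v.2 - q.2), ?_, ?_⟩
    · intro h
      have h1 := congrArg Prod.fst h
      have h2 := congrArg Prod.snd h
      simp at h1 h2
      apply k.2.2.1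
      ext <;> linarith
    · intro u hu
      have e : dt (v.1 - q.1, v.2 - q.2) u v = ori q v u := by unfold dt ori; simp only; ring
      rw [e]; exact k.2.2.2 u hu
  · push Not at hr
    exact ⟨d, hd0, hr⟩

lemma delta_zero {δ d u v : Pt} (h1 : δ.1 * d.2 - δ.2 * d.1 = 0) (h2 : dt δ u v = 0)
    (h3 : dt d u v ≠ 0) : δ = 0 := by
  unfold dt at h2 h3
  have t1 : δ.1 * (d.1 * (u.2 - v.2) - d.2 * (u.1 - v.1)) = 0 := by
    linear_combination d.1 * h2 - (u.1 - v.1) * h1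
  have t2 : δ.2 * (d.1 * (u.2 - v.2) - d.2 * (u.1 - v.1)) = 0 := by
    linear_combination d.2 * h2 - (u.2 - v.2) * h1
  ext
  · exact (mul_eq_zero.1 t1).resolve_right h3
  · exact (mul_eq_zero.1 t2).resolve_right h3

lemma good_of_nonexp {S : Finset Pt} (hS : GP S) {T : PlaneGraph S} (hT : IsTriangulation T)
    {d v : Pt} (hd : Gen S d) (hv : v ∈ S) (h1 : ¬ Expo S d v) (h2 : ¬ Expo S (-d) v) :
    GoodAt T.edges v := by
  intro δ hδ
  by_contra hc
  push Not at hc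
  unfold Expo at h1 h2
  push Not at h1 h2
  obtain ⟨q, p, ⟨i1, i2, i3⟩, f⟩ := key_lemma hS hT hv (hd.at hv) h1
  obtain ⟨q', p', ⟨j1, j2, j3⟩, f'⟩ := key_lemma hS hT hv (hd.neg.at hv) h2
  rw [dt_neg] at j1 j2
  have c1 := hc q f.2.1
  have c2 := hc p (edge_symm f.2.2.2.1)
  have c3 := hc q' f'.2.1
  have c4 := hc p' (edge_symm f'.2.2.2.1)
  have e1 : ori v q p * (δ.1 * d.2 - δ.2 * d.1) = dt d p v * dt δ q v - dt d q v * dt δ p v := by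
    unfold ori dt; ring
  have e2 : ori v q' p' * (δ.1 * d.2 - δ.2 * d.1) =
      dt d p' v * dt δ q' v - dt d q' v * dt δ p' v := by
    unfold ori dt; ring
  have m1 := mul_nonpos_of_nonneg_of_nonpos i2.le c1
  have m2 := mul_nonneg_of_nonpos_of_nonpos i1.le c2
  have m3 := mul_nonneg_of_nonpos_of_nonpos (by linarith : dt d p' v ≤ 0) c3
  have m4 := mul_nonpos_of_nonneg_of_nonpos (by linarith : 0 ≤ dt d q' v) c4
  have k1 : δ.1 * d.2 - δ.2 * d.1 ≤ 0 := by
    by_contra hh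
    have := mul_pos i3 (not_le.1 hh)
    linarith
  have k2 : 0 ≤ δ.1 * d.2 - δ.2 * d.1 := by
    by_contra hh
    have := mul_neg_of_pos_of_neg j3 (not_le.1 hh)
    linarith
  have k := le_antisymm k1 k2
  rw [k, mul_zero] at e1
  have z : dt d p v * dt δ q v = 0 := by linarith
  exact hδ (delta_zero k ((mul_eq_zero.1 z).resolve_left i2.ne') i1.ne)

lemma three_good {S : Finset Pt} (hS : GP S) {T : PlaneGraph S} {v m : Pt}
    (hg : GoodAt T.edges v) (hm : s(v, m) ∈ T.edges) :
    ∃ f g, s(v, f) ∈ T.edges ∧ s(v, g) ∈ T.edges ∧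
      ∀ E : Finset (Sym2 Pt), s(v, m) ∈ E → s(v, f) ∈ E → s(v, g) ∈ E → GoodAt E v := by
  have hv := edge_l T hm
  have nz : ∀ w, v ≠ w → ((w.1 - v.1, w.2 - v.2) : Pt) ≠ 0 := by
    intro w hw h
    have h1 := congrArg Prod.fst h
    have h2 := congrArg Prod.snd h
    simp at h1 h2
    apply hw
    ext <;> linarith
  have eo : ∀ w u : Pt, dt (w.1 - v.1, w.2 - v.2) u v = ori v w u := by
    intro w u; unfold dt ori; simp only
  obtain ⟨n0, hn0, hn0'⟩ := hg _ (nz m (edge_ne T hm))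
  obtain ⟨f, hf, hmax⟩ := ext_high (L := S.filter fun n => s(v, n) ∈ T.edges ∧ 0 < ori v m n)
    (d := -(m.1 - v.1, m.2 - v.2)) (v := v)
    ⟨n0, by rw [eo] at hn0'; simp [edge_r T hn0, hn0, hn0']⟩ (by
      intro u hu
      have := (Finset.mem_filter.1 hu).2.2
      rw [dt_neg, eo]; linarith)
  obtain ⟨hfS, hfe, hfo⟩ := Finset.mem_filter.1 hf
  obtain ⟨g, hge, hgo⟩ := hg _ (nz f (edge_ne T hfe))
  rw [eo] at hgo
  have hgS := edge_r T hge
  have hmS := edge_r T hm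
  have hgm : g ≠ m := by
    rintro rfl
    rw [ori_swap'] at hgo; linarith
  have ho : 0 < ori v g m := by
    have := hS v hv g hgS m hmS (edge_ne T hge) (edge_ne T hm) hgm
    rcases lt_or_gt_of_ne this with h | h
    · have := hmax g (Finset.mem_filter.2 ⟨hgS, hge, by rw [ori_swap']; linarith⟩)
      linarith
    · exact h
  refine ⟨f, g, hfe, hge, ?_⟩
  intro E e1 e2 e3 δ hδ
  by_contra hc
  push Not at hc
  have c1 := hc m e1
  have c2 := hc f e2
  have c3 := hc g e3
  have e : ori v f g * dt δ m v + ori v g m * dt δ f v + ori v m f * dt δ g v = 0 := by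
    unfold ori dt; ring
  have m1 := mul_nonpos_of_nonneg_of_nonpos hgo.le c1
  have m2 := mul_nonpos_of_nonneg_of_nonpos ho.le c2
  have m3 := mul_nonpos_of_nonneg_of_nonpos hfo.le c3
  have z1 : ori v f g * dt δ m v = 0 := by linarith
  have z2 : ori v g m * dt δ f v = 0 := by linarith
  have y1 := (mul_eq_zero.1 z1).resolve_left hgo.ne'
  have y2 := (mul_eq_zero.1 z2).resolve_left ho.ne'
  apply hδ
  apply delta_zero (d := (m.1 - v.1, m.2 - v.2)) (u := f) (v := v) _ y2 (by rw [eo]; exact hfo.ne')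
  unfold dt at y1
  simp only
  linear_combination y1


end PartH

section PartI

/-- Edges directed to the right. -/
def RE {S : Finset Pt} (T : PlaneGraph S) (d : Pt) : Finset (Pt × Pt) :=
  (S ×ˢ S).filter fun x => s(x.1, x.2) ∈ T.edges ∧ dt d x.2 x.1 < 0

lemma mem_RE {S : Finset Pt} {T : PlaneGraph S} {d p b : Pt} :
    (p, b) ∈ RE T d ↔ s(p, b) ∈ T.edges ∧ dt d b p < 0 := by
  unfold RE
  rw [Finset.mem_filter, Finset.mem_product]
  exact ⟨fun h => h.2, fun h => ⟨⟨edge_l T h.1, edge_r T h.1⟩, h⟩⟩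

lemma RE_card {S : Finset Pt} (T : PlaneGraph S) {d : Pt} (hd : Gen S d) :
    (RE T d).card = T.edges.card := by
  have : T.edges = (RE T d).image fun x => s(x.1, x.2) := by
    ext e
    rw [Finset.mem_image]
    constructor
    · intro he
      induction e using Sym2.ind with | _ a b => ?_
      rcases lt_or_gt_of_ne (hd a (edge_l T he) b (edge_r T he) (edge_ne T he)) with h | h
      · exact ⟨(b, a), mem_RE.2 ⟨edge_symm he, h⟩, Sym2.eq_swap⟩
      · exact ⟨(a, b), mem_RE.2 ⟨he, by rw [dt_anti]; linarith⟩, rfl⟩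
    · rintro ⟨⟨a, b⟩, h, rfl⟩
      exact (mem_RE.1 h).1
  rw [this, Finset.card_image_of_injOn]
  rintro ⟨a, b⟩ h ⟨a', b'⟩ h' he
  have h := (mem_RE.1 h).2
  have h' := (mem_RE.1 h').2
  simp only [Sym2.eq_iff] at he
  rcases he with ⟨rfl, rfl⟩ | ⟨rfl, rfl⟩
  · rfl
  · rw [dt_anti] at h'; linarith

/-- lowest right edges. -/
def LowE {S : Finset Pt} (T : PlaneGraph S) (d : Pt) : Finset (Pt × Pt) :=
  (RE T d).filter fun x => ∀ n, (x.1, n) ∈ RE T d → 0 ≤ ori x.1 x.2 n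

/-- non-lowest right edges. -/
def NLowE {S : Finset Pt} (T : PlaneGraph S) (d : Pt) : Finset (Pt × Pt) :=
  (RE T d).filter fun x => ¬ ∀ n, (x.1, n) ∈ RE T d → 0 ≤ ori x.1 x.2 n

lemma low_add {S : Finset Pt} (T : PlaneGraph S) (d : Pt) :
    (LowE T d).card + (NLowE T d).card = (RE T d).card :=
  Finset.card_filter_add_card_filter_not _

lemma low_le {S : Finset Pt} (hS : GP S) (T : PlaneGraph S) (d : Pt) :
    (LowE T d).card ≤ S.card := by
  apply Finset.card_le_card_of_injOn Prod.fst
  · rintro ⟨p, b⟩ h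
    exact edge_l T (mem_RE.1 (Finset.mem_filter.1 h).1).1
  · rintro ⟨p, b⟩ h ⟨p', b'⟩ h' he
    simp only at he
    subst he
    obtain ⟨h1, h2⟩ := Finset.mem_filter.1 h
    obtain ⟨h1', h2'⟩ := Finset.mem_filter.1 h'
    have k := h2 b' h1'
    have k' := h2' b h1
    simp only at k k'
    rw [ori_swap'] at k'
    have e := (mem_RE.1 h1).1
    have e' := (mem_RE.1 h1').1
    rcases gp_eq hS (edge_l T e) (edge_r T e) (edge_r T e') (edge_ne T e) (by linarith) with r | r
    · exact absurd r (edge_ne T e').symm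
    · rw [r]

lemma right_edge {S : Finset Pt} (hS : GP S) {T : PlaneGraph S} (hT : IsTriangulation T)
    {d v : Pt} (hd : Gen S d) (hv : v ∈ S) (hr : ∃ u ∈ S, dt d u v < 0) :
    ∃ b, (v, b) ∈ RE T d := by
  by_cases h : Expo S d v
  · obtain ⟨q, hq, k⟩ := exp_hull hd hv h hr
    exact ⟨q, mem_RE.2 ⟨edge_symm (hull_edge hS hT k), hq⟩⟩
  · unfold Expo at h
    push Not at h
    obtain ⟨q, p, i, f⟩ := key_lemma hS hT hv (hd.at hv) h
    exact ⟨q, mem_RE.2 ⟨f.2.1, i.1⟩⟩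

lemma low_ge {S : Finset Pt} (hS : GP S) {T : PlaneGraph S} (hT : IsTriangulation T)
    {d : Pt} (hd : Gen S d) : S.card ≤ (LowE T d).card + 1 := by
  by_cases hne : S.Nonempty
  swap
  · rw [Finset.not_nonempty_iff_eq_empty] at hne
    subst hne; simp
  obtain ⟨r, hr, hmin⟩ := S.exists_min_image (fun u => dt d u 0) hne
  have : S.erase r ⊆ (LowE T d).image Prod.fst := by
    intro v hv
    obtain ⟨hvr, hv⟩ := Finset.mem_erase.1 hv
    obtain ⟨b, hb⟩ := right_edge hS hT hd hv ⟨r, hr, by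
      have h1 := hmin v hv
      have h2 := dt_tri d r v 0
      have h3 := hd r hr v hv hvr.symm
      exact lt_of_le_of_ne (by linarith) h3⟩
    obtain ⟨q, hq, hl⟩ := ext_low (L := S.filter fun n => (v, n) ∈ RE T d) (d := d) (v := v)
      ⟨b, by simp [edge_r T (mem_RE.1 hb).1, hb]⟩
      (by intro u hu; exact (mem_RE.1 (Finset.mem_filter.1 hu).2).2)
    rw [Finset.mem_image]
    refine ⟨(v, q), Finset.mem_filter.2 ⟨(Finset.mem_filter.1 hq).2, ?_⟩, rfl⟩
    intro n hn
    exact hl n (Finset.mem_filter.2 ⟨edge_r T (mem_RE.1 hn).1, hn⟩)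
  have h1 := (Finset.card_le_card this).trans Finset.card_image_le
  rw [Finset.card_erase_of_mem hr] at h1
  omega

lemma nlow_iff {S : Finset Pt} (hS : GP S) {T : PlaneGraph S} (hT : IsTriangulation T)
    {d : Pt} (hd : Gen S d) {p b : Pt} :
    (p, b) ∈ NLowE T d ↔ dt d b p < 0 ∧ ∃ a, dt d a p < 0 ∧ Face T p a b := by
  unfold NLowE
  rw [Finset.mem_filter, mem_RE]
  simp only
  push Not
  constructor
  · rintro ⟨⟨h1, h2⟩, n, hn, hn'⟩
    refine ⟨h2, ?_⟩
    obtain ⟨n1, n2⟩ := mem_RE.1 hn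
    have hn'' : 0 < ori p n b := by rw [ori_swap']; linarith
    obtain ⟨a, ha⟩ := exists_face hS hT (edge_symm h1) ⟨n, edge_r T n1, by
      rw [ori_cyc]; rw [← ori_cyc, ← ori_cyc] at hn''; rw [ori_cyc] at hn''; exact hn''⟩
    have hF := ha.cyc
    refine ⟨a, ?_, hF⟩
    by_contra hc
    have h0 := hd a (edge_r T hF.2.1) p (edge_l T h1) (edge_ne T hF.2.1).symm
    have hpos : 0 < dt d a p := lt_of_le_of_ne (not_lt.1 hc) h0.symm
    apply cone_free hF n1 _ hn''
    have e := pl1 d p a n b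
    have m1 := mul_neg_of_pos_of_neg hF.1 n2
    have m2 := mul_pos hn'' hpos
    by_contra hh
    have m3 := mul_nonneg_of_nonpos_of_nonpos (not_lt.1 hh) h2.le
    linarith
  · rintro ⟨h1, a, h2, h3⟩
    refine ⟨⟨edge_symm h3.2.2.2.1, h1⟩, a, mem_RE.2 ⟨h3.2.1, h2⟩, ?_⟩
    have := h3.1
    rw [ori_swap'] at this; linarith

/-- The face above `v`. -/
def F1 {S : Finset Pt} (T : PlaneGraph S) (d v : Pt) : Pt × Pt :=
  if h : ∃ x : Pt × Pt, Hit d v x.2 x.1 ∧ Face T v x.2 x.1 then h.choose else (v, v)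

lemma F1_spec {S : Finset Pt} {T : PlaneGraph S} {d v q p : Pt}
    (i : Hit d v q p) (f : Face T v q p) :
    Hit d v (F1 T d v).2 (F1 T d v).1 ∧ Face T v (F1 T d v).2 (F1 T d v).1 := by
  have h : ∃ x : Pt × Pt, Hit d v x.2 x.1 ∧ Face T v x.2 x.1 := ⟨(p, q), i, f⟩
  unfold F1
  rw [dif_pos h]
  exact h.choose_spec

lemma F1_eq {S : Finset Pt} (hS : GP S) {T : PlaneGraph S} {d v q p : Pt}
    (i : Hit d v q p) (f : Face T v q p) : F1 T d v = (p, q) := by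
  obtain ⟨a, b⟩ := F1_spec i f
  obtain ⟨e1, e2⟩ := hit_unique hS b f a i
  exact Prod.ext e2 e1

/-- The face below `v`. -/
def F2 {S : Finset Pt} (T : PlaneGraph S) (d v : Pt) : Pt × Pt := ((F1 T (-d) v).2, v)

lemma nlow_le {S : Finset Pt} (hS : GP S) {T : PlaneGraph S} (hT : IsTriangulation T)
    {d : Pt} (hd : Gen S d) : (NLowE T d).card ≤ 2 * S.card := by
  have : NLowE T d ⊆ S.image (F1 T d) ∪ S.image (F2 T d) := by
    rintro ⟨p, b⟩ h
    obtain ⟨h1, a, h2, h3⟩ := (nlow_iff hS hT hd).1 h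
    have hp := edge_l T h3.2.1
    have ha := edge_r T h3.2.1
    have hb := edge_r T h3.2.2.1
    rw [Finset.mem_union, Finset.mem_image, Finset.mem_image]
    rcases lt_or_gt_of_ne (hd b hb a ha (edge_ne T h3.2.2.1).symm) with k | k
    · left
      refine ⟨a, ha, F1_eq hS ⟨k, by rw [dt_anti]; linarith, h3.cyc.1⟩ h3.cyc⟩
    · right
      refine ⟨b, hb, ?_⟩
      have : F1 T (-d) b = (a, p) := F1_eq hS
        ⟨by rw [dt_neg, dt_anti]; linarith, by rw [dt_neg, dt_anti]; linarith, h3.cyc.cyc.1⟩ h3.cyc.cyc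
      unfold F2
      rw [this]
  have h1 := Finset.card_le_card this
  have h2 := Finset.card_union_le (S.image (F1 T d)) (S.image (F2 T d))
  have h3 : (S.image (F1 T d)).card ≤ S.card := Finset.card_image_le
  have h4 : (S.image (F2 T d)).card ≤ S.card := Finset.card_image_le
  omega

lemma edges_le {S : Finset Pt} (hS : GP S) {T : PlaneGraph S} (hT : IsTriangulation T) :
    T.edges.card ≤ 3 * S.card := by
  obtain ⟨d, hd⟩ := gen_exists S
  have h1 := RE_card T hd
  have h2 := low_add T d
  have h3 := low_le hS T d
  have h4 := nlow_le hS hT hd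
  omega

/-- Exposed points. -/
def ExpF (S : Finset Pt) (d : Pt) : Finset Pt := S.filter fun v => Expo S d v
/-- Non-exposed points. -/
def NExpF (S : Finset Pt) (d : Pt) : Finset Pt := S.filter fun v => ¬ Expo S d v

lemma exp_add (S : Finset Pt) (d : Pt) : (ExpF S d).card + (NExpF S d).card = S.card :=
  Finset.card_filter_add_card_filter_not _

lemma nexp_spec {S : Finset Pt} (hS : GP S) {T : PlaneGraph S} (hT : IsTriangulation T)
    {d v : Pt} (hd : Gen S d) (hv : v ∈ NExpF S d) :
    Hit d v (F1 T d v).2 (F1 T d v).1 ∧ Face T v (F1 T d v).2 (F1 T d v).1 := by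
  obtain ⟨hv, h⟩ := Finset.mem_filter.1 hv
  unfold Expo at h
  push Not at h
  obtain ⟨q, p, i, f⟩ := key_lemma hS hT hv (hd.at hv) h
  exact F1_spec i f

lemma nlow_ge {S : Finset Pt} (hS : GP S) {T : PlaneGraph S} (hT : IsTriangulation T)
    {d : Pt} (hd : Gen S d) : (NExpF S d).card + (NExpF S (-d)).card ≤ (NLowE T d).card := by
  have hsub : (NExpF S d).image (F1 T d) ∪ (NExpF S (-d)).image (F2 T d) ⊆ NLowE T d := by
    apply Finset.union_subset
    · intro x hx
      obtain ⟨v, hv, rfl⟩ := Finset.mem_image.1 hx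
      obtain ⟨i, f⟩ := nexp_spec hS hT hd hv
      have : (F1 T d v) = ((F1 T d v).1, (F1 T d v).2) := rfl
      rw [this, nlow_iff hS hT hd]
      obtain ⟨i1, i2, i3⟩ := i
      have e := dt_tri d (F1 T d v).2 v (F1 T d v).1
      rw [dt_anti d (F1 T d v).1 v] at i2
      exact ⟨by linarith, v, by linarith, f.cyc.cyc⟩
    · intro x hx
      obtain ⟨v, hv, rfl⟩ := Finset.mem_image.1 hx
      obtain ⟨i, f⟩ := nexp_spec hS hT hd.neg hv
      unfold F2
      rw [nlow_iff hS hT hd]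
      obtain ⟨i1, i2, i3⟩ := i
      rw [dt_neg] at i1 i2
      have e := dt_tri d (F1 T (-d) v).1 v (F1 T (-d) v).2
      rw [dt_anti d (F1 T (-d) v).2 v] at i1
      exact ⟨by linarith, _, by linarith, f.cyc⟩
  have hdisj : Disjoint ((NExpF S d).image (F1 T d)) ((NExpF S (-d)).image (F2 T d)) := by
    rw [Finset.disjoint_left]
    intro x hx hx'
    obtain ⟨v, hv, rfl⟩ := Finset.mem_image.1 hx
    obtain ⟨w, hw, he⟩ := Finset.mem_image.1 hx'
    obtain ⟨i, f⟩ := nexp_spec hS hT hd hv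
    obtain ⟨i', f'⟩ := nexp_spec hS hT hd.neg hw
    have e1 : (F1 T (-d) w).2 = (F1 T d v).1 := congrArg Prod.fst he
    have e2 : w = (F1 T d v).2 := congrArg Prod.snd he
    rw [e1, e2] at f'
    rw [e1] at i'
    have := face_unique hS f.cyc f'
    have k1 := i.1
    have k2 := i'.2.1
    rw [dt_neg] at k2
    rw [← e2] at this k1
    rw [← this, dt_anti] at k2
    linarith
  have hi1 : ((NExpF S d).image (F1 T d)).card = (NExpF S d).card := by
    apply Finset.card_image_of_injOn
    intro v hv w hw he
    obtain ⟨i, f⟩ := nexp_spec hS hT hd hv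
    obtain ⟨i', f'⟩ := nexp_spec hS hT hd hw
    rw [← he] at f'
    exact face_unique hS f.cyc f'.cyc
  have hi2 : ((NExpF S (-d)).image (F2 T d)).card = (NExpF S (-d)).card := by
    apply Finset.card_image_of_injOn
    intro v hv w hw he
    exact congrArg Prod.snd he
  have := Finset.card_le_card hsub
  rw [Finset.card_union_of_disjoint hdisj] at this
  omega

lemma edges_ge {S : Finset Pt} (hS : GP S) {T : PlaneGraph S} (hT : IsTriangulation T)
    {d : Pt} (hd : Gen S d) :
    3 * S.card ≤ T.edges.card + 1 + (ExpF S d).card + (ExpF S (-d)).card := by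
  have h1 := RE_card T hd
  have h2 := low_add T d
  have h3 := low_ge hS hT hd
  have h4 := nlow_ge hS hT hd
  have h5 := exp_add S d
  have h6 := exp_add S (-d)
  omega


end PartI

section PartJ

lemma rightmost {S : Finset Pt} (hne : S.Nonempty) (d : Pt) :
    ∃ r ∈ S, ∀ u ∈ S, 0 ≤ dt d u r := by
  obtain ⟨r, hr, hmin⟩ := S.exists_min_image (fun u => dt d u 0) hne
  refine ⟨r, hr, fun u hu => ?_⟩
  have h1 := hmin u hu
  have h2 := dt_tri d u r 0
  linarith

lemma pm_card {S : Finset Pt} {M : PlaneGraph S} (hM : IsPerfectMatching M) :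
    S.card = 2 * M.edges.card := by
  have h := Finset.sum_card_bipartiteAbove_eq_sum_card_bipartiteBelow
    (s := S) (t := M.edges) (fun p e => p ∈ e)
  have h1 : ∀ p ∈ S, (Finset.bipartiteAbove (fun (p : Pt) e => p ∈ e) M.edges p).card = 1 := by
    intro p hp
    obtain ⟨e, he, hu⟩ := hM p hp
    rw [Finset.card_eq_one]
    refine ⟨e, ?_⟩
    ext x
    rw [Finset.mem_bipartiteAbove, Finset.mem_singleton]
    exact ⟨fun hx => hu x hx, fun hx => hx ▸ he⟩
  have h2 : ∀ e ∈ M.edges, (Finset.bipartiteBelow (fun (p : Pt) e => p ∈ e) S e).card = 2 := by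
    intro e he
    rw [← Sym2.card_toFinset_of_not_isDiag e (M.not_isDiag e he)]
    congr 1
    ext p
    rw [Finset.mem_bipartiteBelow, Sym2.mem_toFinset]
    exact ⟨fun hx => hx.2, fun hx => ⟨M.endpoint_mem e he p hx, hx⟩⟩
  rw [Finset.sum_congr rfl h1, Finset.sum_congr rfl h2] at h
  simp at h
  omega

/-- Hull pairs as a finset. -/
def HF (S : Finset Pt) : Finset (Pt × Pt) := (S ×ˢ S).filter fun x => HP S x.1 x.2

lemma HF_half {S : Finset Pt} (hS : GP S) (hne : S.Nonempty) (d : Pt) :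
    ((HF S).filter fun x => dt d x.1 x.2 < 0).card + 1 ≤ (ExpF S d).card := by
  obtain ⟨r, hr, hmin⟩ := rightmost hne d
  have hr' : r ∈ ExpF S d := by
    refine Finset.mem_filter.2 ⟨hr, ?_⟩
    intro p hp q hq h
    have := hmin q hq
    have := h.1
    linarith
  have : ((HF S).filter fun x => dt d x.1 x.2 < 0).card ≤ ((ExpF S d).erase r).card := by
    apply Finset.card_le_card_of_injOn Prod.snd
    · rintro ⟨a, b⟩ h
      obtain ⟨h1, h2⟩ := Finset.mem_filter.1 h
      have h1 := (Finset.mem_filter.1 h1).2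
      simp only at h1 h2
      rw [Finset.mem_coe, Finset.mem_erase]
      refine ⟨?_, Finset.mem_filter.2 ⟨h1.2.1, hull_exp h1 h2⟩⟩
      rintro rfl
      have := hmin a h1.1
      linarith
    · rintro ⟨a, b⟩ h ⟨a', b'⟩ h' he
      simp only at he
      subst he
      have h1 := (Finset.mem_filter.1 (Finset.mem_filter.1 h).1).2
      have h2 := (Finset.mem_filter.1 (Finset.mem_filter.1 h').1).2
      exact Prod.ext (hull_unique hS h1 h2) rfl
  rw [Finset.card_erase_of_mem hr'] at this
  have := Finset.card_pos.2 ⟨r, hr'⟩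
  omega

lemma HF_card {S : Finset Pt} (hS : GP S) (hne : S.Nonempty) {d : Pt} (hd : Gen S d) :
    (HF S).card + 2 ≤ (ExpF S d).card + (ExpF S (-d)).card := by
  have h1 := HF_half hS hne d
  have h2 := HF_half hS hne (-d)
  have h3 : HF S ⊆ ((HF S).filter fun x => dt d x.1 x.2 < 0) ∪
      ((HF S).filter fun x => dt (-d) x.1 x.2 < 0) := by
    rintro ⟨a, b⟩ h
    have hp := (Finset.mem_filter.1 h).2
    rw [Finset.mem_union, Finset.mem_filter, Finset.mem_filter]
    rcases lt_or_gt_of_ne (hd a hp.1 b hp.2.1 hp.2.2.1) with k | k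
    · exact Or.inl ⟨h, k⟩
    · exact Or.inr ⟨h, by rw [dt_neg]; simp only; linarith⟩
  have h4 := (Finset.card_le_card h3).trans (Finset.card_union_le _ _)
  omega

/-- Interior points. -/
def IntF (S : Finset Pt) (d : Pt) : Finset Pt :=
  S.filter fun v => ¬ Expo S d v ∧ ¬ Expo S (-d) v

lemma int_card {S : Finset Pt} (hS : GP S) (hne : S.Nonempty) {d : Pt} (hd : Gen S d) :
    (IntF S d).card + (ExpF S d).card + (ExpF S (-d)).card ≤ S.card + 2 := by
  obtain ⟨r, hr, hmin⟩ := rightmost hne d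
  obtain ⟨l, hl, hmax⟩ := rightmost hne (-d)
  have h1 : ExpF S d ∩ ExpF S (-d) ⊆ {r, l} := by
    intro v hv
    obtain ⟨h1, h2⟩ := Finset.mem_inter.1 hv
    obtain ⟨hv, h1⟩ := Finset.mem_filter.1 h1
    obtain ⟨_, h2⟩ := Finset.mem_filter.1 h2
    rw [Finset.mem_insert, Finset.mem_singleton]
    rcases exp_both hS hd hv h1 h2 with k | k
    · left
      by_contra hc
      have k1 := k r hr
      have k2 := hmin v hv
      rw [dt_anti] at k1
      exact hd v hv r hr hc (by linarith)
    · right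
      by_contra hc
      have k1 := k l hl
      have k2 := hmax v hv
      rw [dt_neg] at k2
      rw [dt_anti] at k1
      exact hd v hv l hl hc (by linarith)
  have h2 := (Finset.card_le_card h1).trans Finset.card_le_two
  have h3 := Finset.card_union_add_card_inter (ExpF S d) (ExpF S (-d))
  have h4 : Disjoint (IntF S d) (ExpF S d ∪ ExpF S (-d)) := by
    rw [Finset.disjoint_left]
    intro v hv hv'
    obtain ⟨_, a, b⟩ := Finset.mem_filter.1 hv
    rcases Finset.mem_union.1 hv' with h | h
    · exact a (Finset.mem_filter.1 h).2
    · exact b (Finset.mem_filter.1 h).2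
  have h5 : IntF S d ∪ (ExpF S d ∪ ExpF S (-d)) ⊆ S :=
    Finset.union_subset (Finset.filter_subset _ _)
      (Finset.union_subset (Finset.filter_subset _ _) (Finset.filter_subset _ _))
  have h6 := Finset.card_le_card h5
  rw [Finset.card_union_of_disjoint h4] at h6
  omega

lemma supp_eq {S : Finset Pt} (M : PlaneGraph S) : supp M = (triSup S M.edges).ncard := rfl

lemma supp_lower {S : Finset Pt} (hS : GP S) {M : PlaneGraph S} (hM : IsPerfectMatching M)
    (k : ℕ) (hk : k + 3 ≤ M.edges.card) : 2 ^ k ≤ supp M := by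
  have hc := pm_card hM
  have hne : S.Nonempty := Finset.card_pos.1 (by omega)
  obtain ⟨d, hd⟩ := gen_exists S
  obtain ⟨T, hT, hMT⟩ := exists_tri M
  have hd0 : d ≠ 0 := by
    obtain ⟨v, hv⟩ := hne
    obtain ⟨u, hu, huv⟩ := Finset.exists_mem_ne (by omega : 1 < S.card) v
    exact gen_ne hd hv ⟨u, hu, huv⟩
  have key : ∀ v ∈ IntF S d, ∃ f g, s(v, f) ∈ T.edges ∧ s(v, g) ∈ T.edges ∧
      ∀ E : Finset (Sym2 Pt), M.edges ⊆ E → s(v, f) ∈ E → s(v, g) ∈ E → GoodAt E v := by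
    intro v hv
    obtain ⟨hv, h1, h2⟩ := Finset.mem_filter.1 hv
    obtain ⟨e, ⟨he, hve⟩, -⟩ := hM v hv
    obtain ⟨m, rfl⟩ := hve
    obtain ⟨f, g, a, b, c⟩ := three_good hS (good_of_nonexp hS hT hd hv h1 h2) (hMT he)
    exact ⟨f, g, a, b, fun E hE => c E (hE he)⟩
  choose! f g hf hg hgood using key
  let D : Finset (Sym2 Pt) := ((HF S).image fun x => s(x.1, x.2)) ∪ M.edges ∪
    (((IntF S d).image fun v => s(v, f v)) ∪ ((IntF S d).image fun v => s(v, g v)))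
  have hDT : D ⊆ T.edges := by
    refine Finset.union_subset (Finset.union_subset ?_ hMT) (Finset.union_subset ?_ ?_)
    · intro x hx
      obtain ⟨y, hy, rfl⟩ := Finset.mem_image.1 hx
      exact hull_edge hS hT (Finset.mem_filter.1 hy).2
    · intro x hx
      obtain ⟨y, hy, rfl⟩ := Finset.mem_image.1 hx
      exact hf y hy
    · intro x hx
      obtain ⟨y, hy, rfl⟩ := Finset.mem_image.1 hx
      exact hg y hy
  have hMD : M.edges ⊆ D := fun x hx =>
    Finset.mem_union_left _ (Finset.mem_union_right _ hx)
  have hD : GoodD S D := by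
    refine ⟨?_, ?_⟩
    · intro a ha b hb hab h
      refine Finset.mem_union_left _ (Finset.mem_union_left _ (Finset.mem_image.2 ⟨(a, b), ?_, rfl⟩))
      exact Finset.mem_filter.2 ⟨Finset.mem_product.2 ⟨ha, hb⟩, ha, hb, hab, h⟩
    · intro v hv
      by_cases h1 : Expo S d v
      · exact Or.inr (exp_supp hd hd0 hv h1)
      by_cases h2 : Expo S (-d) v
      · exact Or.inr (exp_supp hd.neg (neg_ne_zero.2 hd0) hv h2)
      left
      have hi : v ∈ IntF S d := Finset.mem_filter.2 ⟨hv, h1, h2⟩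
      exact hgood v hi D hMD
        (Finset.mem_union_right _ (Finset.mem_union_left _ (Finset.mem_image_of_mem _ hi)))
        (Finset.mem_union_right _ (Finset.mem_union_right _ (Finset.mem_image_of_mem _ hi)))
  have hcD : D.card ≤ (HF S).card + M.edges.card + ((IntF S d).card + (IntF S d).card) :=
    (Finset.card_union_le _ _).trans (Nat.add_le_add
      ((Finset.card_union_le _ _).trans (Nat.add_le_add Finset.card_image_le le_rfl))
      ((Finset.card_union_le _ _).trans (Nat.add_le_add Finset.card_image_le Finset.card_image_le)))
  have a1 := edges_ge hS hT hd
  have a2 := HF_card hS hne hd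
  have a3 := int_card hS hne hd
  have a4 := Finset.card_sdiff_add_card_eq_card hDT
  have := count_lower hS k T D hDT hD (by omega)
  rw [supp_eq]
  refine this.trans (Set.ncard_le_ncard ?_ (Set.toFinite _))
  rintro G ⟨g1, g2⟩
  exact ⟨g1, hMD.trans g2⟩

lemma supp_pos {S : Finset Pt} (M : PlaneGraph S) : 1 ≤ supp M := by
  obtain ⟨T, hT, hMT⟩ := exists_tri M
  rw [supp_eq, Nat.one_le_iff_ne_zero]
  exact Set.ncard_ne_zero_of_mem (a := T) ⟨hT, hMT⟩ (Set.toFinite _)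

lemma supp_bound {S : Finset Pt} (hS : GP S) {M : PlaneGraph S} (hM : IsPerfectMatching M)
    {n : ℕ} (hn : S.card = 2 * n) : 2 ^ n ≤ 8 * supp M := by
  have hc := pm_card hM
  have he : M.edges.card = n := by omega
  by_cases h : 3 ≤ n
  · have := supp_lower hS hM (n - 3) (by omega)
    have e : 2 ^ n = 8 * 2 ^ (n - 3) := by
      have : n = 3 + (n - 3) := by omega
      conv_lhs => rw [this, pow_add]
      norm_num
    rw [e]; omega
  · have h1 := supp_pos M
    have : 2 ^ n ≤ 2 ^ 3 := Nat.pow_le_pow_right (by norm_num) (by omega)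
    omega


end PartJ

section PartK

/-- Sign of the horizontal order. -/
def ff (d x y : Pt) : ℝ := if dt d y x < 0 then 1 else if 0 < dt d y x then -1 else 0

/-- Sign recording whether `u` is below the segment `xy`. -/
def bb (d x y u : Pt) : ℝ :=
  if dt d u x * dt d u y < 0 ∧ 0 < dt d y x * ori x y u then -1 else 1

lemma ff_r {d x y : Pt} (h : dt d y x < 0) : ff d x y = 1 := by
  unfold ff; rw [if_pos h]

lemma ff_l {d x y : Pt} (h : 0 < dt d y x) : ff d x y = -1 := by
  unfold ff; rw [if_neg (by linarith), if_pos h]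

lemma ff_anti (d x y : Pt) : ff d x y = - ff d y x := by
  have e := dt_anti d y x
  rcases lt_trichotomy (dt d y x) 0 with h | h | h
  · rw [ff_r h, ff_l (by linarith : 0 < dt d x y)]; norm_num
  · have h' : dt d x y = 0 := by linarith
    unfold ff
    rw [h, h']; norm_num
  · rw [ff_l h, ff_r (by linarith : dt d x y < 0)]

lemma ff_sq {d x y : Pt} (h : dt d y x ≠ 0) : ff d x y ^ 2 = 1 := by
  rcases lt_or_gt_of_ne h with h | h
  · rw [ff_r h]; norm_num
  · rw [ff_l h]; norm_num

lemma bb_sq (d x y u : Pt) : bb d x y u ^ 2 = 1 := by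
  unfold bb; split_ifs <;> norm_num

lemma bb_out {d x y u : Pt} (h : 0 ≤ dt d u x * dt d u y) : bb d x y u = 1 := by
  unfold bb; rw [if_neg]; rintro ⟨h1, h2⟩; linarith

lemma bb_symm (d x y u : Pt) : bb d x y u = bb d y x u := by
  unfold bb
  have e1 : dt d u x * dt d u y = dt d u y * dt d u x := mul_comm _ _
  have e2 : dt d y x * ori x y u = dt d x y * ori y x u := by unfold dt ori; ring
  rw [e1, e2]

lemma bb_neg {d x y u : Pt} (h1 : dt d u x * dt d u y < 0) (h2 : 0 < dt d y x * ori x y u) :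
    bb d x y u = -1 := by
  unfold bb; rw [if_pos ⟨h1, h2⟩]

lemma bb_pos {d x y u : Pt} (h2 : dt d y x * ori x y u < 0) :
    bb d x y u = 1 := by
  unfold bb; rw [if_neg]; rintro ⟨h1, h3⟩; linarith

lemma bb_1 (d x y : Pt) : bb d x y x = 1 := bb_out (by simp [dt])
lemma bb_2 (d x y : Pt) : bb d x y y = 1 := bb_out (by simp [dt])

/-- The local Kasteleyn sign. -/
def LF (d p₁ q₁ p₂ q₂ : Pt) : ℝ :=
  ff d p₁ p₂ * ff d q₁ q₂ * ff d p₁ q₂ * ff d p₂ q₁ *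
        (bb d p₁ q₁ p₂ * bb d p₁ q₁ q₂ * bb d p₂ q₂ p₁ * bb d p₂ q₂ q₁)

lemma LF_sw (d p₁ q₁ p₂ q₂ : Pt) : LF d p₁ q₁ p₂ q₂ = LF d p₂ q₂ p₁ q₁ := by
  unfold LF
  rw [ff_anti d p₁ p₂, ff_anti d q₁ q₂]; ring

lemma LF_fl (d p₁ q₁ p₂ q₂ : Pt) : LF d p₁ q₁ p₂ q₂ = LF d q₁ p₁ p₂ q₂ := by
  unfold LF
  rw [ff_anti d p₂ q₁, ff_anti d p₁ p₂, bb_symm d p₁ q₁ p₂, bb_symm d p₁ q₁ q₂]; ring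

lemma ident (d p₁ q₁ p₂ q₂ : Pt) : ori p₂ q₂ p₁ * dt d q₁ p₂ - ori p₂ q₂ q₁ * dt d p₁ p₂ =
    - ori p₁ q₁ p₂ * dt d q₂ p₂ := by unfold ori dt; ring

lemma ident' (d p₁ q₁ p₂ q₂ : Pt) : ori p₂ q₂ p₁ * dt d q₁ q₂ - ori p₂ q₂ q₁ * dt d p₁ q₂ =
    - ori p₁ q₁ q₂ * dt d q₂ p₂ := by unfold ori dt; ring

lemma loc0 {d p₁ q₁ p₂ q₂ : Pt} (a1 : dt d q₁ p₁ < 0) (a2 : dt d q₂ p₂ < 0) (a3 : dt d p₂ p₁ < 0)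
    (b1 : dt d q₁ p₂ ≠ 0) (b2 : dt d q₁ q₂ ≠ 0)
    (g1 : ori p₁ q₁ p₂ ≠ 0) (g2 : ori p₁ q₁ q₂ ≠ 0) (h2 : ori p₂ q₂ q₁ ≠ 0)
    (hcr : ¬ Cr p₁ q₁ p₂ q₂) : LF d p₁ q₁ p₂ q₂ = -1 := by
  have i1 := ident d p₁ q₁ p₂ q₂
  have i2 := ident' d p₁ q₁ p₂ q₂
  have t1 := dt_tri d q₂ p₂ p₁
  have n1 := dt_anti d p₁ q₁
  have n2 := dt_anti d p₂ q₂
  have n3 := dt_anti d p₁ p₂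
  have n4 := dt_anti d p₂ q₁
  have n5 := dt_anti d q₂ q₁
  have n6 := dt_anti d p₁ q₂
  unfold LF
  rw [ff_r a3, ff_r (by linarith : dt d q₂ p₁ < 0)]
  have o1 : bb d p₂ q₂ p₁ = 1 := bb_out (mul_nonneg (by linarith) (by linarith))
  rw [o1]
  rcases lt_or_gt_of_ne b1 with k | k
  · -- q₁ right of p₂
    rw [ff_r k]
    have bt : dt d p₂ p₁ * dt d p₂ q₁ < 0 := mul_neg_of_neg_of_pos a3 (by linarith)
    rcases lt_or_gt_of_ne b2 with l | l
    · -- nested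
      rw [ff_l (by linarith : 0 < dt d q₂ q₁)]
      have o2 : bb d p₂ q₂ q₁ = 1 := bb_out (mul_nonneg_of_nonpos_of_nonpos k.le l.le)
      have bt2 : dt d q₂ p₁ * dt d q₂ q₁ < 0 := mul_neg_of_neg_of_pos (by linarith) (by linarith)
      rw [o2]
      have same : 0 < ori p₁ q₁ p₂ * ori p₁ q₁ q₂ := by
        by_contra hc
        have hlt : ori p₁ q₁ p₂ * ori p₁ q₁ q₂ < 0 :=
          lt_of_le_of_ne (not_lt.1 hc) (mul_ne_zero g1 g2)
        have hh : 0 ≤ ori p₂ q₂ p₁ * ori p₂ q₂ q₁ := by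
          by_contra hc2
          exact hcr ⟨hlt, not_le.1 hc2⟩
        rcases lt_or_gt_of_ne h2 with s | s
        · have s1 : ori p₂ q₂ p₁ ≤ 0 := by
            by_contra hc2
            have := mul_neg_of_pos_of_neg (not_le.1 hc2) s
            linarith
          have w1 := mul_nonneg_of_nonpos_of_nonpos s1 k.le
          have w2 := mul_neg_of_neg_of_pos s (by linarith : 0 < dt d p₁ p₂)
          have w3 := mul_nonneg_of_nonpos_of_nonpos s1 l.le
          have w4 := mul_neg_of_neg_of_pos s (by linarith : 0 < dt d p₁ q₂)
          have y1 : 0 < ori p₁ q₁ p₂ := by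
            by_contra hc2
            have := mul_nonneg_of_nonpos_of_nonpos (not_lt.1 hc2) a2.le
            linarith
          have y2 : 0 < ori p₁ q₁ q₂ := by
            by_contra hc2
            have := mul_nonneg_of_nonpos_of_nonpos (not_lt.1 hc2) a2.le
            linarith
          linarith [mul_pos y1 y2]
        · have s1 : 0 ≤ ori p₂ q₂ p₁ := by
            by_contra hc2
            have := mul_neg_of_neg_of_pos (not_le.1 hc2) s
            linarith
          have w1 := mul_nonpos_of_nonneg_of_nonpos s1 k.le
          have w2 := mul_pos s (by linarith : 0 < dt d p₁ p₂)
          have w3 := mul_nonpos_of_nonneg_of_nonpos s1 l.le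
          have w4 := mul_pos s (by linarith : 0 < dt d p₁ q₂)
          have y1 : ori p₁ q₁ p₂ < 0 := by
            by_contra hc2
            have := mul_nonpos_of_nonneg_of_nonpos (not_lt.1 hc2) a2.le
            linarith
          have y2 : ori p₁ q₁ q₂ < 0 := by
            by_contra hc2
            have := mul_nonpos_of_nonneg_of_nonpos (not_lt.1 hc2) a2.le
            linarith
          linarith [mul_pos_of_neg_of_neg y1 y2]
      rcases lt_or_gt_of_ne g1 with s | s
      · have s' : ori p₁ q₁ q₂ < 0 := by
          by_contra hc
          linarith [mul_nonpos_of_nonpos_of_nonneg s.le (not_lt.1 hc)]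
        rw [bb_neg bt (mul_pos_of_neg_of_neg a1 s), bb_neg bt2 (mul_pos_of_neg_of_neg a1 s')]
        norm_num
      · have s' : 0 < ori p₁ q₁ q₂ := by
          by_contra hc
          linarith [mul_nonpos_of_nonneg_of_nonpos s.le (not_lt.1 hc)]
        rw [bb_pos (mul_neg_of_neg_of_pos a1 s), bb_pos (mul_neg_of_neg_of_pos a1 s')]
        norm_num
    · -- interleaved
      rw [ff_r (by linarith : dt d q₂ q₁ < 0)]
      have o2 : bb d p₁ q₁ q₂ = 1 := bb_out (mul_nonneg_of_nonpos_of_nonpos (by linarith) (by linarith))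
      rw [o2]
      have bt2 : dt d q₁ p₂ * dt d q₁ q₂ < 0 := mul_neg_of_neg_of_pos k l
      have opp : ori p₁ q₁ p₂ * ori p₂ q₂ q₁ < 0 := by
        by_contra hc
        have hpos : 0 ≤ ori p₁ q₁ p₂ * ori p₂ q₂ q₁ := not_lt.1 hc
        rcases lt_or_gt_of_ne h2 with s | s
        · have y : ori p₁ q₁ p₂ < 0 := by
            by_contra hc2
            have := mul_neg_of_pos_of_neg (lt_of_le_of_ne (not_lt.1 hc2) g1.symm) s
            linarith
          have w1 := mul_pos_of_neg_of_neg y a2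
          have w2 := mul_neg_of_neg_of_pos s (by linarith : 0 < dt d p₁ p₂)
          have y1 : 0 < ori p₂ q₂ p₁ := by
            by_contra hc2
            have := mul_nonneg_of_nonpos_of_nonpos (not_lt.1 hc2) k.le
            linarith
          have w3 := mul_pos y1 l
          have w4 := mul_neg_of_neg_of_pos s (by linarith : 0 < dt d p₁ q₂)
          have y2 : 0 < ori p₁ q₁ q₂ := by
            by_contra hc2
            have := mul_nonneg_of_nonpos_of_nonpos (not_lt.1 hc2) a2.le
            linarith
          exact hcr ⟨mul_neg_of_neg_of_pos y y2, mul_neg_of_pos_of_neg y1 s⟩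
        · have y : 0 < ori p₁ q₁ p₂ := by
            by_contra hc2
            have := mul_neg_of_neg_of_pos (lt_of_le_of_ne (not_lt.1 hc2) g1) s
            linarith
          have w1 := mul_neg_of_pos_of_neg y a2
          have w2 := mul_pos s (by linarith : 0 < dt d p₁ p₂)
          have y1 : ori p₂ q₂ p₁ < 0 := by
            by_contra hc2
            have := mul_nonpos_of_nonneg_of_nonpos (not_lt.1 hc2) k.le
            linarith
          have w3 := mul_neg_of_neg_of_pos y1 l
          have w4 := mul_pos s (by linarith : 0 < dt d p₁ q₂)
          have y2 : ori p₁ q₁ q₂ < 0 := by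
            by_contra hc2
            have := mul_nonpos_of_nonneg_of_nonpos (not_lt.1 hc2) a2.le
            linarith
          exact hcr ⟨mul_neg_of_pos_of_neg y y2, mul_neg_of_neg_of_pos y1 s⟩
      rcases lt_or_gt_of_ne g1 with s | s
      · have s' : 0 < ori p₂ q₂ q₁ := by
          by_contra hc
          linarith [mul_nonneg_of_nonpos_of_nonpos s.le (not_lt.1 hc)]
        rw [bb_neg bt (mul_pos_of_neg_of_neg a1 s), bb_pos (mul_neg_of_neg_of_pos a2 s')]
        norm_num
      · have s' : ori p₂ q₂ q₁ < 0 := by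
          by_contra hc
          linarith [mul_nonneg s.le (not_lt.1 hc)]
        rw [bb_pos (mul_neg_of_neg_of_pos a1 s), bb_neg bt2 (mul_pos_of_neg_of_neg a2 s')]
        norm_num
  · -- disjoint
    have t2 := dt_tri d q₂ p₂ q₁
    have t3 := dt_tri d q₂ q₁ p₁
    have c1 : bb d p₁ q₁ p₂ = 1 := bb_out (mul_nonneg_of_nonpos_of_nonpos (by linarith) (by linarith))
    have c2 : bb d p₁ q₁ q₂ = 1 := bb_out (mul_nonneg_of_nonpos_of_nonpos (by linarith) (by linarith))
    have c3 : bb d p₂ q₂ q₁ = 1 := bb_out (mul_nonneg (by linarith) (by linarith))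
    rw [ff_l k, ff_r (by linarith : dt d q₂ q₁ < 0), c1, c2, c3]
    norm_num

lemma loc {S : Finset Pt} (hS : GP S) {d : Pt} (hd : Gen S d) {p₁ q₁ p₂ q₂ : Pt}
    (m1 : p₁ ∈ S) (m2 : q₁ ∈ S) (m3 : p₂ ∈ S) (m4 : q₂ ∈ S)
    (e1 : p₁ ≠ q₁) (e2 : p₁ ≠ p₂) (e3 : p₁ ≠ q₂) (e4 : q₁ ≠ p₂) (e5 : q₁ ≠ q₂) (e6 : p₂ ≠ q₂)
    (hcr : ¬ Cr p₁ q₁ p₂ q₂) : LF d p₁ q₁ p₂ q₂ = -1 := by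
  have A : ∀ p₁ ∈ S, ∀ q₁ ∈ S, ∀ p₂ ∈ S, ∀ q₂ ∈ S, p₁ ≠ q₁ → p₁ ≠ p₂ → p₁ ≠ q₂ → q₁ ≠ p₂ →
      q₁ ≠ q₂ → p₂ ≠ q₂ → ¬ Cr p₁ q₁ p₂ q₂ → dt d q₁ p₁ < 0 → dt d q₂ p₂ < 0 →
      LF d p₁ q₁ p₂ q₂ = -1 := by
    intro p₁ m1 q₁ m2 p₂ m3 q₂ m4 e1 e2 e3 e4 e5 e6 hcr a1 a2
    rcases lt_or_gt_of_ne (hd p₂ m3 p₁ m1 e2.symm) with a3 | a3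
    · exact loc0 a1 a2 a3 (hd _ m2 _ m3 e4) (hd _ m2 _ m4 e5) (hS _ m1 _ m2 _ m3 e1 e2 e4)
        (hS _ m1 _ m2 _ m4 e1 e3 e5) (hS _ m3 _ m4 _ m2 e6 e4.symm e5.symm) hcr
    · rw [LF_sw]
      exact loc0 a2 a1 (by rw [dt_anti]; linarith) (hd _ m4 _ m1 e3.symm) (hd _ m4 _ m2 e5.symm)
        (hS _ m3 _ m4 _ m1 e6 e2.symm e3.symm) (hS _ m3 _ m4 _ m2 e6 e4.symm e5.symm)
        (hS _ m1 _ m2 _ m4 e1 e3 e5) (fun h => hcr (Cr_symm h))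
  have B : ∀ p₁ ∈ S, ∀ q₁ ∈ S, ∀ p₂ ∈ S, ∀ q₂ ∈ S, p₁ ≠ q₁ → p₁ ≠ p₂ → p₁ ≠ q₂ → q₁ ≠ p₂ →
      q₁ ≠ q₂ → p₂ ≠ q₂ → ¬ Cr p₁ q₁ p₂ q₂ → dt d q₂ p₂ < 0 →
      LF d p₁ q₁ p₂ q₂ = -1 := by
    intro p₁ m1 q₁ m2 p₂ m3 q₂ m4 e1 e2 e3 e4 e5 e6 hcr a2
    rcases lt_or_gt_of_ne (hd q₁ m2 p₁ m1 e1.symm) with a1 | a1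
    · exact A p₁ m1 q₁ m2 p₂ m3 q₂ m4 e1 e2 e3 e4 e5 e6 hcr a1 a2
    · rw [LF_fl]
      exact A q₁ m2 p₁ m1 p₂ m3 q₂ m4 e1.symm e4 e5 e2 e3 e6 (fun h => hcr (Cr_flip' h))
        (by rw [dt_anti]; linarith) a2
  rcases lt_or_gt_of_ne (hd q₂ m4 p₂ m3 e6.symm) with a2 | a2
  · exact B p₁ m1 q₁ m2 p₂ m3 q₂ m4 e1 e2 e3 e4 e5 e6 hcr a2
  · rw [LF_sw, LF_fl, LF_sw]
    exact B p₁ m1 q₁ m2 q₂ m4 p₂ m3 e1 e3 e2 e5 e4 e6.symm (fun h => hcr (Cr_flip h))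
      (by rw [dt_anti]; linarith)


end PartK

section PartL

/-- Signed adjacency matrix. -/
def KA {S : Finset Pt} (T : PlaneGraph S) (d : Pt) : Matrix {p // p ∈ S} {p // p ∈ S} ℝ :=
  fun x y => if s(x.1, y.1) ∈ T.edges then ff d x.1 y.1 * ∏ u : {p // p ∈ S}, bb d x.1 y.1 u.1 else 0

lemma KA_ne {S : Finset Pt} {T : PlaneGraph S} {d : Pt} (hd : Gen S d) (x y : {p // p ∈ S}) :
    KA T d x y ≠ 0 ↔ s(x.1, y.1) ∈ T.edges := by
  unfold KA
  constructor
  · intro h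
    by_contra hc
    rw [if_neg hc] at h
    exact h rfl
  · intro h
    rw [if_pos h]
    apply mul_ne_zero
    · have := ff_sq (hd y.1 y.2 x.1 x.2 (edge_ne T h).symm)
      intro h0
      rw [h0] at this
      norm_num at this
    · rw [Finset.prod_ne_zero_iff]
      intro u _ h0
      have := bb_sq d x.1 y.1 u.1
      rw [h0] at this
      norm_num at this

/-- Perfect matchings contained in `T`. -/
def pmSub {S : Finset Pt} (T : PlaneGraph S) : Set (PlaneGraph S) :=
  {M | IsPerfectMatching M ∧ M.edges ⊆ T.edges}

lemma partner {S : Finset Pt} {M : PlaneGraph S} (hM : IsPerfectMatching M) (p : {p // p ∈ S}) :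
    ∃ q : {p // p ∈ S}, s(p.1, q.1) ∈ M.edges := by
  obtain ⟨e, ⟨he, hp⟩, -⟩ := hM p.1 p.2
  obtain ⟨q, rfl⟩ := hp
  exact ⟨⟨q, edge_r M he⟩, he⟩

lemma partner_unique {S : Finset Pt} {M : PlaneGraph S} (hM : IsPerfectMatching M)
    {p q r : Pt} (h1 : s(p, q) ∈ M.edges) (h2 : s(p, r) ∈ M.edges) : q = r := by
  have h := (hM p (edge_l M h1)).unique ⟨h1, Sym2.mem_mk_left _ _⟩ ⟨h2, Sym2.mem_mk_left _ _⟩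
  exact Sym2.congr_right.1 h

/-- The partner function. -/
def pf {S : Finset Pt} {M : PlaneGraph S} (hM : IsPerfectMatching M) (p : {p // p ∈ S}) :
    {p // p ∈ S} := (partner hM p).choose

lemma pf_spec {S : Finset Pt} {M : PlaneGraph S} (hM : IsPerfectMatching M) (p : {p // p ∈ S}) :
    s(p.1, (pf hM p).1) ∈ M.edges := (partner hM p).choose_spec

lemma pf_inv {S : Finset Pt} {M : PlaneGraph S} (hM : IsPerfectMatching M) :
    Function.Involutive (pf hM) := by
  intro p
  apply Subtype.ext
  exact partner_unique hM (pf_spec hM (pf hM p)) (edge_symm (pf_spec hM p))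

/-- The permutation of a matching. -/
def mperm {S : Finset Pt} (M : PlaneGraph S) : Equiv.Perm {p // p ∈ S} :=
  if h : IsPerfectMatching M then (pf_inv h).toPerm else 1

lemma mperm_apply {S : Finset Pt} {M : PlaneGraph S} (hM : IsPerfectMatching M)
    (p : {p // p ∈ S}) : mperm M p = pf hM p := by
  unfold mperm; rw [dif_pos hM]; rfl

lemma pm_edges {S : Finset Pt} {M : PlaneGraph S} (hM : IsPerfectMatching M) :
    M.edges = Finset.univ.image fun p : {p // p ∈ S} => s(p.1, (mperm M p).1) := by
  ext e
  rw [Finset.mem_image]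
  constructor
  · intro he
    induction e using Sym2.ind with | _ a b => ?_
    refine ⟨⟨a, edge_l M he⟩, Finset.mem_univ _, ?_⟩
    rw [mperm_apply hM, partner_unique hM (pf_spec hM ⟨a, edge_l M he⟩) he]
  · rintro ⟨p, -, rfl⟩
    rw [mperm_apply hM]
    exact pf_spec hM p

lemma mem_matchPerms {ι : Type} [Fintype ι] (A : Matrix ι ι ℝ) (μ : Equiv.Perm ι) :
    μ ∈ matchPerms A ↔ μ * μ = 1 ∧ ∀ x, μ x ≠ x ∧ A x (μ x) ≠ 0 := by
  unfold matchPerms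
  rw [Finset.mem_filter]
  exact ⟨fun h => h.2, fun h => ⟨Finset.mem_univ _, h⟩⟩

lemma pmSub_le {S : Finset Pt} (T : PlaneGraph S) {d : Pt} (hd : Gen S d) :
    (pmSub T).ncard ≤ (matchPerms (KA T d)).card := by
  rw [← Set.ncard_coe_finset]
  apply Set.ncard_le_ncard_of_injOn mperm
  · rintro M ⟨hM, hMT⟩
    rw [Finset.mem_coe]
    rw [mem_matchPerms]
    refine ⟨?_, ?_⟩
    · refine Equiv.ext fun x => ?_
      rw [Equiv.Perm.mul_apply, mperm_apply hM, mperm_apply hM, pf_inv hM]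
      rfl
    · intro x
      rw [mperm_apply hM]
      refine ⟨?_, (KA_ne hd _ _).2 (hMT (pf_spec hM x))⟩
      intro h
      have := edge_ne M (pf_spec hM x)
      rw [h] at this
      exact this rfl
  · rintro M ⟨hM, -⟩ M' ⟨hM', -⟩ he
    apply pg_ext
    rw [pm_edges hM, pm_edges hM', he]

lemma deg_sum {S : Finset Pt} (hS : GP S) {T : PlaneGraph S} (hT : IsTriangulation T) {d : Pt}
    (hd : Gen S d) :
    ∑ x : {p // p ∈ S}, (Finset.univ.filter fun y => KA T d x y ≠ 0).card ≤ 6 * S.card := by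
  rw [← Finset.card_sigma]
  have h1 : (Finset.univ.sigma fun x : {p // p ∈ S} =>
      Finset.univ.filter fun y => KA T d x y ≠ 0).card ≤
      (RE T d ∪ (RE T d).image Prod.swap).card := by
    apply Finset.card_le_card_of_injOn (fun z => ((z.1.1, z.2.1) : Pt × Pt))
    · rintro ⟨x, y⟩ h
      have h := (Finset.mem_filter.1 (Finset.mem_sigma.1 h).2).2
      simp only at h
      rw [KA_ne hd] at h
      rw [Finset.mem_coe, Finset.mem_union, Finset.mem_image]
      simp only
      rcases lt_or_gt_of_ne (hd y.1 y.2 x.1 x.2 (edge_ne T h).symm) with k | k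
      · exact Or.inl (mem_RE.2 ⟨h, k⟩)
      · exact Or.inr ⟨(y.1, x.1), mem_RE.2 ⟨edge_symm h, by rw [dt_anti]; linarith⟩, rfl⟩
    · rintro ⟨x, y⟩ - ⟨x', y'⟩ - he
      have e1 : x = x' := Subtype.ext (congrArg Prod.fst he)
      have e2 : y = y' := Subtype.ext (congrArg Prod.snd he)
      rw [e1, e2]
  have h2 := Finset.card_union_le (RE T d) ((RE T d).image Prod.swap)
  have h3 : ((RE T d).image Prod.swap).card ≤ (RE T d).card := Finset.card_image_le
  have h4 := RE_card T hd
  have h5 := edges_le hS hT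
  omega

lemma pm_in_tri {S : Finset Pt} (hS : GP S) {T : PlaneGraph S} (hT : IsTriangulation T) {n : ℕ}
    (hn : S.card = n + n) : ((pmSub T).ncard : ℝ) ^ 4 ≤ 6 ^ S.card := by
  obtain ⟨d, hd⟩ := gen_exists S
  have hc : Fintype.card {p // p ∈ S} = S.card := Fintype.card_coe S
  have hK := kasteleyn_bound n (by rw [hc, hn]) (KA T d) (fun x y => ff d x.1 y.1)
    (fun x y u => bb d x.1 y.1 u.1) (fun x y => ff_anti _ _ _)
    (fun x y h => ff_sq (hd y.1 y.2 x.1 x.2 (fun e => h (Subtype.ext e.symm))))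
    (fun x y => bb_1 _ _ _) (fun x y => bb_2 _ _ _) (fun x y u => bb_sq _ _ _ _)
    (by
      ext x y
      rw [Matrix.transpose_apply, Matrix.neg_apply]
      unfold KA
      rw [Sym2.eq_swap, ff_anti d y.1 x.1]
      by_cases h : s(x.1, y.1) ∈ T.edges
      · rw [if_pos h, if_pos h, neg_mul]
        congr 2
        exact Finset.prod_congr rfl fun u _ => bb_symm _ _ _ _
      · rw [if_neg h, if_neg h, neg_zero])
    (by
      intro x y h
      have h' := (KA_ne hd x y).1 h
      unfold KA
      rw [if_pos h'])
    (by
      intro p₁ q₁ p₂ q₂ e1 e2 e3 e4 e5 e6 a1 a2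
      have a1 := (KA_ne hd _ _).1 a1
      have a2 := (KA_ne hd _ _).1 a2
      exact loc hS hd p₁.2 q₁.2 p₂.2 q₂.2 (fun e => e1 (Subtype.ext e))
        (fun e => e2 (Subtype.ext e)) (fun e => e3 (Subtype.ext e))
        (fun e => e4 (Subtype.ext e)) (fun e => e5 (Subtype.ext e))
        (fun e => e6 (Subtype.ext e)) (not_cr T a1 a2))
    (by
      rw [hc]
      have := deg_sum hS hT hd
      exact_mod_cast this)
  rw [hc] at hK
  refine le_trans ?_ hK
  have : ((pmSub T).ncard : ℝ) ≤ ((matchPerms (KA T d)).card : ℝ) := by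
    exact_mod_cast pmSub_le T hd
  exact pow_le_pow_left₀ (Nat.cast_nonneg _) this 4

instance pgFintype (S : Finset Pt) : Fintype (PlaneGraph S) := Fintype.ofFinite _

lemma double_count {S : Finset Pt} (hS : GP S) {n : ℕ} (hn : S.card = 2 * n) :
    2 ^ n * pmCount S ≤
      8 * ∑ T : {T : PlaneGraph S // IsTriangulation T}, (pmSub T.1).ncard := by
  have h1 : 2 ^ n * pmCount S ≤
      8 * ∑ M : {G : PlaneGraph S // IsPerfectMatching G}, supp M.1 := by
    unfold pmCount
    rw [Nat.card_eq_fintype_card, ← Finset.card_univ, mul_comm, ← smul_eq_mul, ← Finset.sum_const,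
      Finset.mul_sum]
    exact Finset.sum_le_sum fun M _ => supp_bound hS M.2 hn
  have h2 : ∑ M : {G : PlaneGraph S // IsPerfectMatching G}, supp M.1 =
      ∑ T : {T : PlaneGraph S // IsTriangulation T}, (pmSub T.1).ncard := by
    have h := Finset.sum_card_bipartiteAbove_eq_sum_card_bipartiteBelow
      (s := (Finset.univ : Finset {G : PlaneGraph S // IsPerfectMatching G}))
      (t := (Finset.univ : Finset {T : PlaneGraph S // IsTriangulation T}))
      (fun M T => M.1.edges ⊆ T.1.edges)
    refine (Eq.trans ?_ h).trans ?_
    · refine Finset.sum_congr rfl fun M _ => ?_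
      rw [supp_eq, ← Finset.card_map (Function.Embedding.subtype _), ← Set.ncard_coe_finset]
      congr 1
      ext T
      simp [triSup, Finset.bipartiteAbove, and_comm]
    · refine Finset.sum_congr rfl fun T _ => ?_
      rw [← Finset.card_map (Function.Embedding.subtype _), ← Set.ncard_coe_finset]
      congr 1
      ext M
      simp [pmSub, Finset.bipartiteBelow, and_comm]
  rw [← h2]; exact h1

lemma final_bound {S : Finset Pt} (hS : GP S) :
    (pmCount S : ℝ) ≤ 8 * ((3 : ℝ) / 2) ^ ((S.card : ℝ) / 4) * (triCount S : ℝ) := by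
  by_cases h0 : pmCount S = 0
  · rw [h0, Nat.cast_zero]
    exact mul_nonneg (mul_nonneg (by norm_num) (Real.rpow_nonneg (by norm_num) _)) (Nat.cast_nonneg _)
  obtain ⟨M, hM⟩ : ∃ M : PlaneGraph S, IsPerfectMatching M := by
    by_contra hc
    push Not at hc
    apply h0
    have : IsEmpty {G : PlaneGraph S // IsPerfectMatching G} := ⟨fun G => hc G.1 G.2⟩
    exact Nat.card_of_isEmpty
  have hn := pm_card hM
  set n := M.edges.card
  have hN : (S.card : ℝ) = 2 * n := by exact_mod_cast hn
  have hd := double_count hS hn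
  have hb : ∀ T : {T : PlaneGraph S // IsTriangulation T},
      ((pmSub T.1).ncard : ℝ) ≤ (6 : ℝ) ^ ((S.card : ℝ) / 4) := by
    intro T
    have h := pm_in_tri hS T.2 (n := n) (by omega)
    have e : ((6 : ℝ) ^ ((S.card : ℝ) / 4)) ^ 4 = 6 ^ S.card := by
      rw [← Real.rpow_natCast, ← Real.rpow_mul (by norm_num), ← Real.rpow_natCast]
      congr 1
      push_cast
      ring
    rw [← e] at h
    exact le_of_pow_le_pow_left₀ (by norm_num) (Real.rpow_nonneg (by norm_num) _) h
  have hs : (∑ T : {T : PlaneGraph S // IsTriangulation T}, ((pmSub T.1).ncard : ℝ)) ≤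
      (triCount S : ℝ) * (6 : ℝ) ^ ((S.card : ℝ) / 4) := by
    refine (Finset.sum_le_sum fun T _ => hb T).trans ?_
    rw [Finset.sum_const, nsmul_eq_mul, Finset.card_univ, ← Nat.card_eq_fintype_card]
    exact le_rfl
  have hd' : (2 : ℝ) ^ n * (pmCount S : ℝ) ≤
      8 * ∑ T : {T : PlaneGraph S // IsTriangulation T}, ((pmSub T.1).ncard : ℝ) := by
    exact_mod_cast hd
  have e2 : (6 : ℝ) ^ ((S.card : ℝ) / 4) = 2 ^ n * ((3 : ℝ) / 2) ^ ((S.card : ℝ) / 4) := by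
    have e3 : (2 : ℝ) ^ n = 4 ^ ((S.card : ℝ) / 4) := by
      rw [hN, ← Real.rpow_natCast, show (4 : ℝ) = 2 ^ (2 : ℝ) by norm_num,
        ← Real.rpow_mul (by norm_num)]
      congr 1
      ring
    rw [e3, ← Real.mul_rpow (by norm_num) (by norm_num)]
    norm_num
  rw [e2] at hs
  have hp : (0 : ℝ) < 2 ^ n := pow_pos (by norm_num) n
  refine le_of_mul_le_mul_left ?_ hp
  refine hd'.trans ?_
  refine (mul_le_mul_of_nonneg_left hs (by norm_num : (0 : ℝ) ≤ 8)).trans (le_of_eq ?_)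
  ring


end PartL

/-- For every set `S` of `N` points in general position,
`pm(S) ≤ 8 · (3/2)^{N/4} · tr(S)`. -/
theorem statement2 :
    ∀ S : Finset Pt, GenPos S →
      (pmCount S : ℝ) ≤ 8 * ((3 : ℝ) / 2) ^ ((S.card : ℝ) / 4) * (triCount S : ℝ) := by
  intro S hS
  exact final_bound (gp_of_genPos hS)

end
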